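/- arXiv:math/0201296 — 13 statements merged into one kernel-verified Lean document; each statement's English description precedes it below -/
import Mathlib

section
/- Let Ω be an open subset of ℝⁿ and let u : Ω → ℝ be continuous. Then the set of points x ∈ Ω at which the subdifferential ∂⁻u(x) is nonempty is dense in Ω, and likewise the set of points at which the superdifferential ∂⁺u(x) is nonempty is dense in Ω. -/
/-- The superdifferential of `u` at `x`. -/
def superdiff {E : Type*} [NormedAddCommGroup E] [NormedSpace ℝ E]
    (u : E → ℝ) (x : E) : Set (E →L[ℝ] ℝ) :=
  {p | ∃ φ : E → ℝ, ContDiff ℝ 1 φ ∧ fderiv ℝ φ x = p ∧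
    IsLocalMin (fun y => φ y - u y) x}

/-- The subdifferential of `u` at `x`. -/
def subdiff {E : Type*} [NormedAddCommGroup E] [NormedSpace ℝ E]
    (u : E → ℝ) (x : E) : Set (E →L[ℝ] ℝ) :=
  {p | ∃ ψ : E → ℝ, ContDiff ℝ 1 ψ ∧ fderiv ℝ ψ x = p ∧
    IsLocalMax (fun y => ψ y - u y) x}

theorem exists_superdiff_near {n : ℕ}
    {Ω : Set (EuclideanSpace ℝ (Fin n))} (hΩ : IsOpen Ω)
    {u : EuclideanSpace ℝ (Fin n) → ℝ} (hu : ContinuousOn u Ω) :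
    Ω ⊆ closure {x ∈ Ω | (superdiff u x).Nonempty} := by
  intro x hx
  rw [Metric.mem_closure_iff]
  intro ε hε
  obtain ⟨δ, hδ, hball⟩ := Metric.isOpen_iff.1 hΩ x hx
  obtain ⟨r, hr, hrm⟩ := exists_between (lt_min hε hδ)
  have hrε : r < ε := lt_of_lt_of_le hrm (min_le_left _ _)
  have hrδ : r < δ := lt_of_lt_of_le hrm (min_le_right _ _)
  have hsub : Metric.closedBall x r ⊆ Ω :=
    (Metric.closedBall_subset_ball hrδ).trans hball
  have hcont : ContinuousOn u (Metric.closedBall x r) := hu.mono hsub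
  have hcomp : IsCompact (Metric.closedBall x r) := isCompact_closedBall x r
  obtain ⟨C, hC⟩ := hcomp.exists_bound_of_continuousOn hcont
  have hxm : x ∈ Metric.closedBall x r := Metric.mem_closedBall_self hr.le
  obtain ⟨K, hK⟩ : ∃ K : ℝ, K * r ^ 2 = 2 * C + 1 :=
    ⟨(2 * C + 1) / r ^ 2, by field_simp⟩
  have hsm : ContDiff ℝ 1 (fun y : EuclideanSpace ℝ (Fin n) => K * ‖y - x‖ ^ 2) :=
    contDiff_const.mul ((contDiff_id.sub contDiff_const).norm_sq ℝ)
  obtain ⟨z, hz, hmin⟩ := hcomp.exists_isMinOn ⟨x, hxm⟩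
    (hsm.continuous.continuousOn.sub hcont)
  have hzr : dist z x < r := by
    refine lt_of_le_of_ne (Metric.mem_closedBall.1 hz) fun h => ?_
    have h1 := isMinOn_iff.1 hmin x hxm
    have h2 := abs_le.1 (hC z hz)
    have h3 := abs_le.1 (hC x hxm)
    rw [dist_eq_norm] at h
    simp only [h, hK, Pi.sub_apply, sub_self, norm_zero] at h1
    norm_num at h1
    linarith [h2.2, h3.1]
  refine ⟨z, ⟨hsub hz, _, _, hsm, rfl, ?_⟩, ?_⟩
  · exact hmin.isLocalMin (Filter.mem_of_superset (Metric.isOpen_ball.mem_nhds hzr)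
      Metric.ball_subset_closedBall)
  · rw [dist_comm]; exact hzr.trans hrε

theorem subdiff_nonempty_of_superdiff_neg {E : Type*} [NormedAddCommGroup E] [NormedSpace ℝ E]
    {u : E → ℝ} {x : E} (h : (superdiff (fun y => - u y) x).Nonempty) :
    (subdiff u x).Nonempty := by
  obtain ⟨p, φ, hφ, -, hm⟩ := h
  refine ⟨_, fun y => - φ y, hφ.neg, rfl, ?_⟩
  have := hm.neg
  have e : (fun y => - φ y - u y) = fun y => - (φ y - - u y) := by
    funext y; ring
  rw [e]
  exact this

theorem dense_nonempty_subdiff_superdiff {n : ℕ}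
    {Ω : Set (EuclideanSpace ℝ (Fin n))} (hΩ : IsOpen Ω)
    {u : EuclideanSpace ℝ (Fin n) → ℝ} (hu : ContinuousOn u Ω) :
    Ω ⊆ closure {x ∈ Ω | (subdiff u x).Nonempty} ∧
    Ω ⊆ closure {x ∈ Ω | (superdiff u x).Nonempty} := by
  refine ⟨?_, exists_superdiff_near hΩ hu⟩
  refine (exists_superdiff_near hΩ hu.neg).trans (closure_mono ?_)
  rintro y ⟨hy, h⟩
  exact ⟨hy, subdiff_nonempty_of_superdiff_neg h⟩
end

section
/- Let u be a locally semiconcave function on an open set Ω ⊆ ℝⁿ. Then the superdifferential ∂⁺u(x) is nonempty at every point x ∈ Ω, and ∂⁺u is upper semicontinuous in the following sense: if x_k ∈ Ω with x_k → x ∈ Ω, v_k ∈ ∂⁺u(x_k), and v_k → v, then v ∈ ∂⁺u(x). -/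
open Filter Topology

/-- `u` is locally semiconcave on `Ω`: it is continuous on `Ω` and on every open convex
set with compact closure contained in `Ω` it satisfies a one-sided second difference
estimate. -/
def LocallySemiconcaveOn {E : Type*} [NormedAddCommGroup E] [NormedSpace ℝ E]
    (u : E → ℝ) (Ω : Set E) : Prop :=
  ContinuousOn u Ω ∧
  ∀ Ω' : Set E, IsOpen Ω' → Convex ℝ Ω' → IsCompact (closure Ω') → closure Ω' ⊆ Ω →
    ∃ C : ℝ, ∀ x h, x ∈ Ω' → x + h ∈ Ω' → x - h ∈ Ω' →
      u (x + h) + u (x - h) - 2 * u x ≤ 2 * C * ‖h‖ ^ 2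

lemma aux_mid1 (f : ℝ → ℝ) (hf : ContinuousOn f (Set.Icc 0 1))
    (hm : ∀ a h, a ∈ Set.Icc (0:ℝ) 1 → a + h ∈ Set.Icc (0:ℝ) 1 → a - h ∈ Set.Icc (0:ℝ) 1 →
      2 * f a ≤ f (a + h) + f (a - h))
    (h0 : f 0 ≤ 0) (h1 : f 1 ≤ 0) : ∀ t ∈ Set.Icc (0:ℝ) 1, f t ≤ 0 := by
  intro t ht
  by_contra! hpos
  obtain ⟨b, hb, hbmax⟩ := isCompact_Icc.exists_isMaxOn ⟨t, ht⟩ hf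
  have hbmax' : ∀ y ∈ Set.Icc (0:ℝ) 1, f y ≤ f b := fun y hy => hbmax hy
  have hK : IsCompact (Set.Icc (0:ℝ) 1 ∩ f ⁻¹' {f b}) :=
    isCompact_Icc.of_isClosed_subset
      (hf.preimage_isClosed_of_isClosed isClosed_Icc isClosed_singleton) Set.inter_subset_left
  obtain ⟨c, ⟨hc, hcb⟩, hcmin⟩ := hK.exists_isLeast ⟨b, hb, rfl⟩
  have hcb' : f c = f b := hcb
  have hMpos : 0 < f c := by rw [hcb']; exact hpos.trans_le (hbmax' t ht)
  have hc0 : 0 < c := by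
    rcases hc.1.eq_or_lt with h | h
    · rw [← h] at hMpos; linarith
    · exact h
  have hc1 : c < 1 := by
    rcases hc.2.eq_or_lt with h | h
    · rw [h] at hMpos; linarith
    · exact h
  obtain ⟨δ, hδ, hδ1, hδ2⟩ : ∃ δ > 0, δ ≤ c ∧ δ ≤ 1 - c :=
    ⟨min c (1 - c), lt_min hc0 (by linarith), min_le_left _ _, min_le_right _ _⟩
  have hp : c + δ ∈ Set.Icc (0:ℝ) 1 := ⟨by linarith, by linarith⟩
  have hq : c - δ ∈ Set.Icc (0:ℝ) 1 := ⟨by linarith, by linarith⟩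
  have e1 := hm c δ hc hp hq
  have e2 := hbmax' _ hp
  have e3 : f (c - δ) < f b := by
    refine lt_of_le_of_ne (hbmax' _ hq) fun h => ?_
    have := hcmin ⟨hq, h⟩
    linarith
  linarith

lemma aux_convex {E : Type*} [NormedAddCommGroup E] [NormedSpace ℝ E] {s : Set E}
    (hs : Convex ℝ s) {F : E → ℝ} (hF : ContinuousOn F s)
    (hm : ∀ a h, a ∈ s → a + h ∈ s → a - h ∈ s → 2 * F a ≤ F (a + h) + F (a - h)) :
    ConvexOn ℝ s F := by
  refine ⟨hs, fun x hx y hy a b ha hb hab => ?_⟩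
  have hmem : ∀ t ∈ Set.Icc (0:ℝ) 1, x + t • (y - x) ∈ s := fun t ht =>
    hs.add_smul_sub_mem hx hy ht
  have key := aux_mid1 (fun t => F (x + t • (y - x)) - ((1 - t) * F x + t * F y))
    (by
      refine ContinuousOn.sub (hF.comp (by fun_prop) hmem) (by fun_prop))
    (by
      intro c h hc hp hq
      have e := hm (x + c • (y - x)) (h • (y - x)) (hmem c hc)
        (by have := hmem _ hp; rwa [add_smul, ← add_assoc] at this)
        (by have := hmem _ hq; rwa [sub_smul, ← add_sub_assoc] at this)
      have e1 : x + c • (y - x) + h • (y - x) = x + (c + h) • (y - x) := by module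
      have e2 : x + c • (y - x) - h • (y - x) = x + (c - h) • (y - x) := by module
      rw [e1, e2] at e
      linarith)
    (by simp) (by simp) b ⟨hb, by linarith⟩
  have e : a • x + b • y = x + b • (y - x) := by
    obtain rfl : a = 1 - b := by linarith
    module
  obtain rfl : a = 1 - b := by linarith
  rw [e, smul_eq_mul, smul_eq_mul]
  linarith

lemma aux_support {E : Type*} [NormedAddCommGroup E] [NormedSpace ℝ E] {s : Set E}
    {F G : E → ℝ} (hF : ConvexOn ℝ s F) {z y : E} (hz : z ∈ s) (hy : y ∈ s)
    (hG : ∀ᶠ w in 𝓝 z, G w - G z ≤ F w - F z) {q : E →L[ℝ] ℝ} (hq : HasFDerivAt G q z) :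
    q (y - z) ≤ F y - F z := by
  have hl : HasDerivAt (fun t : ℝ => z + t • (y - z)) (y - z) 0 := by
    simpa using ((hasDerivAt_id (0:ℝ)).smul_const (y - z)).const_add z
  have hd : HasDerivAt (fun t : ℝ => G (z + t • (y - z))) (q (y - z)) 0 := by
    have hq' : HasFDerivAt G q ((fun t : ℝ => z + t • (y - z)) 0) := by simpa using hq
    exact hq'.comp_hasDerivAt (0:ℝ) hl
  have ht := hd.tendsto_slope_zero_right
  have hc : Tendsto (fun t : ℝ => z + t • (y - z)) (𝓝[>] 0) (𝓝 z) := by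
    have := hl.continuousAt.tendsto
    simp only [zero_smul, add_zero] at this
    exact this.mono_left nhdsWithin_le_nhds
  refine le_of_tendsto ht ?_
  have h1 : ∀ᶠ t : ℝ in 𝓝[>] 0, t ∈ Set.Ioo (0:ℝ) 1 := Ioo_mem_nhdsGT one_pos
  filter_upwards [hc.eventually hG, h1] with t h2 h3
  have h4 := hF.2 hz hy (by linarith [h3.2] : (0:ℝ) ≤ 1 - t) h3.1.le (by ring)
  have e : (1 - t) • z + t • y = z + t • (y - z) := by module
  rw [e, smul_eq_mul, smul_eq_mul] at h4
  simp only [zero_add, zero_smul, add_zero, smul_eq_mul]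
  rw [inv_mul_le_iff₀ h3.1]
  linarith

lemma aux_subgrad {E : Type*} [NormedAddCommGroup E] [NormedSpace ℝ E] {s : Set E}
    (hs : IsOpen s) {F : E → ℝ} (hF : ConvexOn ℝ s F) (hFc : ContinuousOn F s)
    {x : E} (hx : x ∈ s) :
    ∃ p : E →L[ℝ] ℝ, ∀ y ∈ s, F x + p (y - x) ≤ F y := by
  have hopen : IsOpen {p : E × ℝ | p.1 ∈ s ∧ F p.1 < p.2} := by
    have h1 : IsOpen (Prod.fst ⁻¹' s : Set (E × ℝ)) := hs.preimage continuous_fst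
    have h2 : ContinuousOn (fun p : E × ℝ => p.2 - F p.1) (Prod.fst ⁻¹' s) :=
      continuousOn_snd.sub (hFc.comp continuousOn_fst fun p hp => hp)
    have h3 := h2.isOpen_inter_preimage h1 (isOpen_Ioi (a := (0:ℝ)))
    convert h3 using 1
    ext p
    simp
  obtain ⟨f, hf⟩ := geometric_hahn_banach_point_open (x := (x, F x)) hF.convex_strict_epigraph hopen
    (by simp)
  have hdec : ∀ (w : E) (r : ℝ), f (w, r) = f (w, 0) + r * f (0, 1) := by
    intro w r
    have : ((w, r) : E × ℝ) = (w, 0) + r • (0, 1) := by simp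
    rw [this, map_add, map_smul, smul_eq_mul]
  set c := f (0, 1) with hcdef
  have hc : 0 < c := by
    have := hf (x, F x + 1) ⟨hx, by simp⟩
    rw [hdec x (F x), hdec x (F x + 1)] at this
    linarith
  refine ⟨-(c⁻¹ • (f.comp (ContinuousLinearMap.inl ℝ E ℝ))), fun y hy => ?_⟩
  have hlim : f (x, 0) + F x * c ≤ f (y, 0) + F y * c := by
    refine le_of_forall_pos_le_add fun ε hε => ?_
    have := hf (y, F y + ε / c) ⟨hy, by simp; positivity⟩
    rw [hdec x (F x), hdec y (F y + ε / c), add_mul, div_mul_cancel₀ _ hc.ne'] at this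
    linarith
  have e : f (y - x, (0:ℝ)) = f (y, 0) - f (x, 0) := by
    rw [← map_sub]; simp
  simp only [_root_.neg_apply, _root_.smul_apply,
    ContinuousLinearMap.comp_apply, ContinuousLinearMap.inl_apply, smul_eq_mul, e]
  have : c⁻¹ * (f (y, 0) - f (x, 0)) ≥ F x - F y := by
    rw [ge_iff_le, le_inv_mul_iff₀ hc]
    linarith
  linarith

lemma aux_mem {E : Type*} [NormedAddCommGroup E] [InnerProductSpace ℝ E]
    {u : E → ℝ} {x : E} {p : E →L[ℝ] ℝ} {C : ℝ}
    (h : ∀ᶠ y in 𝓝 x, u y ≤ u x + p (y - x) + C * ‖y - x‖ ^ 2) : p ∈ superdiff u x := by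
  refine ⟨fun y => u x + p (y - x) + C * ‖y - x‖ ^ 2, ?_, ?_, ?_⟩
  · exact (contDiff_const.add (p.contDiff.comp (contDiff_id.sub contDiff_const))).add
      (contDiff_const.mul ((contDiff_id.sub contDiff_const).norm_sq ℝ))
  · have h1 : HasFDerivAt (fun y : E => y - x) (ContinuousLinearMap.id ℝ E) x :=
      (hasFDerivAt_id x).sub_const x
    have h2 := ((p.hasFDerivAt.comp x h1).const_add (u x)).add (h1.norm_sq.const_mul C)
    have := h2.fderiv
    simp only [sub_self, map_zero, smul_zero, add_zero,
      ContinuousLinearMap.comp_id] at this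
    exact this
  · filter_upwards [h] with y hy
    simp only [sub_self, map_zero, norm_zero]
    linarith

lemma aux_local {E : Type*} [NormedAddCommGroup E] [InnerProductSpace ℝ E]
    [FiniteDimensional ℝ E] {Ω : Set E} (hΩ : IsOpen Ω) {u : E → ℝ}
    (hu : LocallySemiconcaveOn u Ω) {x : E} (hx : x ∈ Ω) :
    ∃ (s : Set E) (C : ℝ), IsOpen s ∧ x ∈ s ∧ s ⊆ Ω ∧
      ConvexOn ℝ s (fun y => C * ‖y‖ ^ 2 - u y) ∧
      ContinuousOn (fun y => C * ‖y‖ ^ 2 - u y) s := by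
  obtain ⟨r, hr, hrs⟩ := Metric.nhds_basis_closedBall.mem_iff.1 (hΩ.mem_nhds hx)
  have hcl : closure (Metric.ball x r) ⊆ Metric.closedBall x r := Metric.closure_ball_subset_closedBall
  obtain ⟨C, hC⟩ := hu.2 (Metric.ball x r) Metric.isOpen_ball (convex_ball x r)
    ((isCompact_closedBall x r).of_isClosed_subset isClosed_closure hcl) (hcl.trans hrs)
  have hsub : Metric.ball x r ⊆ Ω := Metric.ball_subset_closedBall.trans hrs
  have hcont : ContinuousOn (fun y => C * ‖y‖ ^ 2 - u y) (Metric.ball x r) :=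
    ContinuousOn.sub (by fun_prop) (hu.1.mono hsub)
  refine ⟨_, C, Metric.isOpen_ball, Metric.mem_ball_self hr, hsub,
    aux_convex (convex_ball x r) hcont ?_, hcont⟩
  intro a h ha hp hq
  have e1 := hC a h ha hp hq
  have e2 := parallelogram_law_with_norm ℝ a h
  have e3 : C * ‖a + h‖ ^ 2 + C * ‖a - h‖ ^ 2 = 2 * C * ‖a‖ ^ 2 + 2 * C * ‖h‖ ^ 2 := by
    linear_combination C * e2
  linarith

lemma aux_sq {E : Type*} [NormedAddCommGroup E] [InnerProductSpace ℝ E] (x y : E) :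
    ‖y‖ ^ 2 = ‖x‖ ^ 2 + 2 * inner ℝ x (y - x) + ‖y - x‖ ^ 2 := by
  have := norm_add_sq_real x (y - x)
  rwa [add_sub_cancel] at this

theorem superdiff_nonempty_and_usc_of_locallySemiconcave {n : ℕ}
    {Ω : Set (EuclideanSpace ℝ (Fin n))} (hΩ : IsOpen Ω)
    {u : EuclideanSpace ℝ (Fin n) → ℝ} (hu : LocallySemiconcaveOn u Ω) :
    (∀ x ∈ Ω, (superdiff u x).Nonempty) ∧
    (∀ x ∈ Ω, ∀ (xk : ℕ → EuclideanSpace ℝ (Fin n))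
        (vk : ℕ → EuclideanSpace ℝ (Fin n) →L[ℝ] ℝ) (v : EuclideanSpace ℝ (Fin n) →L[ℝ] ℝ),
        (∀ k, xk k ∈ Ω) → Tendsto xk atTop (𝓝 x) →
        (∀ k, vk k ∈ superdiff u (xk k)) → Tendsto vk atTop (𝓝 v) →
        v ∈ superdiff u x) := by
  refine ⟨fun x hx => ?_, fun x hx xk vk v hxk hxl hvk hvl => ?_⟩
  · obtain ⟨s, C, hso, hxs, hsΩ, hcv, hct⟩ := aux_local hΩ hu hx
    obtain ⟨p, hp⟩ := aux_subgrad hso hcv hct hxs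
    refine ⟨(2 * C) • innerSL ℝ x - p, aux_mem (C := C) ?_⟩
    filter_upwards [hso.mem_nhds hxs] with y hy
    have e1 := hp y hy
    have e2 := aux_sq x y
    simp only [_root_.sub_apply, _root_.smul_apply, innerSL_apply_apply,
      smul_eq_mul]
    rw [e2] at e1
    linarith
  · obtain ⟨s, C, hso, hxs, hsΩ, hcv, hct⟩ := aux_local hΩ hu hx
    refine aux_mem (C := C) ?_
    filter_upwards [hso.mem_nhds hxs] with y hy
    have hux : ContinuousAt u x := hu.1.continuousAt (hΩ.mem_nhds hx)
    have hd : Tendsto (fun k => y - xk k) atTop (𝓝 (y - x)) := tendsto_const_nhds.sub hxl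
    have hcl : Tendsto (fun k => vk k (y - xk k)) atTop (𝓝 (v (y - x))) :=
      (isBoundedBilinearMap_apply.continuous.tendsto (v, y - x)).comp (hvl.prodMk_nhds hd)
    have hlim : Tendsto (fun k => u (xk k) + vk k (y - xk k) + C * ‖y - xk k‖ ^ 2) atTop
        (𝓝 (u x + v (y - x) + C * ‖y - x‖ ^ 2)) :=
      ((hux.tendsto.comp hxl).add hcl).add ((hd.norm.pow 2).const_mul C)
    refine ge_of_tendsto hlim ?_
    filter_upwards [hxl.eventually (hso.mem_nhds hxs)] with k hk
    obtain ⟨φ, hφ, hφd, hmin⟩ := hvk k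
    have hφ' : HasFDerivAt φ (vk k) (xk k) := by
      rw [← hφd]
      exact (hφ.differentiable one_ne_zero).differentiableAt.hasFDerivAt
    have hG := ((hasFDerivAt_id (𝕜 := ℝ) (xk k)).norm_sq.const_mul C).sub hφ'
    have e1 := aux_support hcv hk hy (G := fun w => C * ‖w‖ ^ 2 - φ w) (by
      filter_upwards [hmin] with w hw
      linarith) hG
    have e2 := aux_sq (xk k) y
    rw [e2] at e1
    simp at e1
    rw [map_sub]
    linarith
end

section
/- Let u be a locally semiconcave function on an open set Ω ⊆ ℝⁿ. If u is Fréchet differentiable at every point of Ω, then u is continuously differentiable (of class C¹) on Ω. -/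
open Filter Topology in
theorem semiconcave_upper {E : Type*} [NormedAddCommGroup E] [NormedSpace ℝ E]
    {u : E → ℝ} {B : Set E} (hB : Convex ℝ B) {C : ℝ}
    (hC : ∀ x h, x ∈ B → x + h ∈ B → x - h ∈ B →
      u (x + h) + u (x - h) - 2 * u x ≤ 2 * C * ‖h‖ ^ 2)
    {x v : E} (hx : x ∈ B) (hv : x + v ∈ B) (hd : DifferentiableAt ℝ u x) :
    u (x + v) ≤ u x + fderiv ℝ u x v + C * ‖v‖ ^ 2 := by
  have key : ∀ w : E, x + w ∈ B → u (x + w) - u x - C * ‖w‖ ^ 2 ≤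
      2 * (u (x + (1/2 : ℝ) • w) - u x - C * ‖(1/2 : ℝ) • w‖ ^ 2) ∧ x + (1/2 : ℝ) • w ∈ B := by
    intro w hw
    have hm : x + (1/2 : ℝ) • w ∈ B := hB.add_smul_mem hx hw ⟨by norm_num, by norm_num⟩
    refine ⟨?_, hm⟩
    have e1 : x + (1/2 : ℝ) • w + (1/2 : ℝ) • w = x + w := by module
    have e2 : x + (1/2 : ℝ) • w - (1/2 : ℝ) • w = x := by module
    have := hC (x + (1/2 : ℝ) • w) ((1/2 : ℝ) • w) hm (by rwa [e1]) (by rwa [e2])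
    rw [e1, e2] at this
    have e3 : ‖(1/2 : ℝ) • w‖ = 1/2 * ‖w‖ := by rw [norm_smul]; norm_num
    rw [e3] at this ⊢
    nlinarith
  have it : ∀ k : ℕ, u (x + v) - u x - C * ‖v‖ ^ 2 ≤
      2 ^ k * (u (x + ((1/2 : ℝ) ^ k) • v) - u x - C * ‖((1/2 : ℝ) ^ k) • v‖ ^ 2) ∧
      x + ((1/2 : ℝ) ^ k) • v ∈ B := by
    intro k
    induction k with
    | zero => simpa using hv
    | succ k ih =>
      obtain ⟨h1, h2⟩ := ih
      obtain ⟨h3, h4⟩ := key _ h2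
      rw [smul_smul, ← pow_succ'] at h3 h4
      refine ⟨h1.trans ?_, h4⟩
      rw [pow_succ (2 : ℝ), mul_assoc]
      exact mul_le_mul_of_nonneg_left h3 (by positivity)
  have hhalf : Tendsto (fun k : ℕ => (1/2 : ℝ) ^ k) atTop (𝓝 0) :=
    tendsto_pow_atTop_nhds_zero_of_lt_one (by norm_num) (by norm_num)
  have hlim1 : Tendsto (fun k : ℕ => (2 : ℝ) ^ k • (u (x + ((1/2 : ℝ) ^ k) • v) - u x)) atTop
      (𝓝 (fderiv ℝ u x v)) := by
    have hl := (hd.hasFDerivAt.hasLineDerivAt v).tendsto_slope_zero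
    have hs : Tendsto (fun k : ℕ => (1/2 : ℝ) ^ k) atTop (𝓝[≠] 0) :=
      tendsto_nhdsWithin_iff.2 ⟨hhalf, Eventually.of_forall fun k => by simp⟩
    refine (hl.comp hs).congr fun k => ?_
    simp
  have hlim2 : Tendsto (fun k : ℕ => (1/2 : ℝ) ^ k * (C * ‖v‖ ^ 2)) atTop (𝓝 0) := by
    simpa using hhalf.mul_const (C * ‖v‖ ^ 2)
  have hlim := hlim1.sub hlim2
  have := ge_of_tendsto' hlim (b := u (x + v) - u x - C * ‖v‖ ^ 2) fun k => by
    refine (it k).1.trans (le_of_eq ?_)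
    have e3 : ‖((1/2 : ℝ) ^ k) • v‖ = (1/2) ^ k * ‖v‖ := by
      rw [norm_smul, Real.norm_of_nonneg (by positivity)]
    have e4 : (2 : ℝ) ^ k * (1/2) ^ k = 1 := by rw [← mul_pow]; norm_num
    rw [e3, smul_eq_mul]
    linear_combination (-(1/2 : ℝ) ^ k * C * ‖v‖ ^ 2) * e4
  linarith

theorem contDiffOn_of_locallySemiconcave_of_differentiable {n : ℕ}
    {Ω : Set (EuclideanSpace ℝ (Fin n))} (hΩ : IsOpen Ω)
    {u : EuclideanSpace ℝ (Fin n) → ℝ} (hu : LocallySemiconcaveOn u Ω)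
    (hdiff : ∀ x ∈ Ω, DifferentiableAt ℝ u x) :
    ContDiffOn ℝ 1 u Ω := by
  classical
  have hc : ContinuousOn (fderiv ℝ u) Ω := by
    intro x0 hx0
    apply ContinuousAt.continuousWithinAt
    obtain ⟨r, hr, hrΩ⟩ := Metric.nhds_basis_closedBall.mem_iff.1 (hΩ.mem_nhds hx0)
    have hcl : closure (Metric.ball x0 r) ⊆ Metric.closedBall x0 r :=
      Metric.closure_ball_subset_closedBall
    obtain ⟨C, hC⟩ := hu.2 (Metric.ball x0 r) Metric.isOpen_ball (convex_ball x0 r)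
      ((isCompact_closedBall x0 r).of_isClosed_subset isClosed_closure hcl) (hcl.trans hrΩ)
    have hB : ∀ x ∈ Metric.ball x0 r, x ∈ Ω := fun x hx =>
      hrΩ (Metric.ball_subset_closedBall hx)
    rw [Metric.continuousAt_iff]
    intro ε hε
    have ho := (hdiff x0 hx0).hasFDerivAt.isLittleO.def (c := ε / 8) (by positivity)
    obtain ⟨δ, hδ, hδ'⟩ := Metric.eventually_nhds_iff.1 ho
    obtain ⟨s, hs, hs1, hs2, hs3⟩ : ∃ s : ℝ, 0 < s ∧ 2 * s < δ ∧ 2 * s < r ∧ C * s ≤ ε / 8 := by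
      refine ⟨min (min (δ / 4) (r / 4)) (ε / (8 * (|C| + 1))), by positivity, ?_, ?_, ?_⟩
      · have := (min_le_left (min (δ / 4) (r / 4)) (ε / (8 * (|C| + 1)))).trans (min_le_left _ _)
        linarith
      · have := (min_le_left (min (δ / 4) (r / 4)) (ε / (8 * (|C| + 1)))).trans (min_le_right _ _)
        linarith
      · have h1 := min_le_right (min (δ / 4) (r / 4)) (ε / (8 * (|C| + 1)))
        have h0 : 0 ≤ min (min (δ / 4) (r / 4)) (ε / (8 * (|C| + 1))) := by positivity
        have hp : 0 < 8 * (|C| + 1) := by positivity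
        rw [le_div_iff₀ hp] at h1
        nlinarith [le_abs_self C]
    refine ⟨s, hs, fun {x} hx => ?_⟩
    have hxB : x ∈ Metric.ball x0 r := by rw [Metric.mem_ball]; linarith
    have hx' : ‖x - x0‖ < s := by rwa [← dist_eq_norm]
    have est : ∀ v : EuclideanSpace ℝ (Fin n), ‖v‖ = s →
        -(ε / 2 * s) ≤ (fderiv ℝ u x - fderiv ℝ u x0) v := by
      intro v hv
      have hn : ‖x + v - x0‖ < 2 * s := by
        have : x + v - x0 = (x - x0) + v := by abel
        rw [this]
        linarith [norm_add_le (x - x0) v]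
      have h1 := semiconcave_upper (convex_ball x0 r) hC hxB (v := v)
        (by rw [Metric.mem_ball, dist_eq_norm]; linarith) (hdiff x (hB x hxB))
      have h2 := hδ' (y := x) (by linarith)
      have h3 := hδ' (y := x + v) (by rw [dist_eq_norm]; linarith)
      rw [Real.norm_eq_abs] at h2 h3
      have h2' := (abs_le.1 h2).2
      have h3' := (abs_le.1 h3).1
      have e : fderiv ℝ u x0 (x + v - x0) = fderiv ℝ u x0 (x - x0) + fderiv ℝ u x0 v := by
        rw [← map_add]; congr 1; abel
      rw [e] at h3'
      rw [hv] at h1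
      rw [sub_apply]
      have h4 : ε / 8 * ‖x - x0‖ ≤ ε / 8 * s := by gcongr
      have h5 : ε / 8 * ‖x + v - x0‖ ≤ ε / 8 * (2 * s) := by gcongr
      have h6 : C * s ^ 2 ≤ ε / 8 * s := by nlinarith
      linarith
    rw [dist_eq_norm]
    refine lt_of_le_of_lt (b := ε / 2) ?_ (by linarith)
    refine ContinuousLinearMap.opNorm_le_of_unit_norm (by positivity) fun w hw => ?_
    have a1 := est (s • w) (by rw [norm_smul, hw, Real.norm_of_nonneg hs.le, mul_one])
    have a2 := est (-(s • w)) (by rw [norm_neg, norm_smul, hw, Real.norm_of_nonneg hs.le, mul_one])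
    rw [map_neg] at a2
    rw [map_smul, smul_eq_mul] at a1 a2
    rw [Real.norm_eq_abs, abs_le]
    constructor
    · by_contra! h
      nlinarith
    · by_contra! h
      nlinarith
  rw [show (1 : WithTop ℕ∞) = 0 + 1 by simp, contDiffOn_succ_iff_fderiv_of_isOpen hΩ]
  exact ⟨fun x hx => (hdiff x hx).differentiableWithinAt, by simp, contDiffOn_zero.2 hc⟩
end

section
/- Let Ω ⊆ ℝⁿ and Ω′ ⊆ ℝⁿ be open sets, let H : Ω × (ℝⁿ →L ℝ) × ℝ → ℝ be continuous, and let u : Ω → ℝ be a viscosity solution of H(x, du(x), u(x)) = 0 on Ω, i.e. for every x ∈ Ω, H(x, v, u(x)) ≤ 0 for all v ∈ ∂⁺u(x) and H(x, v, u(x)) ≥ 0 for all v ∈ ∂⁻u(x). Let ψ : Ω′ → Ω be a C¹ local diffeomorphism (every point of Ω′ has an open neighborhood mapped bijectively by ψ onto an open set, with ψ and its local inverse of class C¹). Then u ∘ ψ is a viscosity solution on Ω′ of the pulled-back equation (ψ*H)(y, w, r) = H(ψ(y), w ∘ (dψ(y))⁻¹, r) = 0. -/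
open Filter Topology in
theorem extend_comp_aux {n : ℕ} {V : Set (EuclideanSpace ℝ (Fin n))} (hV : IsOpen V)
    {x : EuclideanSpace ℝ (Fin n)} (hx : x ∈ V) {f : EuclideanSpace ℝ (Fin n) → ℝ}
    (hf : ContDiffOn ℝ 1 f V) :
    ∃ g : EuclideanSpace ℝ (Fin n) → ℝ, ContDiff ℝ 1 g ∧ g =ᶠ[𝓝 x] f := by
  obtain ⟨r, hr, hrV⟩ := Metric.isOpen_iff.1 hV x hx
  let b : ContDiffBump x := ⟨r / 4, r / 2, by positivity, by linarith⟩
  refine ⟨fun z => b z * f z, ?_, ?_⟩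
  · rw [contDiff_iff_contDiffAt]
    intro z
    by_cases hz : z ∈ V
    · exact b.contDiffAt.mul (hf.contDiffAt (hV.mem_nhds hz))
    · have hz' : z ∉ tsupport b := by
        rw [b.tsupport_eq]
        intro h
        apply hz
        apply hrV
        have h1 : dist z x ≤ r / 2 := h
        have h2 : dist z x < r := by linarith
        exact h2
      have h0 : (fun z => b z * f z) =ᶠ[𝓝 z] fun _ => (0 : ℝ) := by
        filter_upwards [notMem_tsupport_iff_eventuallyEq.1 hz'] with w hw
        simp [hw]
      exact contDiffAt_const.congr_of_eventuallyEq h0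
  · filter_upwards [b.eventuallyEq_one] with w hw
    simp [hw]

open Filter Topology in
theorem pullback_aux {n : ℕ} {y : EuclideanSpace ℝ (Fin n)}
    {ψ : EuclideanSpace ℝ (Fin n) → EuclideanSpace ℝ (Fin n)}
    (h : ∃ (U V : Set (EuclideanSpace ℝ (Fin n)))
        (χ : EuclideanSpace ℝ (Fin n) → EuclideanSpace ℝ (Fin n)),
        IsOpen U ∧ IsOpen V ∧ y ∈ U ∧ Set.BijOn ψ U V ∧
        ContDiffOn ℝ 1 ψ U ∧ ContDiffOn ℝ 1 χ V ∧
        (∀ z ∈ U, χ (ψ z) = z) ∧ (∀ w ∈ V, ψ (χ w) = w))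
    {φ : EuclideanSpace ℝ (Fin n) → ℝ} (hφ : ContDiff ℝ 1 φ) :
    ∃ (χ : EuclideanSpace ℝ (Fin n) → EuclideanSpace ℝ (Fin n))
      (g : EuclideanSpace ℝ (Fin n) → ℝ), ContDiff ℝ 1 g ∧
      fderiv ℝ g (ψ y) = (fderiv ℝ φ y).comp (fderiv ℝ ψ y).inverse ∧
      χ (ψ y) = y ∧ Tendsto χ (𝓝 (ψ y)) (𝓝 y) ∧
      ∀ᶠ w in 𝓝 (ψ y), g w = φ (χ w) ∧ ψ (χ w) = w := by
  obtain ⟨U, V, χ, hU, hV, hy, hb, hψ, hχ, h1, h2⟩ := h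
  have hyV : ψ y ∈ V := hb.mapsTo hy
  have hVn := hV.mem_nhds hyV
  have hUn := hU.mem_nhds hy
  obtain ⟨g, hg, hge⟩ := extend_comp_aux hV hyV (hφ.comp_contDiffOn hχ)
  have e1 : χ (ψ y) = y := h1 y hy
  have dψ : HasFDerivAt ψ (fderiv ℝ ψ y) y :=
    ((hψ.contDiffAt hUn).differentiableAt one_ne_zero).hasFDerivAt
  have dχ : HasFDerivAt χ (fderiv ℝ χ (ψ y)) (ψ y) :=
    ((hχ.contDiffAt hVn).differentiableAt one_ne_zero).hasFDerivAt
  have dφ : HasFDerivAt φ (fderiv ℝ φ y) y :=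
    (hφ.differentiable one_ne_zero y).hasFDerivAt
  have c1 : (fderiv ℝ χ (ψ y)).comp (fderiv ℝ ψ y) = ContinuousLinearMap.id ℝ _ := by
    refine (dχ.comp y dψ).unique ((hasFDerivAt_id y).congr_of_eventuallyEq ?_)
    filter_upwards [hUn] with z hz using h1 z hz
  have c2 : (fderiv ℝ ψ y).comp (fderiv ℝ χ (ψ y)) = ContinuousLinearMap.id ℝ _ := by
    have dψ' : HasFDerivAt ψ (fderiv ℝ ψ y) (χ (ψ y)) := by rw [e1]; exact dψ
    refine (dψ'.comp (ψ y) dχ).unique ((hasFDerivAt_id (ψ y)).congr_of_eventuallyEq ?_)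
    filter_upwards [hVn] with z hz using h2 z hz
  refine ⟨χ, g, hg, ?_, e1, ?_, ?_⟩
  · rw [hge.fderiv_eq, ContinuousLinearMap.inverse_eq c2 c1]
    have dφ' : HasFDerivAt φ (fderiv ℝ φ y) (χ (ψ y)) := by rw [e1]; exact dφ
    exact (dφ'.comp (ψ y) dχ).fderiv
  · have := dχ.continuousAt.tendsto
    rwa [e1] at this
  · filter_upwards [hge, hVn] with w hw hwV using ⟨hw, h2 w hwV⟩

theorem viscosity_solution_pullback {n : ℕ}
    {Ω Ω' : Set (EuclideanSpace ℝ (Fin n))} (hΩ : IsOpen Ω) (hΩ' : IsOpen Ω')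
    {H : EuclideanSpace ℝ (Fin n) × (EuclideanSpace ℝ (Fin n) →L[ℝ] ℝ) × ℝ → ℝ}
    (hH : Continuous H)
    {u : EuclideanSpace ℝ (Fin n) → ℝ} (hu : ContinuousOn u Ω)
    (husub : ∀ x ∈ Ω, ∀ v ∈ superdiff u x, H (x, v, u x) ≤ 0)
    (husup : ∀ x ∈ Ω, ∀ v ∈ subdiff u x, 0 ≤ H (x, v, u x))
    {ψ : EuclideanSpace ℝ (Fin n) → EuclideanSpace ℝ (Fin n)}
    (hmaps : Set.MapsTo ψ Ω' Ω)
    (hloc : ∀ y ∈ Ω', ∃ (U V : Set (EuclideanSpace ℝ (Fin n)))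
        (χ : EuclideanSpace ℝ (Fin n) → EuclideanSpace ℝ (Fin n)),
        IsOpen U ∧ IsOpen V ∧ y ∈ U ∧ Set.BijOn ψ U V ∧
        ContDiffOn ℝ 1 ψ U ∧ ContDiffOn ℝ 1 χ V ∧
        (∀ z ∈ U, χ (ψ z) = z) ∧ (∀ w ∈ V, ψ (χ w) = w)) :
    (∀ y ∈ Ω', ∀ w ∈ superdiff (u ∘ ψ) y,
        H (ψ y, w.comp (fderiv ℝ ψ y).inverse, (u ∘ ψ) y) ≤ 0) ∧
    (∀ y ∈ Ω', ∀ w ∈ subdiff (u ∘ ψ) y,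
        0 ≤ H (ψ y, w.comp (fderiv ℝ ψ y).inverse, (u ∘ ψ) y)) := by
  constructor
  · rintro y hy w ⟨φ, hφ, rfl, hm⟩
    obtain ⟨χ, g, hg, hd, e1, ht, hev⟩ := pullback_aux (hloc y hy) hφ
    refine husub (ψ y) (hmaps hy) _ ⟨g, hg, hd, ?_⟩
    have hself := hev.self_of_nhds
    filter_upwards [hev, ht.eventually hm] with z hz hmz
    simp only [Function.comp, hz.2] at hmz
    simp only [hz.1, hself.1, e1]
    exact hmz
  · rintro y hy w ⟨φ, hφ, rfl, hm⟩
    obtain ⟨χ, g, hg, hd, e1, ht, hev⟩ := pullback_aux (hloc y hy) hφ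
    refine husup (ψ y) (hmaps hy) _ ⟨g, hg, hd, ?_⟩
    have hself := hev.self_of_nhds
    filter_upwards [hev, ht.eventually hm] with z hz hmz
    simp only [Function.comp, hz.2] at hmz
    simp only [hz.1, hself.1, e1]
    exact hmz
end

section
/- Let K be a nonempty closed subset of ℝⁿ. Then the distance function d_K is a viscosity solution of ‖∇u‖ − 1 = 0 on ℝⁿ \ K: for every x ∉ K, every v ∈ ∂⁺d_K(x) satisfies ‖v‖ ≤ 1 and every v ∈ ∂⁻d_K(x) satisfies ‖v‖ ≥ 1; moreover d_K = 0 on K. -/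
theorem dir_deriv_ge {E : Type*} [NormedAddCommGroup E] [NormedSpace ℝ E]
    {φ : E → ℝ} {x : E} (hφ : ContDiff ℝ 1 φ) (w : E) (c : ℝ)
    (h : ∀ᶠ y in nhds x, ∀ t : ℝ, 0 < t → t < 1 → y = x + t • w → t * c ≤ φ y - φ x) :
    c ≤ fderiv ℝ φ x w := by
  have hd : HasFDerivAt φ (fderiv ℝ φ x) x :=
    ((hφ.differentiable (by norm_num)) x).hasFDerivAt
  have hl : HasLineDerivAt ℝ φ (fderiv ℝ φ x w) x w := hd.hasLineDerivAt w
  have ht := HasDerivAt.tendsto_slope_zero_right hl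
  refine ge_of_tendsto ht ?_
  have hc : Filter.Tendsto (fun t : ℝ => x + t • w) (nhds 0) (nhds x) := by
    have : Continuous (fun t : ℝ => x + t • w) := by fun_prop
    simpa using this.tendsto 0
  have h1 : ∀ᶠ t : ℝ in nhds 0, t < 1 := eventually_lt_nhds one_pos
  filter_upwards [(hc.eventually h).filter_mono nhdsWithin_le_nhds,
    h1.filter_mono nhdsWithin_le_nhds, self_mem_nhdsWithin] with t ht h1 h0
  have h0' : 0 < t := h0
  have := ht t h0' h1 rfl
  simp only [zero_add, zero_smul, add_zero, smul_eq_mul]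
  rw [inv_mul_eq_div, le_div_iff₀ h0']
  linarith

theorem distance_viscosity_solution_eikonal {n : ℕ}
    {K : Set (EuclideanSpace ℝ (Fin n))} (hK : K.Nonempty) (hKclosed : IsClosed K) :
    (∀ x ∉ K,
      (∀ v ∈ superdiff (fun y => Metric.infDist y K) x, ‖v‖ ≤ 1) ∧
      (∀ v ∈ subdiff (fun y => Metric.infDist y K) x, 1 ≤ ‖v‖)) ∧
    (∀ x ∈ K, Metric.infDist x K = 0) := by
  refine ⟨fun x hx => ⟨?_, ?_⟩, fun x hx => Metric.infDist_zero_of_mem hx⟩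
  · rintro v ⟨φ, hφ, rfl, hmin⟩
    have key : ∀ w, -‖w‖ ≤ fderiv ℝ φ x w := by
      intro w
      apply dir_deriv_ge hφ
      filter_upwards [hmin] with y hy t h0 h1 hyt
      have h2 := Metric.infDist_le_infDist_add_dist (s := K) (x := x) (y := y)
      have h3 : dist x y = t * ‖w‖ := by
        rw [hyt, dist_self_add_right, norm_smul, Real.norm_of_nonneg h0.le]
      linarith
    refine ContinuousLinearMap.opNorm_le_bound _ zero_le_one fun w => ?_
    rw [Real.norm_eq_abs, abs_le]
    have h1 := key w
    have h2 := key (-w)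
    rw [norm_neg, map_neg] at h2
    constructor <;> linarith
  · rintro v ⟨ψ, hψ, rfl, hmax⟩
    obtain ⟨p, hp, hpd⟩ := hKclosed.exists_infDist_eq_dist hK x
    have hpos : 0 < ‖p - x‖ := norm_pos_iff.2 (sub_ne_zero.2 fun h => hx (h ▸ hp))
    have hd : dist x p = ‖p - x‖ := by rw [dist_comm, dist_eq_norm]
    have key : ‖p - x‖ ≤ fderiv ℝ (-ψ) x (p - x) := by
      apply dir_deriv_ge hψ.neg
      filter_upwards [hmax] with y hy t h0 h1 hyt
      have h2 := Metric.infDist_le_dist_of_mem (x := y) hp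
      have h3 : dist y p = (1 - t) * ‖p - x‖ := by
        have : p - y = (1 - t) • (p - x) := by rw [hyt]; module
        rw [dist_comm, dist_eq_norm, this, norm_smul, Real.norm_of_nonneg (by linarith)]
      linarith
    rw [fderiv_neg] at key
    have h4 := (fderiv ℝ ψ x).le_opNorm (p - x)
    have h5 := neg_abs_le (fderiv ℝ ψ x (p - x))
    rw [Real.norm_eq_abs] at h4
    simp only [neg_apply] at key
    by_contra! hlt
    nlinarith
end

section
/- Let K be a nonempty closed subset of ℝⁿ and let u : ℝⁿ → ℝ be a continuous function, bounded from below, such that u = 0 on K and u is a viscosity solution of ‖∇u‖ − 1 = 0 on ℝⁿ \ K (for every x ∉ K, ‖v‖ ≤ 1 for all v ∈ ∂⁺u(x) and ‖v‖ ≥ 1 for all v ∈ ∂⁻u(x)). Then u = d_K on all of ℝⁿ. -/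
/-- Radial test function. -/
noncomputable def testFn {E : Type*} [NormedAddCommGroup E] [InnerProductSpace ℝ E]
    (z : E) (a ε M c : ℝ) (k : ℕ) (y : E) : ℝ :=
  a * Real.sqrt (‖y - z‖ ^ 2 + ε ^ 2) + M * (c * ‖y - z‖ ^ 2) ^ k

theorem testFn_contDiff {E : Type*} [NormedAddCommGroup E] [InnerProductSpace ℝ E]
    (z : E) (a ε M c : ℝ) (k : ℕ) (hε : 0 < ε) : ContDiff ℝ 1 (testFn z a ε M c k) := by
  have h1 : ContDiff ℝ 1 (fun y : E => ‖y - z‖ ^ 2) :=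
    (contDiff_id.sub contDiff_const).norm_sq ℝ
  unfold testFn
  refine (contDiff_const.mul ((h1.add contDiff_const).sqrt ?_)).add
    (contDiff_const.mul ((contDiff_const.mul h1).pow k))
  intro y
  positivity

theorem testFn_fderiv {E : Type*} [NormedAddCommGroup E] [InnerProductSpace ℝ E]
    (z : E) (a ε M c : ℝ) (k : ℕ) (hε : 0 < ε) (y : E) :
    ‖fderiv ℝ (testFn z a ε M c k) y‖ =
      |a / Real.sqrt (‖y - z‖ ^ 2 + ε ^ 2)
        + 2 * M * c * k * (c * ‖y - z‖ ^ 2) ^ (k - 1)| * ‖y - z‖ := by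
  have h1 : HasFDerivAt (fun y : E => ‖y - z‖ ^ 2) ((2 : ℝ) • innerSL ℝ (y - z)) y := by
    have := ((hasFDerivAt_id (𝕜 := ℝ) y).sub_const z).norm_sq
    refine this.congr_fderiv ?_
    ext v
    simp
  have hpos : 0 < ‖y - z‖ ^ 2 + ε ^ 2 := by positivity
  have hF : HasDerivAt (fun t : ℝ => a * Real.sqrt (t + ε ^ 2) + M * (c * t) ^ k)
      (a * (1 / (2 * Real.sqrt (‖y - z‖ ^ 2 + ε ^ 2)))
        + M * (k * (c * ‖y - z‖ ^ 2) ^ (k - 1) * (c * 1))) (‖y - z‖ ^ 2) := by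
    refine HasDerivAt.add (HasDerivAt.const_mul a ?_) (HasDerivAt.const_mul M ?_)
    · exact ((hasDerivAt_id _).add_const _).sqrt hpos.ne'
    · exact ((hasDerivAt_id _).const_mul c).pow k
  have h2 := hF.comp_hasFDerivAt y h1
  have h3 : fderiv ℝ (testFn z a ε M c k) y = _ := h2.fderiv
  rw [h3, smul_smul, norm_smul, innerSL_apply_norm, Real.norm_eq_abs]
  congr 2
  have : Real.sqrt (‖y - z‖ ^ 2 + ε ^ 2) ≠ 0 := (Real.sqrt_pos.2 hpos).ne'
  field_simp

theorem sqrt_le_add_aux (s ε : ℝ) (hs : 0 ≤ s) (hε : 0 ≤ ε) :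
    Real.sqrt (s ^ 2 + ε ^ 2) ≤ s + ε := by
  rw [Real.sqrt_le_left (by positivity)]
  nlinarith [mul_nonneg hs hε]

theorem le_sqrt_aux (s ε : ℝ) : s ≤ Real.sqrt (s ^ 2 + ε ^ 2) := by
  apply Real.le_sqrt_of_sq_le
  nlinarith [sq_nonneg ε]

theorem eik_lower {n : ℕ}
    {K : Set (EuclideanSpace ℝ (Fin n))}
    {u : EuclideanSpace ℝ (Fin n) → ℝ} (hu : Continuous u)
    (hbdd : BddBelow (Set.range u)) (hK0 : ∀ x ∈ K, u x = 0)
    (hsub : ∀ x ∉ K, ∀ v ∈ subdiff u x, 1 ≤ ‖v‖) (x : EuclideanSpace ℝ (Fin n))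
    (η : ℝ) (h0 : 0 < η) (h1 : η < 1) :
    (1 - η) * Metric.infDist x K ≤ u x + (1 - η) * η := by
  obtain ⟨m, hm⟩ := hbdd
  have hm' : ∀ y, m ≤ u y := fun y => hm ⟨y, rfl⟩
  have hc : Continuous (testFn x (-(1 - η)) η 0 0 0) := (testFn_contDiff _ _ _ _ _ _ h0).continuous
  have hcoer : Filter.Tendsto (fun y => u y - testFn x (-(1 - η)) η 0 0 0 y)
      (Filter.cocompact _) Filter.atTop := by
    have ht : Filter.Tendsto (fun y : EuclideanSpace ℝ (Fin n) => m + (1 - η) * dist y x)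
        (Filter.cocompact _) Filter.atTop :=
      Filter.tendsto_atTop_add_const_left _ _
        ((tendsto_dist_right_cocompact_atTop x).const_mul_atTop (by linarith))
    refine Filter.tendsto_atTop_mono (fun y => ?_) ht
    have := mul_le_mul_of_nonneg_left (le_sqrt_aux ‖y - x‖ η) (by linarith : 0 ≤ 1 - η)
    have := hm' y
    simp only [testFn, dist_eq_norm]
    linarith
  obtain ⟨y, hy⟩ := (hu.sub hc).exists_forall_le hcoer
  simp only [Pi.sub_apply] at hy
  have hyK : y ∈ K := by
    by_contra hyK
    have h := hsub y hyK _ ⟨_, testFn_contDiff x (-(1 - η)) η 0 0 0 h0, rfl,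
      Filter.Eventually.of_forall fun w => by have := hy w; linarith⟩
    rw [testFn_fderiv _ _ _ _ _ _ h0] at h
    have hs : 0 < Real.sqrt (‖y - x‖ ^ 2 + η ^ 2) := Real.sqrt_pos.2 (by positivity)
    have h2 : ‖y - x‖ ≤ _ := le_sqrt_aux ‖y - x‖ η
    simp only [mul_zero, zero_mul, add_zero, abs_div, abs_neg, abs_of_pos hs,
      abs_of_pos (by linarith : 0 < 1 - η)] at h
    rw [div_mul_eq_mul_div, le_div_iff₀ hs] at h
    nlinarith
  have h := hy x
  simp only [testFn, hK0 y hyK, sub_self, norm_zero] at h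
  have e : Real.sqrt (0 ^ 2 + η ^ 2) = η := by
    rw [zero_pow two_ne_zero, zero_add, Real.sqrt_sq h0.le]
  rw [e] at h
  have h3 : Metric.infDist x K ≤ Real.sqrt (‖y - x‖ ^ 2 + η ^ 2) := by
    refine (Metric.infDist_le_dist_of_mem hyK).trans ?_
    rw [dist_comm, dist_eq_norm]
    exact le_sqrt_aux _ _
  have := mul_le_mul_of_nonneg_left h3 (by linarith : 0 ≤ 1 - η)
  linarith

theorem eik_upper {n : ℕ}
    {K : Set (EuclideanSpace ℝ (Fin n))}
    {u : EuclideanSpace ℝ (Fin n) → ℝ} (hu : Continuous u)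
    (hK0 : ∀ x ∈ K, u x = 0)
    (hsuper : ∀ x ∉ K, ∀ v ∈ superdiff u x, ‖v‖ ≤ 1) (x z : EuclideanSpace ℝ (Fin n))
    (hz : z ∈ K) (η : ℝ) (h0 : 0 < η) :
    u x ≤ η + (1 + η) * (dist x z + η) + η := by
  set r := dist x z with hr
  have hr0 : 0 ≤ r := dist_nonneg
  obtain ⟨δ, hδ, hδu⟩ := Metric.continuousAt_iff.1 (hu.continuousAt (x := z)) η h0
  rw [hK0 z hz] at hδu
  obtain ⟨ε, hε, hεη, hεδ⟩ : ∃ ε : ℝ, 0 < ε ∧ ε ≤ η ∧ ε < η * δ := by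
    refine ⟨min η (η * δ / 2), by positivity, min_le_left _ _, ?_⟩
    have : 0 < η * δ := by positivity
    exact (min_le_right _ _).trans_lt (by linarith)
  have hcomp := isCompact_closedBall z (r + 1)
  have hzball : z ∈ Metric.closedBall z (r + 1) := Metric.mem_closedBall_self (by linarith)
  obtain ⟨w, -, hw⟩ := hcomp.exists_isMaxOn ⟨z, hzball⟩ hu.continuousOn
  set M := u w
  have hM : ∀ y ∈ Metric.closedBall z (r + 1), u y ≤ M := fun y hy => hw hy
  have hM0 : 0 ≤ M := by have := hM z hzball; rwa [hK0 z hz] at this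
  set c := 1 / (r + 1) ^ 2 with hcdef
  have hc0 : 0 < c := by positivity
  obtain ⟨k, hk⟩ : ∃ k : ℕ, M * (c * r ^ 2) ^ k < η := by
    have hq : c * r ^ 2 < 1 := by
      rw [hcdef, one_div_mul_eq_div, div_lt_one (by positivity)]
      nlinarith
    have := (tendsto_pow_atTop_nhds_zero_of_lt_one (by positivity) hq).const_mul M
    rw [mul_zero] at this
    exact (this.eventually (gt_mem_nhds h0)).exists
  have hcd := testFn_contDiff z (1 + η) ε M c (k + 1) hε
  obtain ⟨y, hyb, hy⟩ := hcomp.exists_isMaxOn ⟨z, hzball⟩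
    (hu.sub hcd.continuous).continuousOn
  have hy' : ∀ v ∈ Metric.closedBall z (r + 1), u v - testFn z (1 + η) ε M c (k + 1) v
      ≤ u y - testFn z (1 + η) ε M c (k + 1) y := fun v hv => hy hv
  have hφ0 : 0 ≤ testFn z (1 + η) ε M c (k + 1) y := by unfold testFn; positivity
  have key : u y ≤ η := by
    by_contra hcon
    push Not at hcon
    have hyK : y ∉ K := fun h => by rw [hK0 y h] at hcon; linarith
    have hyδ : δ ≤ dist y z := by
      by_contra h
      push Not at h
      have := hδu h
      rw [Real.dist_eq, sub_zero] at this
      linarith [le_abs_self (u y)]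
    rw [dist_eq_norm] at hyδ
    have hsp : 0 < Real.sqrt (‖y - z‖ ^ 2 + ε ^ 2) := Real.sqrt_pos.2 (by positivity)
    have hsqe : ε ≤ Real.sqrt (‖y - z‖ ^ 2 + ε ^ 2) := by
      have := le_sqrt_aux ε ‖y - z‖
      rwa [add_comm] at this
    have hlt : dist y z < r + 1 := by
      refine lt_of_le_of_ne hyb fun heq => ?_
      have h := hy' z hzball
      have hone : c * ‖y - z‖ ^ 2 = 1 := by
        rw [← dist_eq_norm, heq, hcdef]; field_simp
      have e : Real.sqrt (0 ^ 2 + ε ^ 2) = ε := by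
        rw [zero_pow two_ne_zero, zero_add, Real.sqrt_sq hε.le]
      simp only [testFn, hone, sub_self, norm_zero, e, hK0 z hz, one_pow] at h
      have hyM := hM y hyb
      have e2 : M * (c * 0 ^ 2) ^ (k + 1) = 0 := by simp
      rw [e2] at h
      have : ε < Real.sqrt (‖y - z‖ ^ 2 + ε ^ 2) := by
        apply Real.lt_sqrt_of_sq_lt
        have : 0 < ‖y - z‖ ^ 2 := by rw [← dist_eq_norm, heq]; positivity
        linarith
      nlinarith
    have hloc : IsLocalMin (fun v => testFn z (1 + η) ε M c (k + 1) v - u v) y := by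
      filter_upwards [Metric.isOpen_ball.mem_nhds (Metric.mem_ball.2 hlt)] with v hv
      have := hy' v (Metric.ball_subset_closedBall hv)
      linarith
    have h := hsuper y hyK _ ⟨_, hcd, rfl, hloc⟩
    rw [testFn_fderiv _ _ _ _ _ _ hε] at h
    have hp : 0 ≤ 2 * M * c * ((k + 1 : ℕ) : ℝ) * (c * ‖y - z‖ ^ 2) ^ (k + 1 - 1) := by positivity
    have hs : 0 < ‖y - z‖ := by linarith
    have h2 : 1 < (1 + η) / Real.sqrt (‖y - z‖ ^ 2 + ε ^ 2) * ‖y - z‖ := by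
      rw [div_mul_eq_mul_div, lt_div_iff₀ hsp]
      have := sqrt_le_add_aux ‖y - z‖ ε hs.le hε.le
      nlinarith
    have h3 := mul_le_mul_of_nonneg_right
      ((le_add_of_nonneg_right hp).trans (le_abs_self _)) hs.le (b := (1 + η) / Real.sqrt (‖y - z‖ ^ 2 + ε ^ 2))
    linarith
  have h := hy' x (by rw [Metric.mem_closedBall]; linarith)
  have hx : testFn z (1 + η) ε M c (k + 1) x ≤ (1 + η) * (r + η) + η := by
    unfold testFn
    rw [← dist_eq_norm, ← hr]
    have a1 := sqrt_le_add_aux r ε hr0 hε.le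
    have a2 : M * (c * r ^ 2) ^ (k + 1) ≤ M * (c * r ^ 2) ^ k := by
      refine mul_le_mul_of_nonneg_left (pow_le_pow_of_le_one (by positivity) ?_ (by omega)) hM0
      rw [hcdef, one_div_mul_eq_div, div_le_one (by positivity)]
      nlinarith
    have a3 : (1 + η) * Real.sqrt (r ^ 2 + ε ^ 2) ≤ (1 + η) * (r + η) :=
      mul_le_mul_of_nonneg_left (by linarith) (by linarith)
    linarith
  linarith

theorem eikonal_uniqueness {n : ℕ}
    {K : Set (EuclideanSpace ℝ (Fin n))} (hK : K.Nonempty) (hKclosed : IsClosed K)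
    {u : EuclideanSpace ℝ (Fin n) → ℝ} (hu : Continuous u)
    (hbdd : BddBelow (Set.range u)) (hK0 : ∀ x ∈ K, u x = 0)
    (hsuper : ∀ x ∉ K, ∀ v ∈ superdiff u x, ‖v‖ ≤ 1)
    (hsub : ∀ x ∉ K, ∀ v ∈ subdiff u x, 1 ≤ ‖v‖) :
    u = fun x => Metric.infDist x K := by
  funext x
  apply le_antisymm
  · rw [Metric.le_infDist hK]
    intro z hz
    have hc : Continuous fun η : ℝ => η + (1 + η) * (dist x z + η) + η := by fun_prop
    have ht := (hc.tendsto 0).mono_left (nhdsWithin_le_nhds (s := Set.Ioi 0))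
    have := ge_of_tendsto ht (Filter.eventually_of_mem self_mem_nhdsWithin
      fun η hη => eik_upper hu hK0 hsuper x z hz η hη)
    simpa using this
  · have hc : Continuous fun η : ℝ => (1 - η) * Metric.infDist x K - (1 - η) * η := by fun_prop
    have ht := (hc.tendsto 0).mono_left (nhdsWithin_le_nhds (s := Set.Ioi 0))
    have := le_of_tendsto (b := u x) ht (by
      filter_upwards [Ioo_mem_nhdsGT (zero_lt_one' ℝ)] with η hη
      have := eik_lower hu hbdd hK0 hsub x η hη.1 hη.2
      linarith)
    simpa using this
end

section
/- Let K be a nonempty closed subset of ℝⁿ. Then the function d_K²/2 is a viscosity solution on all of ℝⁿ of ‖∇u‖² − 2u = 0, i.e. for every x ∈ ℝⁿ, every v ∈ ∂⁺(d_K²/2)(x) satisfies ‖v‖² ≤ d_K(x)² and every v ∈ ∂⁻(d_K²/2)(x) satisfies ‖v‖² ≥ d_K(x)². Moreover, if u : ℝⁿ → ℝ is any continuous viscosity solution of ‖∇u‖² − 2u = 0 on ℝⁿ whose zero set {x : u(x) = 0} equals K, then u = d_K²/2. -/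
open Metric Filter Topology

section helpers

variable {E : Type*} [NormedAddCommGroup E] [InnerProductSpace ℝ E]

lemma aux_oneSided {f : ℝ → ℝ} {f' : ℝ} (hf : HasDerivAt f f' 0)
    (h : ∀ᶠ t in 𝓝[>] (0 : ℝ), f 0 ≤ f t) : 0 ≤ f' := by
  have h1 := (hasDerivWithinAt_iff_tendsto_slope' (s := Set.Ioi (0 : ℝ)) (by simp)).1
    hf.hasDerivWithinAt
  refine ge_of_tendsto h1 ?_
  filter_upwards [h, self_mem_nhdsWithin] with t ht ht0
  have ht0 : 0 < t := ht0
  rw [slope_def_field]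
  apply div_nonneg <;> linarith

lemma aux_line {φ : E → ℝ} {x : E} (hφ : ContDiff ℝ 1 φ) (h : E) :
    HasDerivAt (fun t : ℝ => φ (x + t • h)) (fderiv ℝ φ x h) 0 := by
  have h1 : HasFDerivAt φ (fderiv ℝ φ x) (x + (0 : ℝ) • h) := by
    simpa using (hφ.differentiable (by norm_num) x).hasFDerivAt
  have h2 : HasDerivAt (fun t : ℝ => x + t • h) h 0 := by
    simpa using ((hasDerivAt_id (0 : ℝ)).smul_const h).const_add x
  exact h1.comp_hasDerivAt 0 h2

lemma aux_tendsto_line (x h : E) :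
    Tendsto (fun t : ℝ => x + t • h) (𝓝[>] 0) (𝓝 x) := by
  have : Continuous (fun t : ℝ => x + t • h) := by fun_prop
  have := this.tendsto 0
  simp only [zero_smul, add_zero] at this
  exact this.mono_left nhdsWithin_le_nhds

lemma aux_super {K : Set E} (x : E) {v : E →L[ℝ] ℝ}
    (hv : v ∈ superdiff (fun y => infDist y K ^ 2 / 2) x) :
    ‖v‖ ^ 2 ≤ infDist x K ^ 2 := by
  obtain ⟨φ, hφ, rfl, hmin⟩ := hv
  have key : ∀ h : E, -(infDist x K * ‖h‖) ≤ fderiv ℝ φ x h := by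
    intro h
    have hd := (aux_line (x := x) hφ h).add
      ((hasDerivAt_id (0 : ℝ)).mul_const (infDist x K * ‖h‖))
    have := aux_oneSided hd ?_
    · linarith
    · filter_upwards [(aux_tendsto_line x h).eventually hmin, self_mem_nhdsWithin] with t ht ht0
      have ht0 : 0 < t := ht0
      have h3 : infDist x K ≤ infDist (x + t • h) K + t * ‖h‖ := by
        have := infDist_le_infDist_add_dist (s := K) (x := x) (y := x + t • h)
        simpa [dist_eq_norm, norm_smul, abs_of_pos ht0] using this
      have h4 : 0 ≤ infDist x K := infDist_nonneg
      simp only [Pi.add_apply, id, zero_smul, add_zero, zero_mul] at ht ⊢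
      nlinarith [sq_nonneg (infDist (x + t • h) K - infDist x K),
        mul_le_mul_of_nonneg_left h3 h4]
  have : ‖fderiv ℝ φ x‖ ≤ infDist x K := by
    refine ContinuousLinearMap.opNorm_le_bound _ infDist_nonneg fun h => ?_
    rw [Real.norm_eq_abs, abs_le]
    refine ⟨key h, ?_⟩
    have := key (-h)
    simp only [norm_neg, map_neg] at this
    linarith
  gcongr

lemma aux_sub [ProperSpace E] {K : Set E} (hK : K.Nonempty) (hKc : IsClosed K) (x : E)
    {v : E →L[ℝ] ℝ}
    (hv : v ∈ subdiff (fun y => infDist y K ^ 2 / 2) x) :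
    infDist x K ^ 2 ≤ ‖v‖ ^ 2 := by
  obtain ⟨ψ, hψ, rfl, hmax⟩ := hv
  obtain ⟨y, hyK, hy⟩ := hKc.exists_infDist_eq_dist hK x
  set d := infDist x K with hd
  have hd0 : 0 ≤ d := infDist_nonneg
  have hn : ‖y - x‖ = d := by rw [hy, dist_comm, dist_eq_norm]
  have key : fderiv ℝ ψ x (y - x) ≤ - d ^ 2 := by
    have hq : HasDerivAt (fun t : ℝ => (1 - t) ^ 2 * d ^ 2 / 2) (-d ^ 2) 0 := by
      have := (((((hasDerivAt_id (0 : ℝ)).const_sub 1).pow 2).mul_const (d ^ 2)).div_const 2)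
      exact this.congr_deriv (by simp; ring)
    have := aux_oneSided (hq.sub (aux_line (x := x) hψ (y - x))) ?_
    · linarith
    · have hlt : ∀ᶠ t in 𝓝[>] (0 : ℝ), t < 1 :=
        nhdsWithin_le_nhds (eventually_lt_nhds (by norm_num))
      filter_upwards [(aux_tendsto_line x (y - x)).eventually hmax, self_mem_nhdsWithin, hlt]
        with t ht ht0 ht1
      have ht0 : 0 < t := ht0
      have h3 : infDist (x + t • (y - x)) K ≤ (1 - t) * d := by
        refine (infDist_le_dist_of_mem hyK).trans (le_of_eq ?_)
        have : x + t • (y - x) - y = (-(1 - t)) • (y - x) := by module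
        rw [dist_eq_norm, this, norm_smul, hn, norm_neg, Real.norm_eq_abs,
          abs_of_pos (by linarith)]
      have h4 : infDist (x + t • (y - x)) K ^ 2 ≤ ((1 - t) * d) ^ 2 :=
        pow_le_pow_left₀ infDist_nonneg h3 2
      simp only [Pi.sub_apply, zero_smul, add_zero] at ht ⊢
      rw [← hd] at ht
      nlinarith
  have h1 := (fderiv ℝ ψ x).le_opNorm (y - x)
  rw [hn, Real.norm_eq_abs] at h1
  have h2 := neg_abs_le (fderiv ℝ ψ x (y - x))
  rcases hd0.eq_or_lt with h0 | h0
  · rw [← h0, zero_pow two_ne_zero]; exact sq_nonneg _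
  · have : d ≤ ‖fderiv ℝ ψ x‖ := by
      by_contra! hc
      nlinarith
    gcongr

/-- The basic radial test function. -/
lemma aux_radial (k : E) {F : ℝ → ℝ} (hF : ContDiff ℝ 1 F) {F' : ℝ} (y : E)
    (hF' : HasDerivAt F F' (‖y - k‖ ^ 2)) (c : ℝ) :
    ContDiff ℝ 1 (fun z => (c + F (‖z - k‖ ^ 2)) ^ 2 / 2) ∧
    ‖fderiv ℝ (fun z => (c + F (‖z - k‖ ^ 2)) ^ 2 / 2) y‖ ^ 2
      = (c + F (‖y - k‖ ^ 2)) ^ 2 * (2 * F' * ‖y - k‖) ^ 2 := by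
  have hs : ContDiff ℝ 1 (fun z : E => ‖z - k‖ ^ 2) :=
    (contDiff_id.sub contDiff_const).norm_sq ℝ
  refine ⟨((contDiff_const.add (hF.comp hs)).pow 2).div_const 2, ?_⟩
  have h1 : HasFDerivAt (fun z : E => ‖z - k‖ ^ 2) (2 • (innerSL ℝ (y - k))) y := by
    have := ((hasFDerivAt_id y).sub_const k).norm_sq
    simpa using this
  have h2 := (hF'.comp_hasFDerivAt y h1)
  have hG : HasDerivAt (fun s : ℝ => (c + s) ^ 2 / 2) (c + F (‖y - k‖ ^ 2)) (F (‖y - k‖ ^ 2)) := by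
    have := ((((hasDerivAt_id (F (‖y - k‖ ^ 2))).const_add c).pow 2).div_const 2)
    exact this.congr_deriv (by simp)
  have h3 := hG.comp_hasFDerivAt y h2
  have h4 : fderiv ℝ (fun z => (c + F (‖z - k‖ ^ 2)) ^ 2 / 2) y = _ := h3.fderiv
  rw [h4, norm_smul, norm_smul, ← Nat.cast_smul_eq_nsmul ℝ, norm_smul, innerSL_apply_norm]
  simp only [Real.norm_eq_abs, mul_pow, sq_abs, Nat.cast_ofNat]
  ring

lemma aux_nonneg [ProperSpace E] {u : E → ℝ} (hu : Continuous u)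
    (hsup : ∀ x, ∀ v ∈ superdiff u x, ‖v‖ ^ 2 ≤ 2 * u x) (x : E) : 0 ≤ u x := by
  by_contra! hx
  obtain ⟨r, hr, hball⟩ := Metric.nhds_basis_closedBall.mem_iff.1
    (hu.continuousAt.eventually (eventually_lt_nhds hx))
  set A := (-u x + 1) / r ^ 2 with hA
  have hAr : A * r ^ 2 = -u x + 1 := by rw [hA]; field_simp
  obtain ⟨y, hy, hmax⟩ := (isCompact_closedBall x r).exists_isMaxOn (f := fun z => u z - A * ‖z - x‖ ^ 2)
    ⟨x, by simp [hr.le]⟩ (by fun_prop)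
  have huy : u y < 0 := hball hy
  have h0 := hmax (mem_closedBall_self hr.le)
  simp only [Set.mem_ofPred_eq, sub_self, norm_zero] at h0
  have hyr : ‖y - x‖ ≤ r := by simpa [dist_eq_norm] using hy
  have hlt : dist y x < r := by
    rcases hyr.lt_or_eq with h | h
    · rwa [dist_eq_norm]
    · rw [h, hAr] at h0
      linarith
  have hs : ContDiff ℝ 1 (fun z : E => A * ‖z - x‖ ^ 2) :=
    contDiff_const.mul ((contDiff_id.sub contDiff_const).norm_sq ℝ)
  have := hsup y _ ⟨_, hs, rfl, ?_⟩
  · have h2 := sq_nonneg ‖fderiv ℝ (fun z : E => A * ‖z - x‖ ^ 2) y‖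
    linarith
  · filter_upwards [isOpen_ball.mem_nhds hlt] with z hz
    have := hmax (ball_subset_closedBall hz)
    simp only [Set.mem_ofPred_eq] at this
    linarith

/-- AM-GM majorant of the square root. -/
lemma aux_amgm {a b : ℝ} (hb : 0 < b) : a ≤ (a ^ 2 + b ^ 2) / (2 * b) := by
  rw [le_div_iff₀ (by positivity)]
  nlinarith [sq_nonneg (a - b)]

lemma aux_lower [ProperSpace E] {u : E → ℝ} (hu : Continuous u) (hpos : ∀ x, 0 ≤ u x)
    (hsub : ∀ x, ∀ v ∈ subdiff u x, 2 * u x ≤ ‖v‖ ^ 2) (x : E) :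
    infDist x {x | u x = 0} ≤ √(2 * u x) := by
  refine le_of_forall_pos_le_add fun ε hε => ?_
  set w : E → ℝ := fun y => √(2 * u y) with hw
  have hwc : Continuous w := by fun_prop
  have hw0 : ∀ y, 0 ≤ w y := fun y => Real.sqrt_nonneg _
  have hwsq : ∀ y, w y ^ 2 = 2 * u y := fun y => Real.sq_sqrt (by linarith [hpos y])
  set S : E → ℝ := fun y => √(ε ^ 2 + ‖y - x‖ ^ 2) with hS
  have hSpos : ∀ y, 0 < S y := fun y => Real.sqrt_pos.2 (by positivity)
  have hSsq : ∀ y, S y ^ 2 = ε ^ 2 + ‖y - x‖ ^ 2 := fun y => Real.sq_sqrt (by positivity)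
  have hSge : ∀ y, ‖y - x‖ ≤ S y := fun y => Real.le_sqrt_of_sq_le (by nlinarith [sq_nonneg ε])
  have hSx : S x = ε := by simp [hS, hε.le]
  set R := w x + ε + 1 with hR
  have hRpos : 0 < R := by have := hw0 x; linarith
  obtain ⟨y, hy, hmin⟩ := (isCompact_closedBall x R).exists_isMinOn (f := fun z => w z + S z)
    ⟨x, by simp [hRpos.le]⟩ (by fun_prop)
  have hx := hmin (mem_closedBall_self hRpos.le)
  simp only [Set.mem_ofPred_eq, hSx] at hx
  have hlt : dist y x < R := by
    rw [dist_eq_norm]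
    linarith [hSge y, hw0 y]
  by_cases hy0 : u y = 0
  · have := infDist_le_dist_of_mem (x := x) (s := {x | u x = 0}) (y := y) hy0
    rw [dist_comm, dist_eq_norm] at this
    linarith [hSge y, hw0 y]
  exfalso
  have huy : 0 < u y := lt_of_le_of_ne (hpos y) (Ne.symm hy0)
  have hwy : 0 < w y := Real.sqrt_pos.2 (by linarith)
  set F : ℝ → ℝ := fun s => -((ε ^ 2 + s + S y ^ 2) / (2 * S y)) with hF
  have hFc : ContDiff ℝ 1 F := by
    rw [hF]; fun_prop
  have hF' : HasDerivAt F (-(1 / (2 * S y))) (‖y - x‖ ^ 2) :=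
    ((((hasDerivAt_id _).const_add (ε ^ 2)).add_const (S y ^ 2)).div_const _).neg
  have hFy : F (‖y - x‖ ^ 2) = - S y := by
    simp only [hF]
    rw [← hSsq]
    have := hSpos y
    field_simp
    ring
  obtain ⟨h1, h2⟩ := aux_radial x hFc y hF' (w y + S y)
  have h3 := hsub y _ ⟨_, h1, rfl, ?_⟩
  · rw [h2, hFy, add_neg_cancel_right, hwsq] at h3
    have h5 : (2 * -(1 / (2 * S y)) * ‖y - x‖) ^ 2 < 1 := by
      have : (2 * -(1 / (2 * S y)) * ‖y - x‖) ^ 2 = ‖y - x‖ ^ 2 / S y ^ 2 := by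
        have := hSpos y
        field_simp
      rw [this, div_lt_one (pow_pos (hSpos y) 2), hSsq]
      have := pow_pos hε 2
      linarith
    nlinarith
  · have hcont : Continuous (fun z => w y + S y + F (‖z - x‖ ^ 2)) := by
      have := hFc.continuous
      fun_prop
    have hgpos : ∀ᶠ z in 𝓝 y, 0 < w y + S y + F (‖z - x‖ ^ 2) := by
      refine hcont.continuousAt.eventually (eventually_gt_nhds ?_)
      change 0 < w y + S y + F (‖y - x‖ ^ 2)
      rw [hFy]; linarith
    filter_upwards [isOpen_ball.mem_nhds hlt, hgpos] with z hz hgz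
    have hm := hmin (ball_subset_closedBall hz)
    simp only [Set.mem_ofPred_eq] at hm
    have ham : S z ≤ -F (‖z - x‖ ^ 2) := by
      have := aux_amgm (a := S z) (hSpos y)
      rw [hSsq z] at this
      simpa [hF] using this
    have hle : w y + S y + F (‖z - x‖ ^ 2) ≤ w z := by linarith
    have hsq := pow_le_pow_left₀ hgz.le hle 2
    rw [hwsq] at hsq
    simp only [hFy, add_neg_cancel_right, hwsq]
    linarith

lemma aux_upper [ProperSpace E] {u : E → ℝ} (hu : Continuous u) (hpos : ∀ x, 0 ≤ u x)
    (hsup : ∀ x, ∀ v ∈ superdiff u x, ‖v‖ ^ 2 ≤ 2 * u x) (k : E) (hk : u k = 0) (x : E) :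
    √(2 * u x) ≤ dist x k := by
  refine le_of_forall_pos_le_add fun η hη => ?_
  set w : E → ℝ := fun y => √(2 * u y) with hw
  have hwc : Continuous w := by fun_prop
  have hw0 : ∀ y, 0 ≤ w y := fun y => Real.sqrt_nonneg _
  have hwsq : ∀ y, w y ^ 2 = 2 * u y := fun y => Real.sq_sqrt (by linarith [hpos y])
  have hwk : w k = 0 := by simp [hw, hk]
  rw [dist_eq_norm]
  set R := ‖x - k‖ + 1 with hR
  have hRpos : 0 < R := by positivity
  obtain ⟨y1, -, hy1⟩ := (isCompact_closedBall k R).exists_isMaxOn (f := w)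
    ⟨k, by simp [hRpos.le]⟩ hwc.continuousOn
  set M := w y1 + 1 with hM
  have hMpos : 0 < M := by have := hw0 y1; linarith
  have hq1 : ‖x - k‖ ^ 2 / R ^ 2 < 1 := by
    rw [div_lt_one (by positivity)]
    have := norm_nonneg (x - k)
    nlinarith
  obtain ⟨m, hm⟩ := exists_pow_lt_of_lt_one (show 0 < η / M by positivity) hq1
  -- use exponent `m + 1`
  have hm' : M * (‖x - k‖ ^ 2 / R ^ 2) ^ (m + 1) ≤ η := by
    have h1 : (‖x - k‖ ^ 2 / R ^ 2) ^ (m + 1) ≤ (‖x - k‖ ^ 2 / R ^ 2) ^ m :=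
      pow_le_pow_of_le_one (by positivity) hq1.le (Nat.le_succ m)
    have h2 := (lt_div_iff₀ hMpos).1 (h1.trans_lt hm)
    linarith
  set P : ℝ → ℝ := fun s => M * (s / R ^ 2) ^ (m + 1) with hP
  have hPc : ContDiff ℝ 1 P := by rw [hP]; fun_prop
  have hPcont := hPc.continuous
  obtain ⟨y, hy, hmax⟩ := (isCompact_closedBall k R).exists_isMaxOn
    (f := fun z => w z - (‖z - k‖ + P (‖z - k‖ ^ 2)))
    ⟨k, by simp [hRpos.le]⟩ (by fun_prop)
  have hxm := hmax (show x ∈ closedBall k R by rw [mem_closedBall, dist_eq_norm]; linarith)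
  have hkm := hmax (mem_closedBall_self hRpos.le)
  have hP0 : ∀ s, 0 ≤ s → 0 ≤ P s := fun s hs => by simp only [hP]; positivity
  have hPz : P 0 = 0 := by simp [hP]
  simp only [Set.mem_ofPred_eq] at hxm hkm
  simp only [sub_self, norm_zero, hwk, ne_eq, OfNat.ofNat_ne_zero, not_false_eq_true, zero_pow,
    hPz, add_zero] at hkm
  have hPx : P (‖x - k‖ ^ 2) ≤ η := hm'
  by_cases hy0 : u y = 0
  · have : w y = 0 := by simp [hw, hy0]
    rw [this] at hxm
    have h1 := norm_nonneg (y - k)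
    have h2 := hP0 (‖y - k‖ ^ 2) (by positivity)
    linarith
  exfalso
  have huy : 0 < u y := lt_of_le_of_ne (hpos y) (Ne.symm hy0)
  have hr0 : 0 < ‖y - k‖ := by
    rw [norm_pos_iff, sub_ne_zero]
    rintro rfl
    exact hy0 hk
  have hyR : ‖y - k‖ ≤ R := by simpa [dist_eq_norm] using hy
  have hlt : dist y k < R := by
    rw [dist_eq_norm]
    rcases hyR.lt_or_eq with h | h
    · exact h
    · have hPR : P (R ^ 2) = M := by
        simp only [hP]
        rw [div_self (by positivity), one_pow, mul_one]
      rw [h, hPR] at hkm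
      have := hy1 hy
      simp only [Set.mem_ofPred_eq] at this
      linarith
  set r := ‖y - k‖ with hr
  set F : ℝ → ℝ := fun s => (s + r ^ 2) / (2 * r) + P s with hF
  have hFc : ContDiff ℝ 1 F := by
    rw [hF]; fun_prop
  have hFy : F (r ^ 2) = r + P (r ^ 2) := by
    simp only [hF]
    field_simp
    ring
  have hP' : HasDerivAt P (M * (((m + 1 : ℕ) : ℝ) * (r ^ 2 / R ^ 2) ^ m * (1 / R ^ 2))) (r ^ 2) := by
    have := ((((hasDerivAt_id (r ^ 2)).div_const (R ^ 2)).pow (m + 1)).const_mul M)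
    simpa using this
  have hF' := ((((hasDerivAt_id (r ^ 2)).add_const (r ^ 2)).div_const (2 * r)).add hP')
  have hP'pos : 0 < M * (((m + 1 : ℕ) : ℝ) * (r ^ 2 / R ^ 2) ^ m * (1 / R ^ 2)) := by positivity
  set D := M * (((m + 1 : ℕ) : ℝ) * (r ^ 2 / R ^ 2) ^ m * (1 / R ^ 2)) with hD
  obtain ⟨h1, h2⟩ := aux_radial k hFc y hF' (w y - (r + P (r ^ 2)))
  have h3 := hsup y _ ⟨_, h1, rfl, ?_⟩
  · rw [h2, ← hr, hFy, sub_add_cancel, hwsq] at h3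
    have h5 : 1 < 2 * (1 / (2 * r) + D) * r := by
      have : 2 * (1 / (2 * r) + D) * r = 1 + 2 * D * r := by field_simp
      rw [this]
      have := mul_pos hP'pos hr0
      linarith
    have h6 := one_lt_pow₀ h5 two_ne_zero
    nlinarith
  · filter_upwards [isOpen_ball.mem_nhds hlt] with z hz
    have hm := hmax (ball_subset_closedBall hz)
    simp only [Set.mem_ofPred_eq] at hm
    have ham := aux_amgm (a := ‖z - k‖) hr0
    have hle : w z ≤ w y - (r + P (r ^ 2)) + F (‖z - k‖ ^ 2) := by
      simp only [hF]; linarith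
    have hsq := pow_le_pow_left₀ (hw0 z) hle 2
    rw [hwsq] at hsq
    simp only [← hr, hFy, sub_add_cancel, hwsq]
    linarith

end helpers

theorem sq_distance_viscosity_solution_and_uniqueness {n : ℕ}
    {K : Set (EuclideanSpace ℝ (Fin n))} (hK : K.Nonempty) (hKclosed : IsClosed K) :
    (∀ x : EuclideanSpace ℝ (Fin n),
      (∀ v ∈ superdiff (fun y => Metric.infDist y K ^ 2 / 2) x,
          ‖v‖ ^ 2 ≤ Metric.infDist x K ^ 2) ∧
      (∀ v ∈ subdiff (fun y => Metric.infDist y K ^ 2 / 2) x,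
          Metric.infDist x K ^ 2 ≤ ‖v‖ ^ 2)) ∧
    (∀ u : EuclideanSpace ℝ (Fin n) → ℝ, Continuous u → {x | u x = 0} = K →
      (∀ x, ∀ v ∈ superdiff u x, ‖v‖ ^ 2 ≤ 2 * u x) →
      (∀ x, ∀ v ∈ subdiff u x, 2 * u x ≤ ‖v‖ ^ 2) →
      u = fun x => Metric.infDist x K ^ 2 / 2) := by
  refine ⟨fun x => ⟨fun v hv => aux_super x hv, fun v hv => aux_sub hK hKclosed x hv⟩, ?_⟩
  intro u hu hz hsup hsub
  have hpos := aux_nonneg hu hsup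
  funext x
  have h1 := aux_lower hu hpos hsub x
  rw [hz] at h1
  have h2 : √(2 * u x) ≤ Metric.infDist x K := by
    obtain ⟨k, hk, hd⟩ := hKclosed.exists_infDist_eq_dist hK x
    rw [hd]
    rw [← hz] at hk
    exact aux_upper hu hpos hsup k hk x
  rw [le_antisymm h1 h2, Real.sq_sqrt (by linarith [hpos x])]
  ring
end

section
/- Let Ω ⊆ ℝⁿ be open and let u : Ω → ℝ be a continuous viscosity solution of ‖∇u‖ − 1 = 0 on Ω (for every x ∈ Ω, ‖w‖ ≤ 1 for all w ∈ ∂⁺u(x) and ‖w‖ ≥ 1 for all w ∈ ∂⁻u(x)). Then the function v = −e^{−u} is a viscosity solution of ‖∇v‖ + v = 0 on Ω, i.e. for every x ∈ Ω, ‖w‖ + v(x) ≤ 0 for all w ∈ ∂⁺v(x) and ‖w‖ + v(x) ≥ 0 for all w ∈ ∂⁻v(x). -/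
theorem kruzhkov_transform_viscosity {n : ℕ}
    {Ω : Set (EuclideanSpace ℝ (Fin n))} (hΩ : IsOpen Ω)
    {u : EuclideanSpace ℝ (Fin n) → ℝ} (hu : ContinuousOn u Ω)
    (hsuper : ∀ x ∈ Ω, ∀ w ∈ superdiff u x, ‖w‖ ≤ 1)
    (hsub : ∀ x ∈ Ω, ∀ w ∈ subdiff u x, 1 ≤ ‖w‖) :
    ∀ x ∈ Ω,
      (∀ w ∈ superdiff (fun y => -Real.exp (-u y)) x,
        ‖w‖ + (-Real.exp (-u x)) ≤ 0) ∧
      (∀ w ∈ subdiff (fun y => -Real.exp (-u y)) x,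
        0 ≤ ‖w‖ + (-Real.exp (-u x))) := by
  intro x hx
  have hpos : 0 < Real.exp (u x) := Real.exp_pos _
  have hinv : Real.exp (u x) * Real.exp (-u x) = 1 := by
    rw [← Real.exp_add]; simp
  have hnorm : ∀ w : EuclideanSpace ℝ (Fin n) →L[ℝ] ℝ,
      ‖Real.exp (u x) • w‖ = Real.exp (u x) * ‖w‖ := by
    intro w
    rw [norm_smul, Real.norm_eq_abs, abs_of_pos hpos]
  constructor
  · rintro w ⟨φ, hφ, hw, hmin⟩
    have hd : HasFDerivAt φ w x := by
      rw [← hw]; exact (hφ.differentiable one_ne_zero x).hasFDerivAt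
    have key : Real.exp (u x) • w ∈ superdiff u x := by
      refine ⟨fun y => Real.exp (u x) * (φ y - φ x)
        + 2 * (Real.exp (u x) * (φ y - φ x)) ^ 2, ?_, ?_, ?_⟩
      · fun_prop
      · have h1 : HasFDerivAt (fun y => Real.exp (u x) * (φ y - φ x))
            (Real.exp (u x) • w) x := (hd.sub_const (φ x)).const_mul _
        have h2 := h1.add ((h1.pow 2).const_mul 2)
        have h3 := h2.fderiv
        simp at h3
        exact h3
      · have hc : ContinuousAt (fun y => Real.exp (u x) * (φ y - φ x)) x := by
          have := hφ.continuous
          fun_prop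
        have hev : ∀ᶠ y in nhds x, Real.exp (u x) * (φ y - φ x) < 1 / 2 := by
          apply hc.eventually_lt_const
          simp
        filter_upwards [hmin, hev] with y hy hr
        simp only [sub_self, mul_zero] at hy ⊢
        set r := Real.exp (u x) * (φ y - φ x) with hrdef
        have hE : Real.exp (u y) * Real.exp (-u y) = 1 := by
          rw [← Real.exp_add]; simp
        have hEs : Real.exp (u y - u x) * Real.exp (u x) = Real.exp (u y) := by
          rw [← Real.exp_add]; simp
        have hs := Real.add_one_le_exp (u y - u x)
        have hp := Real.exp_pos (u y - u x)
        have hq : 1 - r ≤ Real.exp (u x) * Real.exp (-u y) := by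
          have := mul_le_mul_of_nonneg_left hy hpos.le
          nlinarith
        have h4 : Real.exp (u y - u x) * (1 - r) ≤ 1 := by
          have := mul_le_mul_of_nonneg_left hq hp.le
          rw [← mul_assoc, hEs, hE] at this
          exact this
        have h5 : Real.exp (u y - u x) ≤ 1 + r + 2 * r ^ 2 := by
          have h6 : 1 ≤ (1 + r + 2 * r ^ 2) * (1 - r) := by
            nlinarith [mul_nonneg (sq_nonneg r) (by linarith : 0 ≤ 1 - 2 * r)]
          exact le_of_mul_le_mul_right (h4.trans h6) (by linarith)
        norm_num
        linarith
    have h := hsuper x hx _ key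
    rw [hnorm] at h
    have : ‖w‖ ≤ Real.exp (-u x) :=
      le_of_mul_le_mul_left (by rw [hinv]; exact h) hpos
    linarith
  · rintro w ⟨φ, hφ, hw, hmax⟩
    have hd : HasFDerivAt φ w x := by
      rw [← hw]; exact (hφ.differentiable one_ne_zero x).hasFDerivAt
    have key : Real.exp (u x) • w ∈ subdiff u x := by
      refine ⟨fun y => Real.exp (u x) * φ y, ?_, (hd.const_mul _).fderiv, ?_⟩
      · fun_prop
      · filter_upwards [hmax] with y hy
        have hs := Real.add_one_le_exp (u x - u y)
        have hEs : Real.exp (u x) * Real.exp (-u y) = Real.exp (u x - u y) := by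
          rw [← Real.exp_add]; rfl
        have := mul_le_mul_of_nonneg_left hy hpos.le
        beta_reduce at this ⊢
        nlinarith
    have h := hsub x hx _ key
    rw [hnorm] at h
    have : Real.exp (-u x) ≤ ‖w‖ :=
      le_of_mul_le_mul_left (by rw [hinv]; exact h) hpos
    linarith
end

section
/- Let K be a nonempty closed subset of ℝⁿ and let u, v : ℝⁿ → ℝ be bounded continuous functions such that u = v = −1 on K and both u and v are viscosity solutions of ‖∇w‖ + w = 0 on ℝⁿ \ K (for every x ∉ K, ‖p‖ + w(x) ≤ 0 for all p ∈ ∂⁺w(x) and ‖p‖ + w(x) ≥ 0 for all p ∈ ∂⁻w(x), where w stands for u or v). Then u = v on all of ℝⁿ. -/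
lemma hasFDerivAt_sq_dist_aux {E : Type*} [NormedAddCommGroup E] [InnerProductSpace ℝ E]
    (c x : E) (a : ℝ) :
    HasFDerivAt (fun z : E => a * ‖z - c‖ ^ 2) ((2 * a) • innerSL ℝ (x - c)) x := by
  have h := (((hasFDerivAt_id (𝕜 := ℝ) x).sub_const c).norm_sq).const_mul a
  refine h.congr_fderiv ?_
  ext w
  simp
  ring

lemma contDiff_sq_dist_aux {E : Type*} [NormedAddCommGroup E] [InnerProductSpace ℝ E]
    (c : E) (a : ℝ) :
    ContDiff ℝ 1 (fun z : E => a * ‖z - c‖ ^ 2) :=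
  contDiff_const.mul ((contDiff_id.sub contDiff_const).norm_sq ℝ)

lemma comparison_aux {n : ℕ}
    {K : Set (EuclideanSpace ℝ (Fin n))}
    {u v : EuclideanSpace ℝ (Fin n) → ℝ}
    (hu : Continuous u) (hv : Continuous v)
    (hubdd : ∃ C : ℝ, ∀ x, |u x| ≤ C) (hvbdd : ∃ C : ℝ, ∀ x, |v x| ≤ C)
    (huK : ∀ x ∈ K, u x = -1) (hvK : ∀ x ∈ K, v x = -1)
    (husuper : ∀ x ∉ K, ∀ p ∈ superdiff u x, ‖p‖ + u x ≤ 0)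
    (hvsub : ∀ x ∉ K, ∀ p ∈ subdiff v x, 0 ≤ ‖p‖ + v x)
    (x0 : EuclideanSpace ℝ (Fin n)) : u x0 ≤ v x0 := by
  by_contra! hlt
  obtain ⟨C, hC⟩ := hubdd
  obtain ⟨C', hC'⟩ := hvbdd
  obtain ⟨δ, hδ⟩ : ∃ δ, δ = u x0 - v x0 := ⟨_, rfl⟩
  have hδ0 : 0 < δ := by linarith
  obtain ⟨B, hB⟩ : ∃ B, B = C + C' := ⟨_, rfl⟩
  have huv : ∀ x y, u x - v y ≤ B := fun x y => by
    have := abs_le.1 (hC x)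
    have := abs_le.1 (hC' y)
    linarith
  have hB0 : 0 < B := by linarith [huv x0 x0]
  obtain ⟨α, hα⟩ : ∃ α, α = δ ^ 2 / (8 * B) := ⟨_, rfl⟩
  have hα0 : 0 < α := by rw [hα]; positivity
  have hαB : 8 * α * B = δ ^ 2 := by rw [hα]; field_simp
  obtain ⟨R, hR⟩ : ∃ R, R = 3 * B / δ := ⟨_, rfl⟩
  have hR0 : 0 < R := by rw [hR]; positivity
  have hαR : B < α * R ^ 2 := by
    have : α * R ^ 2 = 9 / 8 * B := by rw [hα, hR]; field_simp; norm_num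
    linarith
  have hcpt := isCompact_closedBall x0 (R + 1)
  obtain ⟨η₁, hη₁, hη₁u⟩ := Metric.uniformContinuousOn_iff.1
    (hcpt.uniformContinuousOn_of_continuous hu.continuousOn) δ hδ0
  obtain ⟨η₂, hη₂, hη₂v⟩ := Metric.uniformContinuousOn_iff.1
    (hcpt.uniformContinuousOn_of_continuous hv.continuousOn) δ hδ0
  obtain ⟨η, hη⟩ : ∃ η, η = min 1 (min η₁ η₂) := ⟨_, rfl⟩
  have hη0 : 0 < η := by rw [hη]; positivity
  have hη1 : η ≤ 1 := by rw [hη]; exact min_le_left _ _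
  have hηη₁ : η ≤ η₁ := by rw [hη]; exact (min_le_right _ _).trans (min_le_left _ _)
  have hηη₂ : η ≤ η₂ := by rw [hη]; exact (min_le_right _ _).trans (min_le_right _ _)
  obtain ⟨N, hN⟩ : ∃ N, N = (B + 1) / η ^ 2 := ⟨_, rfl⟩
  have hN0 : 0 < N := by rw [hN]; positivity
  have hNη : N * η ^ 2 = B + 1 := by rw [hN]; field_simp
  -- key localization
  have key : ∀ x y, 0 ≤ u x - v y - N * ‖x - y‖ ^ 2 - α * ‖x - x0‖ ^ 2 →
      ‖x - x0‖ ≤ R ∧ ‖x - y‖ < η := by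
    intro x y h
    have h1 := huv x y
    have h2 : 0 ≤ N * ‖x - y‖ ^ 2 := by positivity
    have h3 : 0 ≤ α * ‖x - x0‖ ^ 2 := by positivity
    constructor
    · by_contra! hc
      have : α * R ^ 2 ≤ α * ‖x - x0‖ ^ 2 := by gcongr
      linarith
    · by_contra! hc
      have : N * η ^ 2 ≤ N * ‖x - y‖ ^ 2 := by gcongr
      linarith
  have keyball : ∀ x y, ‖x - x0‖ ≤ R → ‖x - y‖ < η →
      x ∈ Metric.closedBall x0 (R + 1) ∧ y ∈ Metric.closedBall x0 (R + 1) := by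
    intro x y h1 h2
    rw [Metric.mem_closedBall, Metric.mem_closedBall, dist_eq_norm, dist_eq_norm]
    refine ⟨by linarith, ?_⟩
    have : ‖y - x0‖ ≤ ‖x - x0‖ + ‖x - y‖ := by
      have := norm_sub_le (x - x0) (x - y)
      simpa using this
    linarith
  let Φ : EuclideanSpace ℝ (Fin n) × EuclideanSpace ℝ (Fin n) → ℝ :=
    fun q => u q.1 - v q.2 - N * ‖q.1 - q.2‖ ^ 2 - α * ‖q.1 - x0‖ ^ 2
  have hΦ : Continuous Φ := by fun_prop
  have hΦ0 : Φ (x0, x0) = δ := by simp [Φ, hδ]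
  obtain ⟨⟨x, y⟩, hmax⟩ := hΦ.exists_forall_ge' (x0, x0) (by
    filter_upwards [(hcpt.prod hcpt).compl_mem_cocompact] with q hq
    by_contra! hc
    rw [hΦ0] at hc
    obtain ⟨h1, h2⟩ := key q.1 q.2 (hδ0.trans hc).le
    exact hq (keyball _ _ h1 h2))
  have hxy : δ ≤ u x - v y - N * ‖x - y‖ ^ 2 - α * ‖x - x0‖ ^ 2 := by
    rw [← hΦ0]; exact hmax (x0, x0)
  obtain ⟨hxR, hxyη⟩ := key x y (hδ0.le.trans hxy)
  obtain ⟨hxb, hyb⟩ := keyball x y hxR hxyη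
  have h2 : 0 ≤ N * ‖x - y‖ ^ 2 := by positivity
  have h3 : 0 ≤ α * ‖x - x0‖ ^ 2 := by positivity
  by_cases hxK : x ∈ K
  · have h := hη₂v x hxb y hyb (by rw [dist_eq_norm]; linarith)
    rw [Real.dist_eq] at h
    have := le_abs_self (v x - v y)
    linarith [huK x hxK, hvK x hxK]
  by_cases hyK : y ∈ K
  · have h := hη₁u x hxb y hyb (by rw [dist_eq_norm]; linarith)
    rw [Real.dist_eq] at h
    have := le_abs_self (u x - u y)
    linarith [huK y hyK, hvK y hyK]
  have hp : (2 * N) • innerSL ℝ (x - y) + (2 * α) • innerSL ℝ (x - x0) ∈ superdiff u x := by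
    refine ⟨fun z => N * ‖z - y‖ ^ 2 + α * ‖z - x0‖ ^ 2,
      (contDiff_sq_dist_aux y N).add (contDiff_sq_dist_aux x0 α),
      ((hasFDerivAt_sq_dist_aux y x N).add (hasFDerivAt_sq_dist_aux x0 x α)).fderiv, ?_⟩
    refine Filter.Eventually.of_forall fun z => ?_
    have := hmax (z, y)
    simp only [Φ] at this ⊢
    linarith
  have hq : (2 * N) • innerSL ℝ (x - y) ∈ subdiff v y := by
    refine ⟨fun z => (-N) * ‖z - x‖ ^ 2, contDiff_sq_dist_aux x (-N), ?_, ?_⟩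
    · rw [(hasFDerivAt_sq_dist_aux x y (-N)).fderiv, ← neg_sub x y, map_neg,
        mul_neg, neg_smul, smul_neg, neg_neg]
    · refine Filter.Eventually.of_forall fun z => ?_
      have := hmax (x, z)
      simp only [Φ] at this ⊢
      rw [norm_sub_rev z x, norm_sub_rev y x]
      linarith
  have e1 := husuper x hxK _ hp
  have e2 := hvsub y hyK _ hq
  have e3 := norm_sub_le ((2 * N) • innerSL ℝ (x - y) + (2 * α) • innerSL ℝ (x - x0))
    ((2 * α) • innerSL ℝ (x - x0))
  rw [add_sub_cancel_right] at e3
  have e4 : ‖(2 * α) • innerSL ℝ (x - x0)‖ = 2 * α * ‖x - x0‖ := by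
    rw [norm_smul, innerSL_apply_norm, Real.norm_of_nonneg (by positivity)]
  have e5 : 2 * α * ‖x - x0‖ < δ := by
    refine lt_of_pow_lt_pow_left₀ 2 hδ0.le ?_
    have h4 : α * ‖x - x0‖ ^ 2 ≤ B := by linarith [huv x y]
    have : (2 * α * ‖x - x0‖) ^ 2 ≤ 4 * α * B := by
      calc (2 * α * ‖x - x0‖) ^ 2 = 4 * α * (α * ‖x - x0‖ ^ 2) := by ring
        _ ≤ 4 * α * B := by gcongr
    nlinarith [mul_pos hα0 hB0]
  linarith


theorem kruzhkov_uniqueness {n : ℕ}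
    {K : Set (EuclideanSpace ℝ (Fin n))} (hK : K.Nonempty) (hKclosed : IsClosed K)
    {u v : EuclideanSpace ℝ (Fin n) → ℝ}
    (hu : Continuous u) (hv : Continuous v)
    (hubdd : ∃ C : ℝ, ∀ x, |u x| ≤ C) (hvbdd : ∃ C : ℝ, ∀ x, |v x| ≤ C)
    (huK : ∀ x ∈ K, u x = -1) (hvK : ∀ x ∈ K, v x = -1)
    (husuper : ∀ x ∉ K, ∀ p ∈ superdiff u x, ‖p‖ + u x ≤ 0)
    (husub : ∀ x ∉ K, ∀ p ∈ subdiff u x, 0 ≤ ‖p‖ + u x)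
    (hvsuper : ∀ x ∉ K, ∀ p ∈ superdiff v x, ‖p‖ + v x ≤ 0)
    (hvsub : ∀ x ∉ K, ∀ p ∈ subdiff v x, 0 ≤ ‖p‖ + v x) :
    u = v := by
  funext x
  exact le_antisymm
    (comparison_aux hu hv hubdd hvbdd huK hvK husuper hvsub x)
    (comparison_aux hv hu hvbdd hubdd hvK huK hvsuper husub x)
end

section
/- Let K be a nonempty closed subset of ℝⁿ. Then the distance function d_K is locally semiconcave on the open set ℝⁿ \ K: for every open convex set Ω′ with compact closure contained in ℝⁿ \ K there exists a constant C such that d_K(x+h) + d_K(x−h) − 2 d_K(x) ≤ 2C‖h‖² whenever x, x+h, x−h ∈ Ω′. -/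
theorem distance_locally_semiconcave {n : ℕ}
    {K : Set (EuclideanSpace ℝ (Fin n))} (hK : K.Nonempty) (hKclosed : IsClosed K) :
    ∀ Ω' : Set (EuclideanSpace ℝ (Fin n)), IsOpen Ω' → Convex ℝ Ω' →
      IsCompact (closure Ω') → closure Ω' ⊆ Kᶜ →
      ∃ C : ℝ, ∀ x h : EuclideanSpace ℝ (Fin n),
        x ∈ Ω' → x + h ∈ Ω' → x - h ∈ Ω' →
        Metric.infDist (x + h) K + Metric.infDist (x - h) K - 2 * Metric.infDist x K
          ≤ 2 * C * ‖h‖ ^ 2 := by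
  intro Ω' _ _ hc hsub
  rcases Ω'.eq_empty_or_nonempty with he | hne
  · exact ⟨0, fun x h hx => by simp [he] at hx⟩
  obtain ⟨z, hz, hmin⟩ := hc.exists_isMinOn hne.closure
    (Metric.continuous_infDist_pt K).continuousOn
  have hδ : 0 < Metric.infDist z K :=
    (hKclosed.notMem_iff_infDist_pos hK).1 (hsub hz)
  set δ := Metric.infDist z K with hδdef
  refine ⟨1 / (2 * δ), fun x h hx _ _ => ?_⟩
  have hδx : δ ≤ Metric.infDist x K := hmin (subset_closure hx)
  obtain ⟨y, hy, hxy⟩ := hKclosed.exists_infDist_eq_dist hK x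
  have h1 : Metric.infDist (x + h) K ≤ ‖(x - y) + h‖ := by
    have := Metric.infDist_le_dist_of_mem (x := x + h) hy
    rwa [dist_eq_norm, show x + h - y = (x - y) + h by abel] at this
  have h2 : Metric.infDist (x - h) K ≤ ‖(x - y) - h‖ := by
    have := Metric.infDist_le_dist_of_mem (x := x - h) hy
    rwa [dist_eq_norm, show x - h - y = (x - y) - h by abel] at this
  rw [dist_eq_norm] at hxy
  have hp := parallelogram_law_with_norm ℝ (x - y) h
  rw [← hxy] at hp
  set r := Metric.infDist x K with hr
  have hrpos : 0 < r := lt_of_lt_of_le hδ hδx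
  have key : ‖(x - y) + h‖ + ‖(x - y) - h‖ ≤ 2 * r + ‖h‖ ^ 2 / r := by
    refine le_trans (le_abs_self _) (abs_le_of_sq_le_sq ?_ (by positivity))
    have e : (2 * r + ‖h‖ ^ 2 / r) ^ 2 = 4 * r ^ 2 + 4 * ‖h‖ ^ 2 + (‖h‖ ^ 2 / r) ^ 2 := by
      field_simp
      ring
    rw [e]
    nlinarith [sq_nonneg (‖(x - y) + h‖ - ‖(x - y) - h‖), sq_nonneg (‖h‖ ^ 2 / r)]
  have hd : ‖h‖ ^ 2 / r ≤ ‖h‖ ^ 2 / δ := by gcongr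
  have e2 : 2 * (1 / (2 * δ)) * ‖h‖ ^ 2 = ‖h‖ ^ 2 / δ := by
    field_simp
  rw [e2]
  linarith
end

section
/- Let K be a nonempty closed subset of ℝⁿ and let Sing = {x ∈ ℝⁿ : d_K² is not Fréchet differentiable at x}. Then the function d_K² is continuously differentiable (of class C¹) on the open set ℝⁿ \ closure(Sing), and d_K is continuously differentiable on ℝⁿ \ (K ∪ closure(Sing)). -/
theorem nearest_fderiv {n : ℕ} {K : Set (EuclideanSpace ℝ (Fin n))}
    {x p : EuclideanSpace ℝ (Fin n)} (hp : p ∈ K) (hd : Metric.infDist x K = dist x p)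
    (hx : DifferentiableAt ℝ (fun y => Metric.infDist y K ^ 2) x) :
    fderiv ℝ (fun y => Metric.infDist y K ^ 2) x = 2 • innerSL ℝ (x - p) := by
  have h1 : HasFDerivAt (fun y => ‖y - p‖ ^ 2) (2 • innerSL ℝ (x - p)) x := by
    have := ((hasFDerivAt_id (𝕜 := ℝ) x).sub_const p).norm_sq
    simpa using this
  have h2 := h1.sub hx.hasFDerivAt
  have hmin : IsLocalMin ((fun y => ‖y - p‖ ^ 2) - (fun y => Metric.infDist y K ^ 2)) x := by
    refine Filter.Eventually.of_forall fun y => ?_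
    have : Metric.infDist y K ≤ ‖y - p‖ := by
      rw [← dist_eq_norm]; exact Metric.infDist_le_dist_of_mem hp
    have h0 : 0 ≤ Metric.infDist y K := Metric.infDist_nonneg
    have h3 := pow_le_pow_left₀ h0 this 2
    simp only [Pi.sub_apply, hd, ← dist_eq_norm] at h3 ⊢
    linarith
  have := hmin.hasFDerivAt_eq_zero h2
  exact (sub_eq_zero.mp this).symm

theorem sq_distance_C1_off_closure_singular_set {n : ℕ}
    {K : Set (EuclideanSpace ℝ (Fin n))} (hK : K.Nonempty) (hKclosed : IsClosed K) :
    ContDiffOn ℝ 1 (fun x => Metric.infDist x K ^ 2)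
      (closure {x | ¬ DifferentiableAt ℝ (fun y => Metric.infDist y K ^ 2) x})ᶜ ∧
    ContDiffOn ℝ 1 (fun x => Metric.infDist x K)
      (K ∪ closure {x | ¬ DifferentiableAt ℝ (fun y => Metric.infDist y K ^ 2) x})ᶜ := by
  have main : ContDiffOn ℝ 1 (fun x => Metric.infDist x K ^ 2)
      (closure {x | ¬ DifferentiableAt ℝ (fun y => Metric.infDist y K ^ 2) x})ᶜ := by
    set U := (closure {x | ¬ DifferentiableAt ℝ (fun y => Metric.infDist y K ^ 2) x})ᶜ with hU
    have hUo : IsOpen U := isClosed_closure.isOpen_compl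
    have hdiff : ∀ x ∈ U, DifferentiableAt ℝ (fun y => Metric.infDist y K ^ 2) x := by
      intro x hx
      by_contra h
      exact hx (subset_closure h)
    choose p hpK hpd using fun x => hKclosed.exists_infDist_eq_dist hK x
    have hcont : ∀ x ∈ U, ContinuousAt p x := by
      intro x hx
      have hdc : Continuous fun y => Metric.infDist y K := Metric.continuous_infDist_pt K
      refine (isCompact_closedBall x (Metric.infDist x K + 2)).tendsto_nhds_of_unique_mapClusterPt
        ?_ ?_
      · have e1 : ∀ᶠ y in nhds x, Metric.infDist y K < Metric.infDist x K + 1 :=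
          hdc.continuousAt.eventually_lt continuousAt_const (by linarith)
        filter_upwards [e1, Metric.ball_mem_nhds x one_pos] with y h1 h2
        rw [Metric.mem_ball] at h2
        rw [Metric.mem_closedBall]
        have := dist_triangle (p y) y x
        rw [dist_comm (p y) y, ← hpd] at this
        linarith
      · intro q _ hq
        have hqK : q ∈ K := by
          by_contra hn
          have := (mapClusterPt_iff_frequently.mp hq) _ (hKclosed.isOpen_compl.mem_nhds hn)
          obtain ⟨y, hy⟩ := this.exists
          exact hy (hpK y)
        have hqd : Metric.infDist x K = dist x q := by
          refine le_antisymm (Metric.infDist_le_dist_of_mem hqK) ?_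
          refine le_of_forall_pos_le_add fun ε hε => ?_
          have f1 := (mapClusterPt_iff_frequently.mp hq) _
            (Metric.ball_mem_nhds q (by positivity : 0 < ε / 3))
          have e1 : ∀ᶠ y in nhds x, Metric.infDist y K < Metric.infDist x K + ε / 3 :=
            hdc.continuousAt.eventually_lt continuousAt_const (by linarith)
          obtain ⟨y, hy1, hy2, hy3⟩ := (f1.and_eventually
            (e1.and (Metric.ball_mem_nhds x (by positivity : 0 < ε / 3)))).exists
          rw [Metric.mem_ball] at hy1
          have t1 := dist_triangle x y q
          have t2 := dist_triangle y (p y) q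
          rw [← hpd] at t2
          rw [dist_comm y x] at hy3
          linarith
        have a1 := nearest_fderiv hqK hqd (hdiff x hx)
        have a2 := nearest_fderiv (hpK x) (hpd x) (hdiff x hx)
        rw [a1] at a2
        have a3 := DFunLike.congr_fun a2 (p x - q)
        simp only [ContinuousLinearMap.smul_apply, innerSL_apply_apply, nsmul_eq_mul] at a3
        have a4 : inner ℝ (p x - q) (p x - q) = 0 := by
          have : p x - q = (x - q) - (x - p x) := by abel
          nth_rewrite 1 [this]
          rw [inner_sub_left]
          push_cast at a3
          linarith
        exact (sub_eq_zero.mp (inner_self_eq_zero.mp a4)).symm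
    rw [show (1 : WithTop ℕ∞) = 0 + 1 by simp, contDiffOn_succ_iff_fderiv_of_isOpen hUo]
    refine ⟨fun x hx => (hdiff x hx).differentiableWithinAt, by simp, ?_⟩
    rw [contDiffOn_zero]
    have : ContinuousOn (fun x => 2 • innerSL ℝ (x - p x)) U := by
      intro x hx
      have h := hcont x hx
      exact (((innerSL ℝ).continuous.continuousAt.comp
        (continuousAt_id.sub h)).const_smul 2).continuousWithinAt
    exact this.congr fun x hx => nearest_fderiv (hpK x) (hpd x) (hdiff x hx)
  refine ⟨main, ?_⟩
  have h2 := (main.mono (s := (closure {x | ¬ DifferentiableAt ℝ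
      (fun y => Metric.infDist y K ^ 2) x})ᶜ) (t := (K ∪ closure {x | ¬ DifferentiableAt ℝ
      (fun y => Metric.infDist y K ^ 2) x})ᶜ) (fun x hx h => hx (Or.inr h))).sqrt
    (fun x hx => by
      have : x ∉ K := fun h => hx (Or.inl h)
      have := (hKclosed.notMem_iff_infDist_pos hK).mp this
      positivity)
  exact h2.congr fun x _ => (Real.sqrt_sq Metric.infDist_nonneg).symm
end

section
/- Let K be a nonempty closed subset of ℝⁿ and x ∈ ℝⁿ. Then d_K² is Fréchet differentiable at x if and only if there is exactly one point y ∈ K with ‖x − y‖ = d_K(x); in that case the unique nearest point is y = x − ∇(d_K²)(x)/2, where ∇(d_K²)(x) denotes the gradient of d_K² at x. -/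
theorem aux_grad {n : ℕ} {K : Set (EuclideanSpace ℝ (Fin n))}
    (x y : EuclideanSpace ℝ (Fin n)) (hy : y ∈ K) (hxy : ‖x - y‖ = Metric.infDist x K)
    (hd : DifferentiableAt ℝ (fun y => Metric.infDist y K ^ 2) x) :
    x - (2:ℝ)⁻¹ • gradient (fun y => Metric.infDist y K ^ 2) x = y := by
  have h1 : HasFDerivAt (fun z : EuclideanSpace ℝ (Fin n) => ‖z - y‖ ^ 2)
      (2 • (innerSL ℝ (x - y))) x := by
    simpa using ((hasFDerivAt_id x).sub_const y).norm_sq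
  have h2 := hd.hasGradientAt.hasFDerivAt
  have hmin : IsLocalMin (fun z : EuclideanSpace ℝ (Fin n) =>
      ‖z - y‖ ^ 2 - Metric.infDist z K ^ 2) x := by
    refine Filter.Eventually.of_forall fun z => ?_
    have := Metric.infDist_le_dist_of_mem (x := z) hy
    rw [dist_eq_norm] at this
    have h0 : 0 ≤ Metric.infDist z K := Metric.infDist_nonneg
    simp only [hxy, sub_self]
    nlinarith
  have h3 := hmin.hasFDerivAt_eq_zero (h1.sub h2)
  have h4 : gradient (fun y => Metric.infDist y K ^ 2) x = (2:ℝ) • (x - y) := by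
    refine ext_inner_right ℝ fun v => ?_
    have := congrArg (fun L => L v) h3
    simp [sub_eq_zero] at this
    rw [inner_smul_left, inner_sub_left]
    simp [this]
  rw [h4, smul_smul]
  norm_num

theorem aux_diff {n : ℕ} {K : Set (EuclideanSpace ℝ (Fin n))} (hK : K.Nonempty)
    (hKclosed : IsClosed K)
    (x y : EuclideanSpace ℝ (Fin n)) (hy : y ∈ K) (hxy : ‖x - y‖ = Metric.infDist x K)
    (hu : ∀ z, z ∈ K ∧ ‖x - z‖ = Metric.infDist x K → z = y) :
    DifferentiableAt ℝ (fun y => Metric.infDist y K ^ 2) x := by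
  have hnear : ∀ ε > 0, ∃ δ > 0, ∀ p ∈ K, ‖x - p‖ < Metric.infDist x K + δ → ‖p - y‖ < ε := by
    intro ε hε
    set C := (K ∩ Metric.closedBall x (Metric.infDist x K + 1)) \ Metric.ball y ε with hC
    have hCc : IsCompact C :=
      ((isCompact_closedBall x _).inter_left hKclosed).diff Metric.isOpen_ball
    rcases C.eq_empty_or_nonempty with he | hne
    · refine ⟨1, one_pos, fun p hp hlt => ?_⟩
      by_contra hcon
      have : p ∈ C := by
        refine ⟨⟨hp, ?_⟩, ?_⟩
        · rw [Metric.mem_closedBall', dist_eq_norm]; exact hlt.le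
        · rw [Metric.mem_ball, dist_eq_norm]; exact hcon
      rw [he] at this
      exact this
    · obtain ⟨q, hq, hqm⟩ := hCc.exists_isMinOn hne
        (f := fun p => ‖x - p‖) (by fun_prop)
      have hle : Metric.infDist x K ≤ ‖x - q‖ := by
        rw [← dist_eq_norm]; exact Metric.infDist_le_dist_of_mem hq.1.1
      have hlt : Metric.infDist x K < ‖x - q‖ := by
        refine lt_of_le_of_ne hle fun h => ?_
        have := hu q ⟨hq.1.1, h.symm⟩
        apply hq.2
        rw [this]
        exact Metric.mem_ball_self hε
      refine ⟨min 1 (‖x - q‖ - Metric.infDist x K), lt_min one_pos (by linarith), ?_⟩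
      intro p hp hlt
      have ha := min_le_left 1 (‖x - q‖ - Metric.infDist x K)
      have hb := min_le_right 1 (‖x - q‖ - Metric.infDist x K)
      by_contra hcon
      have : p ∈ C := by
        refine ⟨⟨hp, ?_⟩, ?_⟩
        · rw [Metric.mem_closedBall', dist_eq_norm]; linarith
        · rw [Metric.mem_ball, dist_eq_norm]; exact hcon
      have h5 : ‖x - q‖ ≤ ‖x - p‖ := hqm this
      linarith
  have hex : ∀ z v : EuclideanSpace ℝ (Fin n),
      ‖z - v‖ ^ 2 = ‖x - v‖ ^ 2 + 2 * inner ℝ (x - v) (z - x) + ‖z - x‖ ^ 2 := by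
    intro z v
    rw [← norm_add_sq_real]
    congr 2
    abel
  have : HasFDerivAt (fun y => Metric.infDist y K ^ 2) ((2:ℝ) • (innerSL ℝ (x - y))) x := by
    rw [hasFDerivAt_iff_isLittleO, Asymptotics.isLittleO_iff]
    intro c hc
    obtain ⟨δ, hδ, hp⟩ := hnear (c / 4) (by positivity)
    have hpos : 0 < min (δ / 2) (c / 2) := by positivity
    filter_upwards [Metric.ball_mem_nhds x hpos] with z hz
    rw [Metric.mem_ball, dist_eq_norm] at hz
    have hz1 := hz.trans_le (min_le_left _ _)
    have hz2 := hz.trans_le (min_le_right _ _)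
    obtain ⟨p, hpK, hpd⟩ := hKclosed.exists_infDist_eq_dist hK z
    rw [dist_eq_norm] at hpd
    have hzx : Metric.infDist z K ≤ Metric.infDist x K + ‖z - x‖ := by
      rw [← dist_eq_norm]; exact Metric.infDist_le_infDist_add_dist
    have hxp : ‖x - p‖ ≤ ‖z - x‖ + ‖z - p‖ := by
      have := norm_sub_le_norm_sub_add_norm_sub x z p
      rwa [norm_sub_rev x z] at this
    have hpy := hp p hpK (by linarith)
    have hup : Metric.infDist z K ≤ ‖z - y‖ := by
      rw [← dist_eq_norm]; exact Metric.infDist_le_dist_of_mem hy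
    have hlow : Metric.infDist x K ≤ ‖x - p‖ := by
      rw [← dist_eq_norm]; exact Metric.infDist_le_dist_of_mem hpK
    have h0 : 0 ≤ Metric.infDist z K := Metric.infDist_nonneg
    have h0' : 0 ≤ Metric.infDist x K := Metric.infDist_nonneg
    have e1 := hex z y
    have e2 := hex z p
    have s1 : Metric.infDist z K ^ 2 ≤ ‖z - y‖ ^ 2 := by gcongr
    have s2 : Metric.infDist x K ^ 2 ≤ ‖x - p‖ ^ 2 := by gcongr
    rw [hxy] at e1
    rw [← hpd] at e2
    have hin : inner ℝ (x - p) (z - x) = inner ℝ (x - y) (z - x) - inner ℝ (p - y) (z - x) := by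
      rw [← inner_sub_left]; congr 1; abel
    have hcs : inner ℝ (p - y) (z - x) ≤ ‖p - y‖ * ‖z - x‖ := real_inner_le_norm _ _
    have hm : ‖p - y‖ * ‖z - x‖ ≤ c / 4 * ‖z - x‖ := by gcongr
    have hq : ‖z - x‖ ^ 2 ≤ c / 2 * ‖z - x‖ := by rw [sq]; gcongr
    have hn := sq_nonneg ‖z - x‖
    have hcn : 0 ≤ c * ‖z - x‖ := by positivity
    have hL : ((2:ℝ) • (innerSL ℝ (x - y))) (z - x) = 2 * inner ℝ (x - y) (z - x) := rfl
    rw [hL, Real.norm_eq_abs, abs_le]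
    constructor <;> linarith
  exact this.differentiableAt

theorem sq_distance_differentiable_iff_unique_nearest {n : ℕ}
    {K : Set (EuclideanSpace ℝ (Fin n))} (hK : K.Nonempty) (hKclosed : IsClosed K)
    (x : EuclideanSpace ℝ (Fin n)) :
    (DifferentiableAt ℝ (fun y => Metric.infDist y K ^ 2) x ↔
      ∃! y : EuclideanSpace ℝ (Fin n), y ∈ K ∧ ‖x - y‖ = Metric.infDist x K) ∧
    (DifferentiableAt ℝ (fun y => Metric.infDist y K ^ 2) x →
      (x - (2:ℝ)⁻¹ • gradient (fun y => Metric.infDist y K ^ 2) x) ∈ K ∧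
      ‖x - (x - (2:ℝ)⁻¹ • gradient (fun y => Metric.infDist y K ^ 2) x)‖
        = Metric.infDist x K) := by
  obtain ⟨p, hpK, hpd⟩ := hKclosed.exists_infDist_eq_dist hK x
  rw [dist_eq_norm] at hpd
  refine ⟨⟨fun hd => ⟨p, ⟨hpK, hpd.symm⟩, fun q hq => ?_⟩, ?_⟩, fun hd => ?_⟩
  · rw [← aux_grad x p hpK hpd.symm hd, ← aux_grad x q hq.1 hq.2 hd]
  · rintro ⟨y, hy, hu⟩
    exact aux_diff hK hKclosed x y hy.1 hy.2 hu
  · rw [aux_grad x p hpK hpd.symm hd]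
    exact ⟨hpK, hpd.symm⟩
end

section
/- Let K be a nonempty closed subset of ℝⁿ with n ≥ 1 and let Sing = {x ∈ ℝⁿ : d_K² is not Fréchet differentiable at x}. Then Sing is C²-rectifiable of dimension n−1: there exist countably many C² maps f_i : ℝ^{n−1} → ℝⁿ and a set N ⊆ ℝⁿ with ℋ^{n−1}(N) = 0 (ℋ^{n−1} the (n−1)-dimensional Hausdorff measure) such that Sing ⊆ N ∪ ⋃_i f_i(ℝ^{n−1}). -/
namespace SingC2

open MeasureTheory Set Filter Topology Metric
set_option linter.unusedSectionVars false
set_option linter.unusedVariables false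


section Smoothing

variable {E : Type} [NormedAddCommGroup E] [InnerProductSpace ℝ E] [FiniteDimensional ℝ E]
  [MeasurableSpace E] [BorelSpace E]

open scoped Convolution ContDiff

theorem conv_fderiv {F : Type} [NormedAddCommGroup F] [NormedSpace ℝ F]
    (f : E → ℝ) (g : E → F) (hf : LocallyIntegrable f) (hg : ContDiff ℝ ∞ g)
    (hc : HasCompactSupport g) :
    fderiv ℝ (f ⋆[ContinuousLinearMap.lsmul ℝ ℝ, volume] g) =
      f ⋆[ContinuousLinearMap.lsmul ℝ ℝ, volume] (fderiv ℝ g) := by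
  ext1 x
  rw [(hc.hasFDerivAt_convolution_right (ContinuousLinearMap.lsmul ℝ ℝ) hf
    (hg.of_le (by exact_mod_cast le_top)) x).fderiv]
  unfold convolution
  congr 1

theorem conv_bound (k : ℕ) : ∀ {F : Type} [NormedAddCommGroup F] [NormedSpace ℝ F]
    (f : E → ℝ) (g : E → F) (_ : LocallyIntegrable f) (_ : ContDiff ℝ ∞ g)
    (_ : HasCompactSupport g) (_ : tsupport g ⊆ closedBall 0 1) (x : E) (M : ℝ)
    (_ : ∀ y ∈ closedBall x 1, |f y| ≤ M),
    ‖iteratedFDeriv ℝ k (f ⋆[ContinuousLinearMap.lsmul ℝ ℝ, volume] g) x‖ ≤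
      M * ∫ z, ‖iteratedFDeriv ℝ k g z‖ := by
  induction k with
  | zero =>
    intro F _ _ f g hf hg hc hs x M hM
    simp only [norm_iteratedFDeriv_zero]
    rw [convolution_eq_swap, ← integral_const_mul]
    refine norm_integral_le_of_norm_le ?_ (ae_of_all _ ?_)
    · exact ((hg.continuous.integrable_of_hasCompactSupport hc).norm).const_mul M
    · intro z
      simp only [ContinuousLinearMap.lsmul_apply, norm_smul]
      by_cases hz : z ∈ closedBall (0:E) 1
      · gcongr
        apply hM
        simpa [mem_closedBall, dist_eq_norm] using hz
      · have : g z = 0 := image_eq_zero_of_notMem_tsupport (fun h => hz (hs h))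
        simp [this]
  | succ k ih =>
    intro F _ _ f g hf hg hc hs x M hM
    rw [← norm_iteratedFDeriv_fderiv, conv_fderiv f g hf hg hc]
    simp_rw [← norm_iteratedFDeriv_fderiv (𝕜 := ℝ) (f := g)]
    exact ih f (fderiv ℝ g) hf (hg.fderiv_right (by simp)) (hc.fderiv ℝ)
      ((tsupport_fderiv_subset ℝ).trans hs) x M hM

/-- smoothing at scale `r` with kernel `φ` -/
noncomputable def sm (φ : E → ℝ) (r : ℝ) (f : E → ℝ) (x : E) : ℝ := ∫ z, f (x - r • z) * φ z

structure Kern (φ : E → ℝ) : Prop where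
  smooth : ContDiff ℝ ∞ φ
  cpt : HasCompactSupport φ
  supp : tsupport φ ⊆ closedBall 0 1
  int_one : ∫ z, φ z = 1

theorem sm_eq (φ : E → ℝ) {r : ℝ} (hr : 0 < r) (f : E → ℝ) :
    sm φ r f = fun x => ((fun y => f (r • y)) ⋆[ContinuousLinearMap.lsmul ℝ ℝ, volume] φ)
      (r⁻¹ • x) := by
  ext x
  rw [convolution_eq_swap]
  simp only [sm, ContinuousLinearMap.lsmul_apply, smul_eq_mul, smul_sub, smul_smul,
    mul_inv_cancel₀ hr.ne', one_smul]

theorem locInt_smul {f : E → ℝ} (hf : Measurable f) {B : E → ℝ} (hB : Continuous B)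
    (hfB : ∀ x, |f x| ≤ B x) (r : ℝ) : LocallyIntegrable (fun y => f (r • y)) := by
  have h1 : Continuous (fun y => B (r • y)) := by fun_prop
  refine (h1.locallyIntegrable (μ := volume)).mono ?_ (ae_of_all _ fun x => ?_)
  · exact (hf.comp (measurable_const_smul r)).aestronglyMeasurable
  · simpa [Real.norm_eq_abs] using (hfB _).trans (le_abs_self _)

/-- functions that are measurable and dominated by a continuous function -/
def Good (f : E → ℝ) : Prop := Measurable f ∧ ∃ B : E → ℝ, Continuous B ∧ ∀ x, |f x| ≤ B x

theorem Good.of_cont {f : E → ℝ} (h : Continuous f) : Good f :=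
  ⟨h.measurable, fun x => |f x|, h.abs, fun _ => le_rfl⟩

theorem sm_contDiff {φ : E → ℝ} (hφ : Kern φ) {r : ℝ} (hr : 0 < r) {f : E → ℝ} (hf : Good f) :
    ContDiff ℝ 2 (sm φ r f) := by
  obtain ⟨h1, B, hB, hfB⟩ := hf
  rw [sm_eq φ hr f]
  have := hφ.cpt.contDiff_convolution_right (n := 2) (ContinuousLinearMap.lsmul ℝ ℝ)
    (locInt_smul h1 hB hfB r) (hφ.smooth.of_le (by exact_mod_cast le_top))
  have h2 : ContDiff ℝ 2 ((fun y => f (r • y)) ⋆[ContinuousLinearMap.lsmul ℝ ℝ, volume] φ) := by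
    exact_mod_cast this
  exact h2.comp (contDiff_const_smul _)

theorem sm_bound {φ : E → ℝ} (hφ : Kern φ) : ∃ C : ℝ, 0 ≤ C ∧ ∀ (r : ℝ) (_ : 0 < r) (f : E → ℝ)
    (_ : Good f) (x : E) (M : ℝ) (_ : ∀ y ∈ closedBall x r, |f y| ≤ M) (i : ℕ) (_ : i ≤ 2),
    ‖iteratedFDeriv ℝ i (sm φ r f) x‖ ≤ C * M * r⁻¹ ^ i := by
  have hnn : ∀ i : ℕ, 0 ≤ ∫ z, ‖iteratedFDeriv ℝ i φ z‖ :=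
    fun i => integral_nonneg fun z => norm_nonneg _
  refine ⟨∑ i ∈ Finset.range 3, ∫ z, ‖iteratedFDeriv ℝ i φ z‖,
    Finset.sum_nonneg fun i _ => hnn i, ?_⟩
  intro r hr f hf x M hM i hi
  have hM0 : 0 ≤ M := (abs_nonneg _).trans (hM x (mem_closedBall_self hr.le))
  obtain ⟨h1, B, hB, hfB⟩ := hf
  have hl := locInt_smul h1 hB hfB r
  have hc := hφ.cpt.contDiff_convolution_right (n := i) (ContinuousLinearMap.lsmul ℝ ℝ)
    hl (hφ.smooth.of_le (by exact_mod_cast le_top))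
  rw [sm_eq φ hr f, iteratedFDeriv_comp_const_smul (i := i) r⁻¹ (by exact_mod_cast hc)]
  rw [norm_smul, norm_pow, Real.norm_of_nonneg (inv_nonneg.2 hr.le), mul_comm]
  gcongr
  refine (conv_bound i _ φ hl hφ.smooth hφ.cpt hφ.supp (r⁻¹ • x) M ?_).trans ?_
  · intro y hy
    apply hM
    rw [mem_closedBall, dist_eq_norm] at hy ⊢
    have : r • y - x = r • (y - r⁻¹ • x) := by
      rw [smul_sub, smul_smul, mul_inv_cancel₀ hr.ne', one_smul]
    rw [this, norm_smul, Real.norm_of_nonneg hr.le]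
    nlinarith
  · rw [mul_comm]
    gcongr
    exact Finset.single_le_sum (f := fun i => ∫ z, ‖iteratedFDeriv ℝ i φ z‖)
      (fun i _ => hnn i) (by simp; omega)

theorem sm_integrable {φ : E → ℝ} (hφ : Kern φ) {f : E → ℝ} (hf : Good f) (r : ℝ) (x : E) :
    Integrable (fun z => f (x - r • z) * φ z) := by
  obtain ⟨h1, B, hB, hfB⟩ := hf
  have h2 : Integrable (fun z => B (x - r • z) * φ z) := by
    apply Continuous.integrable_of_hasCompactSupport
    · have := hφ.smooth.continuous
      fun_prop
    · exact hφ.cpt.mul_left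
  refine h2.mono ?_ (ae_of_all _ fun z => ?_)
  · have h3 := hφ.smooth.continuous.measurable
    have h4 : Measurable (fun z : E => f (x - r • z)) := h1.comp (by fun_prop)
    exact (h4.mul h3).aestronglyMeasurable
  · rw [norm_mul, norm_mul]
    gcongr
    simpa [Real.norm_eq_abs] using (hfB _).trans (le_abs_self _)

theorem sm_sub {φ : E → ℝ} (hφ : Kern φ) {f g : E → ℝ} (hf : Good f) (hg : Good g) (r : ℝ) :
    sm φ r (f - g) = sm φ r f - sm φ r g := by
  ext x
  simp only [sm, Pi.sub_apply, sub_mul]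
  exact integral_sub (sm_integrable hφ hf r x) (sm_integrable hφ hg r x)

/-- local constancy -/
theorem sm_const_on {φ : E → ℝ} (hφ : Kern φ) {f : E → ℝ} {r c : ℝ} (hr : 0 < r) {x : E}
    (h : ∀ y ∈ closedBall x r, f y = c) : sm φ r f x = c := by
  have : ∀ z, f (x - r • z) * φ z = c * φ z := by
    intro z
    by_cases hz : z ∈ closedBall (0:E) 1
    · rw [h]
      rw [mem_closedBall, dist_eq_norm] at hz ⊢
      simp only [sub_zero, sub_sub_cancel_left, norm_neg, norm_smul,
        Real.norm_of_nonneg hr.le] at hz ⊢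
      nlinarith
    · have : φ z = 0 := image_eq_zero_of_notMem_tsupport (fun h => hz (hφ.supp h))
      simp [this]
  simp only [sm, this, integral_const_mul, hφ.int_one, mul_one]

def IsQuad (P : E → ℝ) : Prop :=
  ∃ (c : ℝ) (L : E →L[ℝ] ℝ) (B : E →L[ℝ] E →L[ℝ] ℝ), ∀ y, P y = c + L y + B y y

theorem IsQuad.continuous {P : E → ℝ} (h : IsQuad P) : Continuous P := by
  obtain ⟨c, L, B, h⟩ := h
  have : P = fun y => c + L y + B y y := funext h
  rw [this]
  fun_prop

theorem IsQuad.lin {P Q : E → ℝ} (h : IsQuad P) (h' : IsQuad Q) (a b : ℝ) :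
    IsQuad (fun y => a * P y + b * Q y) := by
  obtain ⟨c, L, B, h⟩ := h
  obtain ⟨c', L', B', h'⟩ := h'
  refine ⟨a * c + b * c', a • L + b • L', a • B + b • B', fun y => ?_⟩
  simp [h, h']
  ring

theorem IsQuad.of_center (x : E) (c : ℝ) (L : E →L[ℝ] ℝ) (B : E →L[ℝ] E →L[ℝ] ℝ) :
    IsQuad (fun y => c + L (y - x) + B (y - x) (y - x)) := by
  refine ⟨c - L x + B x x, L - B x - B.flip x, B, fun y => ?_⟩
  simp
  ring

/-- kernel with vanishing first and second moments -/
theorem exists_kern : ∃ φ : E → ℝ, Kern φ ∧ ∀ (r : ℝ) (P : E → ℝ), IsQuad P → sm φ r P = P := by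
  let b : ContDiffBump (0 : E) := ⟨1/2, 1, by norm_num, by norm_num⟩
  let η : E → ℝ := b.normed volume
  have hηs : ContDiff ℝ ∞ η := b.contDiff_normed
  have hηc : HasCompactSupport η := b.hasCompactSupport_normed
  have hη0 : ∀ z, z ∉ closedBall (0:E) 1 → η z = 0 := by
    intro z hz
    apply image_eq_zero_of_notMem_tsupport
    rw [b.tsupport_normed_eq]
    exact hz
  have hηe : ∀ z, η (-z) = η z := b.normed_neg
  have hη1 : ∫ z, η z = 1 := b.integral_normed
  let d := Module.finrank ℝ E
  let φ : E → ℝ := fun z => (4/3) * 2^d * η ((2:ℝ) • z) - (1/3) * η z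
  have hφs : ContDiff ℝ ∞ φ := by
    have : ContDiff ℝ ∞ (fun z : E => η ((2:ℝ) • z)) := hηs.comp (contDiff_const_smul _)
    exact (contDiff_const.mul this).sub (contDiff_const.mul hηs)
  have hφ0 : ∀ z, z ∉ closedBall (0:E) 1 → φ z = 0 := by
    intro z hz
    have : (2:ℝ) • z ∉ closedBall (0:E) 1 := by
      simp only [mem_closedBall, dist_zero_right, norm_smul, not_le, Real.norm_ofNat] at hz ⊢
      linarith
    simp [φ, hη0 z hz, hη0 _ this]
  have hφsupp : tsupport φ ⊆ closedBall 0 1 := by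
    apply closure_minimal _ isClosed_closedBall
    intro z hz
    by_contra h
    exact hz (hφ0 z h)
  have hφc : HasCompactSupport φ :=
    (isCompact_closedBall (0:E) 1).of_isClosed_subset (isClosed_tsupport _) hφsupp
  have key : ∀ g : E → ℝ, Continuous g →
      ∫ z, g z * φ z = (4/3) * (∫ z, g ((1/2:ℝ) • z) * η z) - (1/3) * ∫ z, g z * η z := by
    intro g hg
    have e1 : ∫ z, g z * η ((2:ℝ) • z) = (2^d)⁻¹ * ∫ z, g ((1/2:ℝ) • z) * η z := by
      have := Measure.integral_comp_smul (μ := (volume : Measure E))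
        (fun z => g ((1/2:ℝ) • z) * η z) 2
      simp only [smul_smul] at this
      norm_num at this
      simpa [d] using this
    have i1 : Integrable (fun z => g z * η ((2:ℝ) • z)) := by
      have hc := hηs.continuous
      apply Continuous.integrable_of_hasCompactSupport (by fun_prop)
      apply HasCompactSupport.mul_left
      exact hηc.comp_smul (by norm_num)
    have i2 : Integrable (fun z => g z * η z) := by
      have hc := hηs.continuous
      exact Continuous.integrable_of_hasCompactSupport (by fun_prop) hηc.mul_left
    have : ∀ z, g z * φ z = (4/3) * 2^d * (g z * η ((2:ℝ) • z)) - (1/3) * (g z * η z) := by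
      intro z; simp only [φ]; ring
    simp only [this]
    rw [integral_sub (i1.const_mul _) (i2.const_mul _), integral_const_mul, integral_const_mul, e1]
    have : (2:ℝ)^d ≠ 0 := by positivity
    field_simp
  have h1 : ∫ z, φ z = 1 := by
    have := key (fun _ => 1) continuous_const
    simp only [one_mul, hη1] at this
    rw [this]; norm_num
  have hlin : ∀ L : E →L[ℝ] ℝ, ∫ z, L z * φ z = 0 := by
    intro L
    have h2 : ∫ z, L z * φ z = - ∫ z, L z * φ z := by
      conv_lhs => rw [← integral_neg_eq_self]
      rw [← integral_neg]
      congr 1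
      ext z
      simp [φ, hηe]
    linarith
  have hquad : ∀ B : E →L[ℝ] E →L[ℝ] ℝ, ∫ z, B z z * φ z = 0 := by
    intro B
    rw [key _ (by fun_prop)]
    have : ∀ z, B ((1/2:ℝ) • z) ((1/2:ℝ) • z) * η z = (1/4) * (B z z * η z) := by
      intro z; simp; ring
    simp only [this, integral_const_mul]
    ring
  refine ⟨φ, ⟨hφs, hφc, hφsupp, h1⟩, ?_⟩
  intro r P ⟨c, L, B, hP⟩
  ext x
  have ic : ∀ g : E → ℝ, Continuous g → Integrable (fun z => g z * φ z) := by
    intro g hg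
    have hc := hφs.continuous
    exact Continuous.integrable_of_hasCompactSupport (by fun_prop) hφc.mul_left
  have : ∀ z, P (x - r • z) * φ z = P x * φ z - ((r • (L + B x + B.flip x)) z * φ z
      - (r^2 • B) z z * φ z) := by
    intro z
    simp only [hP]
    simp
    ring
  simp only [sm, this]
  rw [integral_sub, integral_sub, integral_const_mul, h1, hlin, hquad]
  · simp
  · exact ic _ (by fun_prop)
  · exact ic _ (by fun_prop)
  · exact (hφs.continuous.integrable_of_hasCompactSupport hφc).const_mul _
  · exact (ic _ (by fun_prop)).sub (ic _ (by fun_prop))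

end Smoothing

section Lusin

variable {E : Type} [NormedAddCommGroup E] [InnerProductSpace ℝ E] [FiniteDimensional ℝ E]
  [MeasurableSpace E] [BorelSpace E]

/-- the scales -/
noncomputable def rr (k : ℕ) : ℝ := (1/4:ℝ)^k

theorem rr_pos (k : ℕ) : 0 < rr k := by unfold rr; positivity
theorem rr_succ (k : ℕ) : rr k = 4 * rr (k+1) := by unfold rr; rw [pow_succ]; ring
theorem rr_anti {j k : ℕ} (h : j ≤ k) : rr k ≤ rr j :=
  pow_le_pow_of_le_one (by norm_num) (by norm_num) h
theorem rr_le_one (k : ℕ) : rr k ≤ 1 := pow_le_one₀ (by norm_num) (by norm_num)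

theorem rr_pow_le (k i : ℕ) (hi : i ≤ 2) : rr k ^ 2 * (rr k)⁻¹ ^ i ≤ 1 := by
  have h := rr_pos k
  have : rr k ^ 2 * (rr k)⁻¹ ^ i = rr k ^ (2 - i) := by
    rw [inv_pow, ← pow_sub₀ _ h.ne' hi]
  rw [this]
  exact pow_le_one₀ h.le (rr_le_one k)

noncomputable def cut (φ : E → ℝ) (S : Set E) (k : ℕ) : E → ℝ :=
  sm φ (rr k) ({x | infDist x S < 2 * rr k}.indicator (fun _ => (1:ℝ)))

theorem good_ind (S : Set E) (a : ℝ) : Good ({x | infDist x S < a}.indicator (fun _ => (1:ℝ))) := by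
  refine ⟨measurable_const.indicator ?_, fun _ => 1, continuous_const, fun x => ?_⟩
  · exact (isOpen_lt (continuous_infDist_pt S) continuous_const).measurableSet
  · by_cases hx : x ∈ {x | infDist x S < a} <;> simp [hx]

theorem cut_one {φ : E → ℝ} (hφ : Kern φ) {S : Set E} {k : ℕ} {x : E} (h : infDist x S < rr k) :
    cut φ S k x = 1 := by
  apply sm_const_on hφ (rr_pos k)
  intro y hy
  rw [indicator_of_mem]
  have := infDist_le_infDist_add_dist (s := S) (x := y) (y := x)
  rw [mem_closedBall] at hy
  simp only [mem_ofPred_eq]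
  linarith

theorem cut_zero {φ : E → ℝ} (hφ : Kern φ) {S : Set E} {k : ℕ} {x : E}
    (h : 3 * rr k < infDist x S) : cut φ S k x = 0 := by
  apply sm_const_on hφ (rr_pos k)
  intro y hy
  rw [indicator_of_notMem]
  have := infDist_le_infDist_add_dist (s := S) (x := x) (y := y)
  rw [mem_closedBall, dist_comm] at hy
  simp only [mem_ofPred_eq, not_lt]
  linarith

theorem split_index (S : Set E) (x : E) (J J' : ℕ) (h : J ≤ J') : ∃ j, J ≤ j ∧ j ≤ J' ∧
    (∀ k ∈ Finset.Ico J j, infDist x S < rr k) ∧ (∀ k ∈ Finset.Ico j J', rr k ≤ infDist x S) := by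
  induction J', h using Nat.le_induction with
  | base => exact ⟨J, le_rfl, le_rfl, by simp, by simp⟩
  | succ n hn ih =>
    obtain ⟨j, h1, h2, h3, h4⟩ := ih
    by_cases hx : rr n ≤ infDist x S
    · refine ⟨j, h1, by omega, h3, ?_⟩
      intro k hk
      rw [Finset.mem_Ico] at hk
      by_cases hkn : k = n
      · exact hkn ▸ hx
      · exact h4 k (by rw [Finset.mem_Ico]; omega)
    · push Not at hx
      refine ⟨n+1, by omega, le_rfl, ?_, by simp⟩
      intro k hk
      rw [Finset.mem_Ico] at hk
      exact hx.trans_le (rr_anti (by omega))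

/-- approximation by quadratics on `S` at level `ε`, radius `δ` -/
def Approx (u : E → ℝ) (S : Set E) (ε δ : ℝ) : Prop :=
  ∀ x ∈ S, ∀ r0 : ℝ, 0 < r0 → ∃ P : E → ℝ, IsQuad P ∧
    ∀ y, ‖y - x‖ ≤ δ → |u y - P y| ≤ ε * (max r0 ‖y - x‖)^2

noncomputable def blk (φ : E → ℝ) (S : Set E) (u : E → ℝ) (J J' : ℕ) : E → ℝ :=
  fun x => ∑ k ∈ Finset.Ico J J', cut φ S k x * (sm φ (rr (k+1)) u x - sm φ (rr k) u x)

theorem cut_contDiff {φ : E → ℝ} (hφ : Kern φ) (S : Set E) (k : ℕ) : ContDiff ℝ 2 (cut φ S k) :=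
  sm_contDiff hφ (rr_pos k) (good_ind S _)

theorem smk_contDiff {φ : E → ℝ} (hφ : Kern φ) {u : E → ℝ} (hu : Continuous u) (k : ℕ) :
    ContDiff ℝ 2 (sm φ (rr k) u) :=
  sm_contDiff hφ (rr_pos k) (Good.of_cont hu)

theorem blk_contDiff {φ : E → ℝ} (hφ : Kern φ) (S : Set E) {u : E → ℝ} (hu : Continuous u)
    (J J' : ℕ) : ContDiff ℝ 2 (blk φ S u J J') := by
  unfold blk
  apply ContDiff.sum
  intro k _
  exact (cut_contDiff hφ S k).mul ((smk_contDiff hφ hu _).sub (smk_contDiff hφ hu _))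

theorem iter_sub_le {f g : E → ℝ} (hf : ContDiff ℝ 2 f) (hg : ContDiff ℝ 2 g) (x : E) (i : ℕ)
    (hi : i ≤ 2) :
    ‖iteratedFDeriv ℝ i (f - g) x‖ ≤ ‖iteratedFDeriv ℝ i f x‖ + ‖iteratedFDeriv ℝ i g x‖ := by
  have h : ((i:ℕ) : WithTop ℕ∞) ≤ ((2:ℕ) : WithTop ℕ∞) := Nat.mono_cast hi
  have hg' : ContDiff ℝ 2 (-g) := hg.neg
  rw [sub_eq_add_neg f g, iteratedFDeriv_add_apply (hf.of_le h).contDiffAt (hg'.of_le h).contDiffAt]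
  refine (norm_add_le _ _).trans ?_
  rw [iteratedFDeriv_neg_apply, norm_neg]

theorem iter_add_le {f g : E → ℝ} (hf : ContDiff ℝ 2 f) (hg : ContDiff ℝ 2 g) (x : E) (i : ℕ)
    (hi : i ≤ 2) :
    ‖iteratedFDeriv ℝ i (f + g) x‖ ≤ ‖iteratedFDeriv ℝ i f x‖ + ‖iteratedFDeriv ℝ i g x‖ := by
  have h : ((i:ℕ) : WithTop ℕ∞) ≤ ((2:ℕ) : WithTop ℕ∞) := Nat.mono_cast hi
  rw [iteratedFDeriv_add_apply (hf.of_le h).contDiffAt (hg.of_le h).contDiffAt]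
  exact norm_add_le _ _

theorem diff_bound {φ : E → ℝ} (hφ : Kern φ)
    (hq : ∀ (r : ℝ) (P : E → ℝ), IsQuad P → sm φ r P = P) :
    ∃ C : ℝ, 0 ≤ C ∧ ∀ (u : E → ℝ) (_ : Continuous u) (S : Set E) (_ : S.Nonempty) (ε δ : ℝ)
      (_ : 0 ≤ ε) (_ : Approx u S ε δ) (J j : ℕ) (_ : J ≤ j) (_ : 17 * rr J ≤ δ) (x : E)
      (_ : infDist x S < 16 * rr j) (i : ℕ) (_ : i ≤ 2),
      ‖iteratedFDeriv ℝ i (sm φ (rr j) u - sm φ (rr J) u) x‖ ≤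
        C * ε * (rr j ^ 2 * (rr j)⁻¹ ^ i + rr J ^ 2 * (rr J)⁻¹ ^ i) := by
  obtain ⟨C, hC, hb⟩ := sm_bound hφ
  refine ⟨289 * C, by positivity, ?_⟩
  intro u hu S hS ε δ hε hA J j hJj hδ x hx i hi
  obtain ⟨x0, hx0, hd⟩ := (infDist_lt_iff hS).1 hx
  obtain ⟨P, hP, hPu⟩ := hA x0 hx0 (rr j) (rr_pos j)
  have main : ∀ k, J ≤ k → k ≤ j → ‖iteratedFDeriv ℝ i (sm φ (rr k) (u - P)) x‖ ≤
      C * (ε * (17 * rr k)^2) * (rr k)⁻¹ ^ i := by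
    intro k h1 h2
    refine hb (rr k) (rr_pos k) (u - P) (Good.of_cont (hu.sub hP.continuous)) x _ ?_ i hi
    intro y hy
    rw [mem_closedBall] at hy
    have hk := rr_anti h2
    have hkJ := rr_anti h1
    have hy0 : ‖y - x0‖ ≤ 17 * rr k := by
      rw [← dist_eq_norm]
      have := dist_triangle y x x0
      linarith
    have := hPu y (by linarith)
    refine this.trans ?_
    gcongr
    · apply max_le _ hy0
      have := rr_pos k
      linarith
  have e : sm φ (rr j) u - sm φ (rr J) u = sm φ (rr j) (u - P) - sm φ (rr J) (u - P) := by
    have hu' := Good.of_cont hu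
    have hP' := Good.of_cont hP.continuous
    rw [sm_sub hφ hu' hP', sm_sub hφ hu' hP', hq _ P hP, hq _ P hP]
    abel
  rw [e]
  have hc : Good (u - P) := Good.of_cont (hu.sub hP.continuous)
  refine (iter_sub_le (sm_contDiff hφ (rr_pos _) hc) (sm_contDiff hφ (rr_pos _) hc) x i hi).trans ?_
  have h1 := main j hJj le_rfl
  have h2 := main J le_rfl hJj
  nlinarith

theorem blk_bound {φ : E → ℝ} (hφ : Kern φ)
    (hq : ∀ (r : ℝ) (P : E → ℝ), IsQuad P → sm φ r P = P) :
    ∃ C : ℝ, 0 ≤ C ∧ ∀ (u : E → ℝ) (_ : Continuous u) (S : Set E) (_ : S.Nonempty) (ε δ : ℝ)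
      (_ : 0 ≤ ε) (_ : Approx u S ε δ) (J J' : ℕ) (_ : J ≤ J') (_ : 17 * rr J ≤ δ) (x : E)
      (i : ℕ) (_ : i ≤ 2), ‖iteratedFDeriv ℝ i (blk φ S u J J') x‖ ≤ C * ε := by
  obtain ⟨C, hC, hb⟩ := diff_bound hφ hq
  obtain ⟨C1, hC1, hb1⟩ := sm_bound hφ
  refine ⟨2 * C + 8 * C1 * C, by positivity, ?_⟩
  intro u hu S hS ε δ hε hA J J' hJ hδ x i hi
  obtain ⟨j, h1, h2, h3, h4⟩ := split_index S x J J' hJ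
  have hcont := continuous_infDist_pt S
  let A : E → ℝ := sm φ (rr j) u - sm φ (rr J) u
  let D : E → ℝ := fun y => sm φ (rr (j+1)) u y - sm φ (rr j) u y
  have hD : ContDiff ℝ 2 D := (smk_contDiff hφ hu _).sub (smk_contDiff hφ hu _)
  let Q : E → ℝ := fun y => cut φ S j y * D y
  have hQ : ContDiff ℝ 2 Q := (cut_contDiff hφ S j).mul hD
  have hAc : ContDiff ℝ 2 A := (smk_contDiff hφ hu _).sub (smk_contDiff hφ hu _)
  have hAb : ‖iteratedFDeriv ℝ i A x‖ ≤ 2 * C * ε := by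
    rcases h1.eq_or_lt with rfl | hlt
    · have : A = 0 := sub_self _
      rw [this]
      have h0 : iteratedFDeriv ℝ i (0 : E → ℝ) x = 0 := by
        simp
      rw [h0, norm_zero]
      positivity
    · have hd : infDist x S < 16 * rr j := by
        have := h3 (j-1) (by rw [Finset.mem_Ico]; omega)
        have e := rr_succ (j-1)
        rw [Nat.sub_add_cancel (by omega)] at e
        have := rr_pos j
        linarith
      refine (hb u hu S hS ε δ hε hA J j h1 hδ x hd i hi).trans ?_
      have a1 := rr_pow_le j i hi
      have a2 := rr_pow_le J i hi
      have : 0 ≤ C * ε := by positivity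
      nlinarith
  have hev1 : ∀ᶠ y in 𝓝 x, ∑ k ∈ Finset.Ico J j,
      cut φ S k y * (sm φ (rr (k+1)) u y - sm φ (rr k) u y) = A y := by
    have : ∀ᶠ y in 𝓝 x, ∀ k ∈ Finset.Ico J j, infDist y S < rr k := by
      rw [Filter.eventually_all_finset]
      intro k hk
      exact hcont.continuousAt.eventually_lt continuousAt_const (h3 k hk)
    filter_upwards [this] with y hy
    rw [Finset.sum_congr rfl (g := fun k => sm φ (rr (k+1)) u y - sm φ (rr k) u y)]
    · exact Finset.sum_Ico_sub (fun k => sm φ (rr k) u y) h1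
    · intro k hk
      rw [cut_one hφ (hy k hk), one_mul]
  have hfar : ∀ k ∈ Finset.Ico (j+1) J', 3 * rr k < infDist x S := by
    intro k hk
    rw [Finset.mem_Ico] at hk
    have a := h4 j (by rw [Finset.mem_Ico]; omega)
    have b := rr_succ j
    have c := rr_anti hk.1
    have := rr_pos k
    linarith
  have hev2 : ∀ᶠ y in 𝓝 x, ∑ k ∈ Finset.Ico (j+1) J',
      cut φ S k y * (sm φ (rr (k+1)) u y - sm φ (rr k) u y) = 0 := by
    have : ∀ᶠ y in 𝓝 x, ∀ k ∈ Finset.Ico (j+1) J', 3 * rr k < infDist y S := by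
      rw [Filter.eventually_all_finset]
      intro k hk
      exact continuousAt_const.eventually_lt hcont.continuousAt (hfar k hk)
    filter_upwards [this] with y hy
    apply Finset.sum_eq_zero
    intro k hk
    rw [cut_zero hφ (hy k hk), zero_mul]
  have hQb : infDist x S ≤ 3 * rr j → 17 * rr j ≤ δ →
      ‖iteratedFDeriv ℝ i Q x‖ ≤ 8 * C1 * C * ε := by
    intro hd hδ'
    have hN : ((i:ℕ) : WithTop ℕ∞) ≤ ((2:ℕ) : WithTop ℕ∞) := Nat.mono_cast hi
    refine (norm_iteratedFDeriv_mul_le (𝕜 := ℝ) (cut_contDiff hφ S j) hD x hN).trans ?_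
    have hr := rr_pos j
    have hterm : ∀ a ∈ Finset.range (i+1), (i.choose a : ℝ) * ‖iteratedFDeriv ℝ a (cut φ S j) x‖ *
        ‖iteratedFDeriv ℝ (i - a) D x‖ ≤ (i.choose a : ℝ) * (2 * C1 * C * ε) := by
      intro a ha
      rw [Finset.mem_range] at ha
      have t1 : ‖iteratedFDeriv ℝ a (cut φ S j) x‖ ≤ C1 * 1 * (rr j)⁻¹ ^ a := by
        refine hb1 (rr j) hr _ (good_ind S _) x 1 (fun y _ => ?_) a (by omega)
        by_cases hx : y ∈ {x | infDist x S < 2 * rr j} <;> simp [hx]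
      have t2 : ‖iteratedFDeriv ℝ (i-a) D x‖ ≤ 2 * C * ε * (rr j ^ 2 * (rr j)⁻¹ ^ (i-a)) := by
        have e := rr_succ j
        refine (hb u hu S hS ε δ hε hA j (j+1) (Nat.le_succ j) hδ' x (by linarith) (i-a)
          (by omega)).trans ?_
        have e' : rr (j+1) = rr j / 4 := by linarith
        have : rr (j+1) ^ 2 * (rr (j+1))⁻¹ ^ (i-a) ≤ rr j ^ 2 * (rr j)⁻¹ ^ (i-a) := by
          rw [e', div_pow, inv_div, div_eq_mul_inv (4:ℝ), mul_pow (4:ℝ)]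
          have h4 : (4:ℝ)^(i-a) ≤ 4^2 := pow_le_pow_right₀ (by norm_num) (by omega)
          have hp : 0 ≤ rr j ^ 2 * (rr j)⁻¹ ^ (i-a) := by positivity
          nlinarith
        have : 0 ≤ C * ε := by positivity
        nlinarith
      rw [mul_assoc]
      refine mul_le_mul_of_nonneg_left ?_ (Nat.cast_nonneg _)
      calc _ ≤ (C1 * 1 * (rr j)⁻¹ ^ a) * (2 * C * ε * (rr j ^ 2 * (rr j)⁻¹ ^ (i-a))) := by
            gcongr
        _ = (2 * C1 * C * ε) * (rr j ^ 2 * (rr j)⁻¹ ^ i) := by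
            have : (rr j)⁻¹ ^ i = (rr j)⁻¹ ^ a * (rr j)⁻¹ ^ (i-a) := by
              rw [← pow_add]; congr 1; omega
            rw [this]; ring
        _ ≤ (2 * C1 * C * ε) * 1 := by
            gcongr
            exact rr_pow_le j i hi
        _ = _ := mul_one _
    refine (Finset.sum_le_sum hterm).trans ?_
    rw [← Finset.sum_mul]
    have : ∑ a ∈ Finset.range (i+1), (i.choose a : ℝ) = 2 ^ i := by
      exact_mod_cast Nat.sum_range_choose i
    rw [this]
    have h4 : (2:ℝ)^i ≤ 2^2 := pow_le_pow_right₀ (by norm_num) hi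
    have : 0 ≤ 2 * C1 * C * ε := by positivity
    nlinarith
  have hsmall : ∀ G : E → ℝ, blk φ S u J J' =ᶠ[𝓝 x] G →
      ‖iteratedFDeriv ℝ i G x‖ ≤ (2 * C + 8 * C1 * C) * ε →
      ‖iteratedFDeriv ℝ i (blk φ S u J J') x‖ ≤ (2 * C + 8 * C1 * C) * ε := by
    intro G hG h
    rwa [(hG.iteratedFDeriv ℝ i).eq_of_nhds]
  have hpos : 0 ≤ 8 * C1 * C * ε := by positivity
  rcases h2.eq_or_lt with rfl | hlt
  · refine hsmall A ?_ (by linarith)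
    filter_upwards [hev1] with y hy
    exact hy
  · by_cases hd : infDist x S ≤ 3 * rr j
    · refine hsmall (A + Q) ?_ ?_
      · filter_upwards [hev1, hev2] with y hy1 hy2
        simp only [blk, Pi.add_apply]
        rw [← Finset.sum_Ico_consecutive _ h1 h2, hy1, Finset.sum_eq_sum_Ico_succ_bot hlt, hy2,
          add_zero]
      · have a := rr_anti h1
        have := hQb hd (by linarith)
        have := iter_add_le hAc hQ x i hi
        linarith
    · push Not at hd
      refine hsmall A ?_ (by linarith)
      have : ∀ᶠ y in 𝓝 x, 3 * rr j < infDist y S :=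
        continuousAt_const.eventually_lt hcont.continuousAt hd
      filter_upwards [hev1, hev2, this] with y hy1 hy2 hy3
      simp only [blk]
      rw [← Finset.sum_Ico_consecutive _ h1 h2, hy1, Finset.sum_eq_sum_Ico_succ_bot hlt, hy2,
          add_zero, cut_zero hφ hy3, zero_mul, add_zero]

theorem lusin_ext (u : E → ℝ) (hu : Continuous u) (S : Set E) (ε δ : ℕ → ℝ)
    (hε0 : ∀ l, 0 ≤ ε l) (hε : Summable ε) (hδ : ∀ l, 0 < δ l) (hA : ∀ l, Approx u S (ε l) (δ l)) :
    ∃ v : E → ℝ, ContDiff ℝ 2 v ∧ ∀ x ∈ S, v x = u x := by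
  rcases S.eq_empty_or_nonempty with rfl | hS
  · exact ⟨0, contDiff_const, by simp⟩
  obtain ⟨φ, hφ, hq⟩ := exists_kern (E := E)
  obtain ⟨C, hC, hb⟩ := blk_bound hφ hq
  have hr : Tendsto rr atTop (𝓝 0) := tendsto_pow_atTop_nhds_zero_of_lt_one (by norm_num) (by norm_num)
  obtain ⟨J, hJ, hJδ⟩ := extraction_forall_of_eventually (P := fun l k => 17 * rr k ≤ δ l) (by
    intro l
    have : Tendsto (fun k => 17 * rr k) atTop (𝓝 (17 * 0)) := hr.const_mul 17
    rw [mul_zero] at this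
    exact (this.eventually_lt_const (hδ l)).mono fun _ h => h.le)
  let g : ℕ → E → ℝ := fun l => blk φ S u (J l) (J (l+1))
  have hgb : ∀ (i : ℕ) l x, ((i:ℕ∞)) ≤ 2 → ‖iteratedFDeriv ℝ i (g l) x‖ ≤ C * ε l := by
    intro i l x hi
    exact hb u hu S hS _ _ (hε0 l) (hA l) _ _ (hJ.monotone (Nat.le_succ l)) (hJδ l) x i
      (by exact_mod_cast hi)
  have hg2 : ContDiff ℝ 2 (fun x => ∑' l, g l x) := by
    have := contDiff_tsum (𝕜 := ℝ) (N := 2) (f := g) (v := fun _ l => C * ε l)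
      (fun l => by exact_mod_cast blk_contDiff hφ S hu _ _) (fun k _ => hε.mul_left C)
      (fun i l x hi => hgb i l x hi)
    exact_mod_cast this
  refine ⟨fun x => sm φ (rr (J 0)) u x + ∑' l, g l x, (smk_contDiff hφ hu _).add hg2, ?_⟩
  intro x hx
  have hsum : Summable (fun l => g l x) := by
    refine Summable.of_norm_bounded (hε.mul_left C) fun l => ?_
    simpa using hgb 0 l x (by simp)
  have hgx : ∀ l, g l x = sm φ (rr (J (l+1))) u x - sm φ (rr (J l)) u x := by
    intro l
    have h0 : ∀ k, cut φ S k x = 1 := fun k => cut_one hφ (by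
      rw [infDist_zero_of_mem hx]; exact rr_pos k)
    simp only [g, blk, h0, one_mul]
    exact Finset.sum_Ico_sub (fun k => sm φ (rr k) u x) (hJ.monotone (Nat.le_succ l))
  have ht : Tendsto (fun n => ∑ l ∈ Finset.range n, g l x) atTop
      (𝓝 (u x - sm φ (rr (J 0)) u x)) := by
    have : (fun n => ∑ l ∈ Finset.range n, g l x) =
        fun n => sm φ (rr (J n)) u x - sm φ (rr (J 0)) u x := by
      ext n
      simp only [hgx]
      exact Finset.sum_range_sub (fun l => sm φ (rr (J l)) u x) n
    rw [this]
    refine Tendsto.sub_const ?_ _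
    obtain ⟨C1, hC1, hb1⟩ := sm_bound hφ
    rw [Metric.tendsto_atTop]
    intro e he
    obtain ⟨d, hd, hcd⟩ := Metric.continuous_iff.1 hu x (e / (C1 + 1)) (by positivity)
    have hrJ : Tendsto (fun n => rr (J n)) atTop (𝓝 0) := hr.comp hJ.tendsto_atTop
    obtain ⟨N, hN⟩ := (hrJ.eventually_lt_const hd).exists_forall_of_atTop
    refine ⟨N, fun n hn => ?_⟩
    have hcst : Good (fun _ : E => u x) := Good.of_cont continuous_const
    have hu' := Good.of_cont hu
    have h1 := hb1 (rr (J n)) (rr_pos _) (u - fun _ => u x)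
      (Good.of_cont (hu.sub continuous_const)) x (e / (C1+1)) (fun y hy => by
        have := hcd y (lt_of_le_of_lt (mem_closedBall.1 hy) (hN n hn))
        rw [Real.dist_eq] at this
        exact this.le) 0 (by norm_num)
    rw [norm_iteratedFDeriv_zero, sm_sub hφ hu' hcst, Pi.sub_apply,
      sm_const_on hφ (rr_pos _) (f := fun _ => u x) (c := u x) (fun _ _ => rfl)] at h1
    rw [dist_eq_norm]
    refine h1.trans_lt ?_
    rw [pow_zero, mul_one, mul_div_assoc', div_lt_iff₀ (by positivity)]
    nlinarith
  have := tendsto_nhds_unique hsum.hasSum.tendsto_sum_nat ht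
  simp only [this]
  ring

end Lusin


section Cover

variable {E : Type} [NormedAddCommGroup E] [InnerProductSpace ℝ E] [FiniteDimensional ℝ E]
  [MeasurableSpace E] [BorelSpace E]

def TaylorAt (u : E → ℝ) (x : E) : Prop :=
  ∃ P : E → ℝ, IsQuad P ∧ ∀ ε > 0, ∃ δ > 0, ∀ y, ‖y - x‖ ≤ δ → |u y - P y| ≤ ε * ‖y - x‖^2

def AA (u : E → ℝ) (l n : ℕ) : Set E :=
  {x | ∃ P : E → ℝ, IsQuad P ∧ ∀ y, ‖y - x‖ ≤ 1 / ((n:ℝ) + 1) →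
    |u y - P y| ≤ (1/2)^l * ‖y - x‖^2}

theorem AA_mono (u : E → ℝ) (l : ℕ) : Monotone (AA u l) := by
  rintro n n' hn x ⟨P, hP, h⟩
  refine ⟨P, hP, fun y hy => h y (hy.trans ?_)⟩
  gcongr

theorem approx_closure (u : E → ℝ) (l n : ℕ) (S : Set E) (hS : S ⊆ closure (AA u l n)) :
    Approx u S (4 * (1/2)^l) (1 / (2 * ((n:ℝ) + 1))) := by
  intro x hx r0 hr0
  have hpos : 0 < 1 / (2 * ((n:ℝ) + 1)) := by positivity
  obtain ⟨x1, ⟨P, hP, h⟩, hd⟩ := Metric.mem_closure_iff.1 (hS hx) (min r0 (1 / (2 * ((n:ℝ) + 1))))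
    (lt_min hr0 hpos)
  rw [dist_eq_norm] at hd
  refine ⟨P, hP, fun y hy => ?_⟩
  have h1 : ‖y - x1‖ ≤ ‖y - x‖ + ‖x - x1‖ := norm_sub_le_norm_sub_add_norm_sub y x x1
  have h2 := hd.trans_le (min_le_left _ _)
  have h3 := hd.trans_le (min_le_right _ _)
  have e : 1 / ((n:ℝ) + 1) = 1 / (2 * ((n:ℝ) + 1)) + 1 / (2 * ((n:ℝ) + 1)) := by
    field_simp; norm_num
  refine (h y (by linarith)).trans ?_
  have h4 : ‖y - x1‖ ≤ 2 * max r0 ‖y - x‖ := by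
    have := le_max_left r0 ‖y - x‖
    have := le_max_right r0 ‖y - x‖
    linarith
  calc (1/2:ℝ)^l * ‖y - x1‖^2 ≤ (1/2)^l * (2 * max r0 ‖y - x‖)^2 := by gcongr
    _ = _ := by ring

theorem cover_large (u : E → ℝ) (hu : Continuous u) (h : ∀ᵐ x, TaylorAt u x) (R : ℕ)
    (η : ENNReal) (hη : η ≠ 0) :
    ∃ v : E → ℝ, ContDiff ℝ 2 v ∧ volume {x | x ∈ ball (0:E) R ∧ v x ≠ u x} ≤ η := by
  obtain ⟨e, he0, he⟩ := ENNReal.exists_pos_sum_of_countable' hη ℕ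
  have hn : ∀ l, ∃ n, volume (ball (0:E) R \ closure (AA u l n)) < e l := by
    intro l
    have ht := tendsto_measure_iInter_atTop (μ := (volume : Measure E))
      (s := fun n => ball (0:E) R \ closure (AA u l n))
      (fun n => (measurableSet_ball.diff isClosed_closure.measurableSet).nullMeasurableSet)
      (fun n n' hnn => sdiff_subset_sdiff_right (closure_mono (AA_mono u l hnn)))
      ⟨0, ((measure_mono diff_subset).trans_lt measure_ball_lt_top).ne⟩
    have h0 : volume (⋂ n, ball (0:E) R \ closure (AA u l n)) = 0 := by
      refine measure_mono_null ?_ (ae_iff.1 h)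
      intro x hx hT
      rw [mem_iInter] at hx
      obtain ⟨P, hP, hT⟩ := hT
      obtain ⟨δ, hδ, hT⟩ := hT ((1/2)^l) (by positivity)
      obtain ⟨n, hn⟩ := exists_nat_one_div_lt hδ
      exact (hx n).2 (subset_closure ⟨P, hP, fun y hy => hT y (hy.trans hn.le)⟩)
    rw [h0] at ht
    exact (ht.eventually_lt_const (he0 l)).exists
  choose n hn using hn
  let S : Set E := ⋂ l, closure (AA u l (n l))
  obtain ⟨v, hv, hvu⟩ := lusin_ext u hu S (fun l => 4 * (1/2)^l) (fun l => 1 / (2 * ((n l:ℝ) + 1)))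
    (fun l => by positivity) ((summable_geometric_two).mul_left 4) (fun l => by positivity)
    (fun l => approx_closure u l (n l) S (iInter_subset _ l))
  refine ⟨v, hv, ?_⟩
  calc volume {x | x ∈ ball (0:E) R ∧ v x ≠ u x}
      ≤ volume (⋃ l, ball (0:E) R \ closure (AA u l (n l))) := by
        apply measure_mono
        rintro x ⟨hx, hne⟩
        by_contra hc
        simp only [mem_iUnion, not_exists, mem_diff, not_and, not_not] at hc
        exact hne (hvu x (mem_iInter.2 fun l => hc l hx))
    _ ≤ ∑' l, volume (ball (0:E) R \ closure (AA u l (n l))) := measure_iUnion_le _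
    _ ≤ ∑' l, e l := ENNReal.tsum_le_tsum fun l => (hn l).le
    _ ≤ η := he.le

theorem cover (u : E → ℝ) (hu : Continuous u) (h : ∀ᵐ x, TaylorAt u x) :
    ∃ v : ℕ → E → ℝ, (∀ i, ContDiff ℝ 2 (v i)) ∧ ∀ᵐ x, ∃ i, v i x = u x := by
  have := fun (p : ℕ × ℕ) => cover_large u hu h p.1 ((p.2 + 1 : ENNReal)⁻¹) (by simp)
  choose w hw hwu using this
  refine ⟨fun i => w (Nat.unpair i), fun i => hw _, ?_⟩
  have hR : ∀ R : ℕ, ∀ᵐ x : E, x ∈ ball (0:E) R → ∃ i, w (Nat.unpair i) x = u x := by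
    intro R
    rw [ae_iff]
    have hle : ∀ k : ℕ, volume {x : E | ¬ (x ∈ ball (0:E) R → ∃ i, w (Nat.unpair i) x = u x)} ≤
        (k + 1 : ENNReal)⁻¹ := by
      intro k
      refine (measure_mono ?_).trans (hwu (R, k))
      intro x hx
      simp only [mem_ofPred_eq, Classical.not_imp, not_exists] at hx ⊢
      refine ⟨hx.1, ?_⟩
      have := hx.2 (Nat.pair R k)
      rwa [Nat.unpair_pair] at this
    have ht : Tendsto (fun k : ℕ => ((k:ENNReal) + 1)⁻¹) atTop (𝓝 0) := by
      have := (tendsto_add_atTop_iff_nat 1).2 ENNReal.tendsto_inv_nat_nhds_zero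
      simpa using this
    exact le_antisymm (ge_of_tendsto' ht hle) bot_le
  rw [← ae_all_iff] at hR
  filter_upwards [hR] with x hx
  obtain ⟨R, hRx⟩ := exists_nat_gt ‖x‖
  exact hx R (by simpa using hRx)

end Cover


section Alexandrov

variable {E : Type} [NormedAddCommGroup E] [InnerProductSpace ℝ E] [FiniteDimensional ℝ E]
  [MeasurableSpace E] [BorelSpace E]

open scoped NNReal

theorem null_image_lip {J : E → E} {C : ℝ≥0} (hJ : LipschitzWith C J) {s : Set E}
    (hs : volume s = 0) : volume (J '' s) = 0 := by
  have h1 : (volume : Measure E) ≪ μH[Module.finrank ℝ E] :=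
    Measure.absolutelyContinuous_isAddHaarMeasure _ _
  have h2 : (μH[Module.finrank ℝ E] : Measure E) ≪ volume :=
    Measure.absolutelyContinuous_isAddHaarMeasure _ _
  apply h1
  have := hJ.hausdorffMeasure_image_le (d := Module.finrank ℝ E) (by positivity) s
  rw [h2 hs, mul_zero] at this
  exact le_antisymm this (zero_le)

theorem subgrad {f : E → ℝ} (hf : ConvexOn ℝ univ f) {x p : E} (h : HasGradientAt f p x) (y : E) :
    f x + inner ℝ p (y - x) ≤ f y := by
  have hc : ConvexOn ℝ univ (fun t : ℝ => f (x + t • (y - x))) := by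
    have := hf.comp_affineMap (AffineMap.lineMap x y : ℝ →ᵃ[ℝ] E)
    simp only [preimage_univ] at this
    refine this.congr fun t _ => ?_
    simp [AffineMap.lineMap_apply, add_comm]
  have hd : HasDerivAt (fun t : ℝ => f (x + t • (y - x))) (inner ℝ p (y - x)) 0 := by
    have h1 : HasDerivAt (fun t : ℝ => x + t • (y - x)) (y - x) 0 := by
      simpa using ((hasDerivAt_id (0:ℝ)).smul_const (y - x)).const_add x
    have h2 := h.hasFDerivAt
    have h3 : HasFDerivAt f (InnerProductSpace.toDual ℝ E p) (x + (0:ℝ) • (y - x)) := by simpa using h2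
    have h4 := h3.comp_hasDerivAt (0:ℝ) h1
    rw [InnerProductSpace.toDual_apply_apply] at h4
    exact h4
  have := hc.le_slope_of_hasDerivAt (mem_univ 0) (mem_univ 1) one_pos hd
  simp [slope_def_field] at this
  linarith

theorem grad_cont {f : E → ℝ} {L : ℝ≥0} (hL : LipschitzWith L f) {x p : E}
    (h : HasGradientAt f p x) (ε : ℝ) (hε : 0 < ε) : ∃ δ > 0, ∀ x' p', ‖x' - x‖ ≤ δ →
      (∀ y, f x' + inner ℝ p' (y - x') ≤ f y) → ‖p' - p‖ ≤ ε := by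
  have h1 := h.hasFDerivAt.isLittleO.def (half_pos hε)
  rw [Metric.eventually_nhds_iff] at h1
  obtain ⟨ρ', hρ', h1⟩ := h1
  set ρ := ρ' / 2 with hρdef
  have hρ : 0 < ρ := half_pos hρ'
  have hLn : (0:ℝ) ≤ L := L.2
  refine ⟨ε * ρ / (4 * (L + 1)), by positivity, fun x' p' hx' hs => ?_⟩
  by_contra hcon
  push Not at hcon
  have hq : 0 < ‖p' - p‖ := hε.trans hcon
  set q := p' - p with hqd
  set k : E := (ρ / ‖q‖) • q with hk
  have hkn : ‖k‖ = ρ := by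
    rw [hk, norm_smul, Real.norm_eq_abs, abs_of_pos (by positivity)]; field_simp
  have hkq : inner ℝ q k = ρ * ‖q‖ := by
    rw [hk, inner_smul_right, real_inner_self_eq_norm_sq]; field_simp
  have h2 := h1 (y := x + k) (by simp [dist_eq_norm, hkn]; linarith)
  simp only [InnerProductSpace.toDual_apply_apply, add_sub_cancel_left, Real.norm_eq_abs, hkn] at h2
  have h3 := (abs_le.1 h2).2
  have h4 := hs (x + k)
  have h5 := hs (x' + (x' - x))
  rw [add_sub_cancel_left] at h5
  have l1 := hL.dist_le_mul x' x
  have l2 := hL.dist_le_mul (x' + (x' - x)) x'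
  simp only [dist_eq_norm, add_sub_cancel_left] at l1 l2
  have l1' := (abs_le.1 l1).1
  have l2' := (abs_le.1 l2).2
  have e1 : inner ℝ p' (x + k - x') = inner ℝ p' k - inner ℝ p' (x' - x) := by
    rw [← inner_sub_right]; congr 1; abel
  have e2 : inner ℝ q k = inner ℝ p' k - inner ℝ p k := by rw [hqd, inner_sub_left]
  have h6 : ρ * ‖q‖ ≤ 2 * (L * ‖x' - x‖) + ε / 2 * ρ := by linarith
  have h7 : L * ‖x' - x‖ ≤ (L + 1) * (ε * ρ / (4 * (L + 1))) := by
    apply mul_le_mul _ hx' (norm_nonneg _) (by positivity); linarith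
  have h8 : (L + 1) * (ε * ρ / (4 * (L + 1))) = ε * ρ / 4 := by
    have : (L:ℝ) + 1 ≠ 0 := by positivity
    field_simp
  have : ρ * ε < ρ * ‖q‖ := mul_lt_mul_of_pos_left hcon hρ
  nlinarith

theorem oneD {g : ℝ → ℝ} {α β : ℝ}
    (h : ∀ a b, 0 ≤ a → a ≤ b → b ≤ 1 → g b - g a ≤ (b - a) * (α + β * b)) :
    g 1 - g 0 ≤ α + β / 2 := by
  have key : ∀ N : ℕ, g 1 - g 0 ≤ α + β / 2 + β / 2 * (1 / ((N:ℝ) + 1)) := by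
    intro N
    have hN : (0:ℝ) < (N:ℝ) + 1 := by positivity
    set M : ℝ := (N:ℝ) + 1 with hM
    have : ∀ k : ℕ, k ≤ N + 1 → g (k / M) - g 0 ≤ k * α / M + β * k * (k + 1) / (2 * M ^ 2) := by
      intro k
      induction k with
      | zero => intro _; simp
      | succ k ih =>
        intro hk
        have i1 := ih (by omega)
        have i2 := h (k / M) ((k+1 : ℕ) / M) (by positivity)
          (by gcongr; simp) (by
            rw [div_le_one hN, hM]; exact_mod_cast hk)
        have e : (((k+1 : ℕ) : ℝ) / M - k / M) * (α + β * (((k+1 : ℕ):ℝ) / M)) + (k * α / M + β * k * (k + 1) / (2 * M ^ 2))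
          = (k+1 : ℕ) * α / M + β * (k+1 : ℕ) * ((k+1 : ℕ) + 1) / (2 * M ^ 2) := by
          push_cast; field_simp; ring
        linarith
    have h1 := this (N+1) le_rfl
    push_cast at h1
    rw [← hM, div_self hN.ne'] at h1
    have e : M * α / M + β * M * (M + 1) / (2 * M ^ 2) = α + β / 2 + β / 2 * (1 / M) := by
      field_simp; ring
    linarith
  have lim : Tendsto (fun N : ℕ => α + β / 2 + β / 2 * (1 / ((N:ℝ) + 1))) atTop (𝓝 (α + β / 2 + β / 2 * 0)) :=
    (tendsto_one_div_add_atTop_nhds_zero_nat.const_mul _).const_add _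
  rw [mul_zero, add_zero] at lim
  exact ge_of_tendsto' lim key

theorem taylor_of_grad {f : E → ℝ} (hf : Continuous f) {D : Set E} (hD : Dense D) {pp : E → E}
    (hsub : ∀ x ∈ D, ∀ y, f x + inner ℝ (pp x) (y - x) ≤ f y) {x p : E} {A : E →L[ℝ] E}
    (hA : ∀ ε > 0, ∃ δ > 0, ∀ x' ∈ D, ‖x' - x‖ ≤ δ → ‖pp x' - p - A (x' - x)‖ ≤ ε * ‖x' - x‖) :
    TaylorAt f x := by
  refine ⟨_, IsQuad.of_center x (f x) (innerSL ℝ p) ((1/2 : ℝ) • (innerSL ℝ).flip.comp A), ?_⟩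
  intro ε hε
  obtain ⟨δ, hδ, h1⟩ := hA ε hε
  refine ⟨δ / 2, by positivity, fun y hy => ?_⟩
  have key : ∀ z h : E, ‖z - x‖ < δ → f z - f (z - h) ≤
      inner ℝ (p + A (z - x)) h + ε * ‖z - x‖ * ‖h‖ := by
    intro z h hz
    have hcl : IsClosed {z | f z - f (z - h) ≤ inner ℝ (p + A (z - x)) h + ε * ‖z - x‖ * ‖h‖} :=
      isClosed_le (by fun_prop) (by fun_prop)
    have hop : IsOpen {z | ‖z - x‖ < δ} := isOpen_lt (by fun_prop) (by fun_prop)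
    have hm := hD.open_subset_closure_inter hop hz
    refine hcl.closure_subset_iff.2 ?_ hm
    rintro w ⟨hw1, hw2⟩
    have a1 := hsub w hw2 (w - h)
    have a2 := h1 w hw2 (le_of_lt hw1)
    rw [sub_sub_cancel_left, inner_neg_right] at a1
    have a3 : inner ℝ (pp w - p - A (w - x)) h ≤ ε * ‖w - x‖ * ‖h‖ :=
      (real_inner_le_norm _ _).trans (by gcongr)
    simp only [mem_ofPred_eq]
    rw [inner_sub_left, inner_sub_left] at a3
    rw [inner_add_left]
    linarith
  set v := y - x with hv
  have hvn : ∀ t : ℝ, 0 ≤ t → t ≤ 1 → ‖x + t • v - x‖ < δ := by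
    intro t h0 h1
    rw [add_sub_cancel_left, norm_smul, Real.norm_eq_abs, abs_of_nonneg h0]
    nlinarith [norm_nonneg v]
  have kk : ∀ a b : ℝ, 0 ≤ a → a ≤ 1 → f (x + a • v) - f (x + b • v) ≤
      (a - b) * (inner ℝ p v + a * inner ℝ (A v) v) + ε * a * |a - b| * ‖v‖^2 := by
    intro a b h0 h1
    have := key (x + a • v) ((a - b) • v) (hvn a h0 h1)
    have e : x + a • v - (a - b) • v = x + b • v := by rw [sub_smul]; abel
    rw [e, add_sub_cancel_left, norm_smul, norm_smul, Real.norm_eq_abs, Real.norm_eq_abs,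
      abs_of_nonneg h0, map_smul, inner_smul_right, inner_add_left, inner_smul_left] at this
    simp only [conj_trivial] at this
    refine this.trans (le_of_eq ?_)
    ring
  have up := oneD (g := fun t => f (x + t • v)) (α := inner ℝ p v)
    (β := inner ℝ (A v) v + ε * ‖v‖^2) (by
      intro a b h0 hab h1
      have := kk b a (h0.trans hab) h1
      rw [abs_of_nonneg (by linarith)] at this
      refine this.trans (le_of_eq ?_)
      ring)
  have lo := oneD (g := fun t => f (x + (1 - t) • v))
    (α := - inner ℝ p v - (inner ℝ (A v) v - ε * ‖v‖^2))
    (β := inner ℝ (A v) v - ε * ‖v‖^2) (by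
      intro a b h0 hab h1
      have := kk (1 - b) (1 - a) (by linarith) (by linarith)
      rw [abs_of_nonpos (by linarith)] at this
      refine this.trans (le_of_eq ?_)
      ring)
  have exy : x + v = y := by rw [hv]; abel
  simp only [one_smul, zero_smul, add_zero, sub_self, sub_zero, exy] at up lo
  simp only [_root_.smul_apply, ContinuousLinearMap.comp_apply,
    ContinuousLinearMap.flip_apply, innerSL_apply_apply, smul_eq_mul]
  have e3 : inner ℝ v (A v) = inner ℝ (A v) v := real_inner_comm _ _
  rw [abs_le]
  have : 0 ≤ ε * ‖v‖^2 := by positivity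
  constructor <;> linarith

theorem grad_diff {D : Set E} {pp : E → E} {x p : E} {J : E → E} {e : E ≃L[ℝ] E}
    (hJ : HasFDerivAt J (e : E →L[ℝ] E) (x + p)) (hJx : J (x + p) = x)
    (hJD : ∀ x' ∈ D, J (x' + pp x') = x')
    (hc : ∀ ε > 0, ∃ δ > 0, ∀ x' ∈ D, ‖x' - x‖ ≤ δ → ‖pp x' - p‖ ≤ ε) :
    ∀ ε > 0, ∃ δ > 0, ∀ x' ∈ D, ‖x' - x‖ ≤ δ →
      ‖pp x' - p - ((e.symm : E →L[ℝ] E) - ContinuousLinearMap.id ℝ E) (x' - x)‖ ≤ ε * ‖x' - x‖ := by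
  intro ε hε
  set C : ℝ := ‖(e.symm : E →L[ℝ] E)‖ + 1 with hC
  have hCpos : 0 < C := by positivity
  set η : ℝ := min (1 / (2 * C)) (ε / (2 * C^2)) with hη
  have hηpos : 0 < η := by positivity
  have h1 := hJ.isLittleO.def hηpos
  rw [Metric.eventually_nhds_iff] at h1
  obtain ⟨r, hr, h1⟩ := h1
  obtain ⟨δ, hδ, h2⟩ := hc (r / 4) (by positivity)
  refine ⟨min δ (r / 4), by positivity, fun x' hx' hd => ?_⟩
  have a1 := h2 x' hx' (hd.trans (min_le_left _ _))
  have a2 := hd.trans (min_le_right _ _)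
  set w := (x' + pp x') - (x + p) with hw
  have ew : w = (x' - x) + (pp x' - p) := by rw [hw]; abel
  have hwn : ‖w‖ < r := by
    rw [ew]; refine (norm_add_le _ _).trans_lt ?_; linarith
  have a3 := h1 (y := x' + pp x') (by rw [dist_eq_norm]; exact hwn)
  rw [hJx, hJD x' hx', ← hw] at a3
  have a4 : ‖w - e.symm (x' - x)‖ ≤ C * (η * ‖w‖) := by
    have : w - e.symm (x' - x) = - (e.symm : E →L[ℝ] E) (x' - x - e w) := by
      simp
    rw [this, norm_neg]
    refine (ContinuousLinearMap.le_opNorm _ _).trans ?_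
    refine mul_le_mul (by rw [hC]; linarith) a3 (norm_nonneg _) hCpos.le
  have b1 : C * η ≤ 1 / 2 := by
    have : C * η ≤ C * (1 / (2 * C)) := by gcongr; exact min_le_left _ _
    refine this.trans (le_of_eq ?_); field_simp
  have b2 : C * η * (2 * C) ≤ ε := by
    have : C * η * (2 * C) ≤ C * (ε / (2 * C^2)) * (2 * C) := by gcongr; exact min_le_right _ _
    refine this.trans (le_of_eq ?_); field_simp
  have a5 : ‖e.symm (x' - x)‖ ≤ C * ‖x' - x‖ := by
    refine ((e.symm : E →L[ℝ] E).le_opNorm (x' - x)).trans ?_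
    gcongr; rw [hC]; linarith
  have a6 : ‖w‖ ≤ 2 * C * ‖x' - x‖ := by
    have t1 : ‖w‖ ≤ ‖w - e.symm (x' - x)‖ + ‖e.symm (x' - x)‖ := by
      simpa using norm_add_le (w - e.symm (x' - x)) (e.symm (x' - x))
    have t2 : C * (η * ‖w‖) ≤ 1 / 2 * ‖w‖ := by
      rw [← mul_assoc]; gcongr
    linarith
  have e5 : pp x' - p - ((e.symm : E →L[ℝ] E) - ContinuousLinearMap.id ℝ E) (x' - x)
      = w - e.symm (x' - x) := by
    simp [ew]; abel
  rw [e5]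
  calc _ ≤ C * (η * ‖w‖) := a4
    _ ≤ C * (η * (2 * C * ‖x' - x‖)) := by gcongr
    _ = (C * η * (2 * C)) * ‖x' - x‖ := by ring
    _ ≤ _ := by gcongr

theorem alexandrov {f : E → ℝ} (hf : ConvexOn ℝ univ f) {L : ℝ≥0} (hL : LipschitzWith L f) :
    ∀ᵐ x, TaylorAt f x := by
  set D : Set E := {x | DifferentiableAt ℝ f x} with hDd
  have hDae : ∀ᵐ x, x ∈ D := hL.ae_differentiableAt
  have hD : Dense D := Measure.dense_of_ae hDae
  set pp : E → E := fun x => gradient f x with hpp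
  have hg : ∀ x ∈ D, HasGradientAt f (pp x) x := fun x hx => DifferentiableAt.hasGradientAt hx
  have hsub : ∀ x ∈ D, ∀ y, f x + inner ℝ (pp x) (y - x) ≤ f y := fun x hx y =>
    subgrad hf (hg x hx) y
  set T : E → E := fun x => x + pp x with hT
  have hexp : ∀ x ∈ D, ∀ y ∈ D, ‖x - y‖ ≤ ‖T x - T y‖ := by
    intro x hx y hy
    have h1 := hsub x hx y
    have h2 := hsub y hy x
    have h3 : 0 ≤ inner ℝ (pp x - pp y) (x - y) := by
      rw [inner_sub_left]
      have : inner ℝ (pp x) (y - x) = - inner ℝ (pp x) (x - y) := by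
        rw [← inner_neg_right, neg_sub]
      linarith
    have h4 : ‖x - y‖ ^ 2 ≤ ‖T x - T y‖ ^ 2 := by
      have : T x - T y = (x - y) + (pp x - pp y) := by simp only [hT]; abel
      rw [this, norm_add_sq_real, real_inner_comm]
      nlinarith [sq_nonneg ‖pp x - pp y‖]
    exact le_of_sq_le_sq h4 (norm_nonneg _)
  have hinj : InjOn T D := by
    intro x hx y hy hxy
    have := hexp x hx y hy
    rw [hxy, sub_self, norm_zero] at this
    exact sub_eq_zero.1 (norm_le_zero_iff.1 this)
  have hinv : ∀ x ∈ D, Function.invFunOn T D (T x) = x := fun x hx =>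
    hinj.leftInvOn_invFunOn hx
  have hlip : LipschitzOnWith 1 (Function.invFunOn T D) (T '' D) := by
    rw [lipschitzOnWith_iff_dist_le_mul]
    rintro _ ⟨x, hx, rfl⟩ _ ⟨y, hy, rfl⟩
    rw [hinv x hx, hinv y hy, dist_eq_norm, dist_eq_norm]
    simpa using hexp x hx y hy
  obtain ⟨J, hJ, hJe⟩ := hlip.extend_finite_dimension
  have hJD : ∀ x ∈ D, J (x + pp x) = x := by
    intro x hx
    have := hJe ⟨x, hx, rfl⟩
    rw [hinv x hx] at this
    exact this.symm
  have n1 : volume (J '' {z | ¬ DifferentiableAt ℝ J z}) = 0 :=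
    null_image_lip hJ hJ.ae_differentiableAt
  have n2 : volume (J '' {z | DifferentiableAt ℝ J z ∧ (fderiv ℝ J z).det = 0}) = 0 :=
    addHaar_image_eq_zero_of_det_fderivWithin_eq_zero volume
      (fun z hz => hz.1.hasFDerivAt.hasFDerivWithinAt) (fun z hz => hz.2)
  have m1 : ∀ᵐ x, x ∉ J '' {z | ¬ DifferentiableAt ℝ J z} := measure_eq_zero_iff_ae_notMem.1 n1
  have m2 := measure_eq_zero_iff_ae_notMem.1 n2
  filter_upwards [hDae, m1, m2] with x hx k1 k2
  have d1 : DifferentiableAt ℝ J (x + pp x) := by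
    by_contra hcon
    exact k1 ⟨x + pp x, hcon, hJD x hx⟩
  have d2 : (fderiv ℝ J (x + pp x)).det ≠ 0 := by
    intro hcon
    exact k2 ⟨x + pp x, ⟨d1, hcon⟩, hJD x hx⟩
  have d3 := d1.hasFDerivAt
  set e := (fderiv ℝ J (x + pp x)).toContinuousLinearEquivOfDetNeZero d2 with he
  have d4 : HasFDerivAt J (e : E →L[ℝ] E) (x + pp x) := by
    rw [he, ContinuousLinearMap.coe_toContinuousLinearEquivOfDetNeZero]; exact d3
  refine taylor_of_grad hL.continuous hD hsub
    (grad_diff (p := pp x) d4 (hJD x hx) hJD ?_)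
  intro ε hε
  obtain ⟨δ, hδ, h⟩ := grad_cont hL (hg x hx) ε hε
  exact ⟨δ, hδ, fun x' hx' hd => h x' _ hd (hsub x' hx')⟩

end Alexandrov


section Nearest

variable {E : Type} [NormedAddCommGroup E] [InnerProductSpace ℝ E] [FiniteDimensional ℝ E]

theorem near_cont {K : Set E} (hc : IsClosed K) {x y : E}
    (hy : y ∈ K) (hyd : infDist x K = dist x y)
    (huniq : ∀ z ∈ K, infDist x K = dist x z → z = y) (ε : ℝ) (hε : 0 < ε) :
    ∃ δ > 0, ∀ x', ‖x' - x‖ ≤ δ → ∀ z ∈ K, infDist x' K = dist x' z → ‖z - y‖ ≤ ε := by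
  have : ProperSpace E := FiniteDimensional.proper ℝ E
  set K' : Set E := K ∩ {z | ε ≤ ‖z - y‖} with hK'
  have hc' : IsClosed K' := hc.inter (isClosed_le (by fun_prop) (by fun_prop))
  rcases K'.eq_empty_or_nonempty with h0 | hne
  · refine ⟨1, one_pos, fun x' _ z hz _ => ?_⟩
    by_contra hcon
    push Not at hcon
    have : z ∈ K' := ⟨hz, hcon.le⟩
    rw [h0] at this
    exact this
  · obtain ⟨w, hw, hwd⟩ := hc'.exists_infDist_eq_dist hne x
    have hgap : infDist x K < infDist x K' := by
      refine lt_of_le_of_ne (infDist_le_infDist_of_subset inter_subset_left hne) fun heq => ?_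
      have := huniq w hw.1 (heq.trans hwd)
      have h2 := hw.2
      simp only [mem_ofPred_eq, this, sub_self, norm_zero] at h2
      linarith
    refine ⟨(infDist x K' - infDist x K) / 3, by linarith, fun x' hx' z hz hzd => ?_⟩
    by_contra hcon
    push Not at hcon
    have a1 : infDist x K' ≤ dist x z := infDist_le_dist_of_mem ⟨hz, hcon.le⟩
    have a2 : dist x z ≤ dist x x' + dist x' z := dist_triangle _ _ _
    have a3 : infDist x' K ≤ infDist x K + dist x' x := infDist_le_infDist_add_dist
    rw [← dist_eq_norm] at hx'
    rw [dist_comm x x'] at a2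
    linarith

theorem sing_two {K : Set E} (hne : K.Nonempty) (hc : IsClosed K) {x : E}
    (hx : ¬ DifferentiableAt ℝ (fun y => infDist y K ^ 2) x) :
    ∃ y ∈ K, ∃ z ∈ K, y ≠ z ∧ infDist x K = dist x y ∧ infDist x K = dist x z := by
  have : ProperSpace E := FiniteDimensional.proper ℝ E
  by_contra hcon
  push Not at hcon
  obtain ⟨y, hy, hyd⟩ := hc.exists_infDist_eq_dist hne x
  have huniq : ∀ z ∈ K, infDist x K = dist x z → z = y := by
    intro z hz hzd
    by_contra hzy
    exact hcon y hy z hz (Ne.symm hzy) hyd hzd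
  apply hx
  have : HasFDerivAt (fun y => infDist y K ^ 2) ((2:ℝ) • innerSL ℝ (x - y)) x := by
    refine HasFDerivAt.of_isLittleO ?_
    rw [Asymptotics.isLittleO_iff]
    intro c hcpos
    obtain ⟨δ, hδ, h⟩ := near_cont hc hy hyd huniq (c / 4) (by positivity)
    have : ∀ᶠ x' in 𝓝 x, dist x' x < min δ (c / 4) :=
      Metric.eventually_nhds_iff.2 ⟨min δ (c / 4), by positivity, fun _ h => h⟩
    filter_upwards [this] with x' hx'
    rw [dist_eq_norm] at hx'
    have b1 := hx'.le.trans (min_le_left _ _)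
    have b2 := hx'.le.trans (min_le_right _ _)
    obtain ⟨z, hz, hzd⟩ := hc.exists_infDist_eq_dist hne x'
    have b3 := h x' b1 z hz hzd
    set k := x' - x with hk
    have ex : x' = x + k := by rw [hk]; abel
    have c1 : infDist x' K ≤ dist x' y := infDist_le_dist_of_mem hy
    have c2 : infDist x K ≤ dist x z := infDist_le_dist_of_mem hz
    have q1 : infDist x' K ^ 2 ≤ dist x' y ^ 2 := pow_le_pow_left₀ infDist_nonneg c1 2
    have q2 : infDist x K ^ 2 ≤ dist x z ^ 2 := pow_le_pow_left₀ infDist_nonneg c2 2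
    have q3 : infDist x K ^ 2 = dist x y ^ 2 := by rw [hyd]
    have q4 : infDist x' K ^ 2 = dist x' z ^ 2 := by rw [hzd]
    have e1 : ∀ w, dist x' w ^ 2 = dist x w ^ 2 + 2 * inner ℝ (x - w) k + ‖k‖ ^ 2 := by
      intro w
      rw [dist_eq_norm, dist_eq_norm, ← norm_add_sq_real, ex]
      congr 2; abel
    have e2 : inner ℝ (x - z) k = inner ℝ (x - y) k - inner ℝ (z - y) k := by
      rw [← inner_sub_left]; congr 1; abel
    have e3 : inner ℝ (z - y) k ≤ c / 4 * ‖k‖ := (real_inner_le_norm _ _).trans (by gcongr)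
    have e4 : ‖k‖ ^ 2 ≤ c / 4 * ‖k‖ := by rw [sq]; gcongr
    have f1 := e1 y
    have f2 := e1 z
    simp only [_root_.smul_apply, innerSL_apply_apply, smul_eq_mul, Real.norm_eq_abs]
    have : 0 ≤ c * ‖k‖ := by positivity
    have : 0 ≤ ‖k‖ ^ 2 := by positivity
    rw [abs_le]
    constructor <;> linarith
  exact this.differentiableAt

end Nearest

section InfSup

open scoped NNReal

variable {E : Type} [NormedAddCommGroup E] [InnerProductSpace ℝ E] {ι : Type}

noncomputable def Phi (a : ι → ℝ) (b : ι → E) (c : ι → ℝ) (s : ℝ) (t : ℝ) (x : E) : ℝ :=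
  ⨆ y : ι, (t * (a y - s) + inner ℝ x (b y) - c y)

noncomputable def MM (a : ι → ℝ) (b : ι → E) (c : ι → ℝ) (s : ℝ) (x : E) : ℝ :=
  ⨅ t : ℝ, Phi a b c s t x

structure Bd (a : ι → ℝ) (b : ι → E) (c : ι → ℝ) (R R' : ℝ) : Prop where
  ha : ∀ y, |a y| ≤ R
  hb : ∀ y, ‖b y‖ ≤ R
  hc : ∀ y, |c y| ≤ R'

variable {a : ι → ℝ} {b : ι → E} {c : ι → ℝ} {R R' : ℝ} {s : ℝ}

theorem Bd.bdd (h : Bd a b c R R') (s t : ℝ) (x : E) :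
    BddAbove (range fun y : ι => (t * (a y - s) + inner ℝ x (b y) - c y)) := by
  refine ⟨|t| * (R + |s|) + ‖x‖ * R + R', ?_⟩
  rintro _ ⟨y, rfl⟩
  have h1 : t * (a y - s) ≤ |t| * (R + |s|) := by
    refine (le_abs_self _).trans ?_
    rw [abs_mul]
    gcongr
    exact (abs_sub _ _).trans (by gcongr; exact h.ha y)
  have h2 : inner ℝ x (b y) ≤ ‖x‖ * R := (real_inner_le_norm _ _).trans (by gcongr; exact h.hb y)
  have h3 := (abs_le.1 (h.hc y)).1
  simp only
  linarith

theorem Bd.le_Phi (h : Bd a b c R R') (s t : ℝ) (x : E) (y : ι) :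
    t * (a y - s) + inner ℝ x (b y) - c y ≤ Phi a b c s t x :=
  le_ciSup (h.bdd s t x) y

theorem Bd.bddBelow (h : Bd a b c R R') {y1 y2 : ι} (h1 : a y1 ≤ s) (h2 : s ≤ a y2) (x : E) :
    BddBelow (range fun t : ℝ => Phi a b c s t x) := by
  refine ⟨-(‖x‖ * R) - R', ?_⟩
  rintro _ ⟨t, rfl⟩
  have key : ∀ y, 0 ≤ t * (a y - s) → -(‖x‖ * R) - R' ≤ Phi a b c s t x := by
    intro y hy
    have k1 := h.le_Phi s t x y
    have k2 : -(‖x‖ * R) ≤ inner ℝ x (b y) := by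
      have := (abs_le.1 (abs_real_inner_le_norm x (b y))).1
      have h3 : ‖x‖ * ‖b y‖ ≤ ‖x‖ * R := by gcongr; exact h.hb y
      linarith
    have k3 := (abs_le.1 (h.hc y)).2
    linarith
  rcases le_total 0 t with ht | ht
  · exact key y2 (mul_nonneg ht (by linarith))
  · exact key y1 (mul_nonneg_of_nonpos_of_nonpos ht (by linarith))

theorem MM_lip (h : Bd a b c R R') (hR : 0 ≤ R) {y1 y2 : ι} (h1 : a y1 ≤ s) (h2 : s ≤ a y2) :
    LipschitzWith R.toNNReal (MM a b c s : E → ℝ) := by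
  have : Nonempty ι := ⟨y1⟩
  refine LipschitzWith.of_le_add_mul _ fun x z => ?_
  rw [← sub_le_iff_le_add]
  refine le_ciInf fun t => ?_
  rw [sub_le_iff_le_add]
  refine (ciInf_le (h.bddBelow h1 h2 x) t).trans ?_
  refine ciSup_le fun y => ?_
  have k1 := h.le_Phi s t z y
  have k2 : inner ℝ x (b y) - inner ℝ z (b y) ≤ R * dist x z := by
    rw [← inner_sub_left, mul_comm, dist_eq_norm]
    exact (real_inner_le_norm _ _).trans (by gcongr; exact h.hb y)
  rw [Real.coe_toNNReal R hR]
  linarith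

theorem MM_convex (h : Bd a b c R R') {y1 y2 : ι} (h1 : a y1 ≤ s) (h2 : s ≤ a y2) :
    ConvexOn ℝ univ (MM a b c s : E → ℝ) := by
  have : Nonempty ι := ⟨y1⟩
  refine ⟨convex_univ, fun x _ z _ p q hp hq hpq => ?_⟩
  refine le_of_forall_pos_le_add fun ε hε => ?_
  obtain ⟨t1, ht1⟩ := exists_lt_of_ciInf_lt (show MM a b c s x < MM a b c s x + ε by linarith)
  obtain ⟨t2, ht2⟩ := exists_lt_of_ciInf_lt (show MM a b c s z < MM a b c s z + ε by linarith)
  refine (ciInf_le (h.bddBelow h1 h2 _) (p * t1 + q * t2)).trans ?_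
  refine ciSup_le fun y => ?_
  have k1 := (h.le_Phi s t1 x y).trans ht1.le
  have k2 := (h.le_Phi s t2 z y).trans ht2.le
  have k3 := mul_le_mul_of_nonneg_left k1 hp
  have k4 := mul_le_mul_of_nonneg_left k2 hq
  rw [inner_add_left, real_inner_smul_left, real_inner_smul_left]
  simp only [smul_eq_mul]
  have hq' : q = 1 - p := by linarith
  subst hq'
  linarith

theorem MM_eq (h : Bd a b c R R') {y1 y2 : ι} (h1 : a y1 ≤ s) (h2 : s ≤ a y2) {t0 V : ℝ} {x : E}
    (hV : ∀ y, t0 * a y + inner ℝ x (b y) - c y ≤ V)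
    (e1 : t0 * a y1 + inner ℝ x (b y1) - c y1 = V)
    (e2 : t0 * a y2 + inner ℝ x (b y2) - c y2 = V) : MM a b c s x = V - s * t0 := by
  have : Nonempty ι := ⟨y1⟩
  apply le_antisymm
  · refine (ciInf_le (h.bddBelow h1 h2 x) t0).trans ?_
    refine ciSup_le fun y => ?_
    have := hV y
    linarith
  · refine le_ciInf fun t => ?_
    rcases le_total t0 t with ht | ht
    · have := h.le_Phi s t x y2
      nlinarith
    · have := h.le_Phi s t x y1
      nlinarith

end InfSup

section Coord

open scoped NNReal

variable {m : ℕ}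

noncomputable def pr (i : Fin (m+1)) (x : EuclideanSpace ℝ (Fin (m+1))) : EuclideanSpace ℝ (Fin m) :=
  WithLp.toLp 2 (fun j => x (i.succAbove j))

noncomputable def ins (i : Fin (m+1)) (t : ℝ) (x : EuclideanSpace ℝ (Fin m)) :
    EuclideanSpace ℝ (Fin (m+1)) :=
  WithLp.toLp 2 (i.insertNth t (fun j => x j) : Fin (m+1) → ℝ)

@[simp] theorem ins_self (i : Fin (m+1)) (t : ℝ) (x : EuclideanSpace ℝ (Fin m)) : ins i t x i = t := by
  simp [ins]

@[simp] theorem ins_succ (i : Fin (m+1)) (t : ℝ) (x : EuclideanSpace ℝ (Fin m)) (j : Fin m) :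
    ins i t x (i.succAbove j) = x j := by
  simp [ins]

theorem ins_pr (i : Fin (m+1)) (x : EuclideanSpace ℝ (Fin (m+1))) : ins i (x i) (pr i x) = x := by
  ext j
  refine Fin.succAboveCases i ?_ (fun k => ?_) j
  · simp
  · simp [pr]

theorem ins_sub (i : Fin (m+1)) (t t' : ℝ) (x x' : EuclideanSpace ℝ (Fin m)) :
    ins i t x - ins i t' x' = ins i (t - t') (x - x') := by
  ext j
  refine Fin.succAboveCases i ?_ (fun k => ?_) j
  · simp
  · simp

theorem inner_pr (i : Fin (m+1)) (x y : EuclideanSpace ℝ (Fin (m+1))) :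
    inner ℝ x y = x i * y i + inner ℝ (pr i x) (pr i y) := by
  simp only [PiLp.inner_apply, Fin.sum_univ_succAbove _ i]
  simp [pr, mul_comm]

theorem norm_ins_sq (i : Fin (m+1)) (t : ℝ) (x : EuclideanSpace ℝ (Fin m)) :
    ‖ins i t x‖^2 = t^2 + ‖x‖^2 := by
  simp [EuclideanSpace.norm_sq_eq, Fin.sum_univ_succAbove _ i]

theorem norm_ins_le (i : Fin (m+1)) (t : ℝ) (x : EuclideanSpace ℝ (Fin m)) :
    ‖ins i t x‖ ≤ |t| + ‖x‖ := by
  refine le_of_sq_le_sq ?_ (by positivity)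
  rw [norm_ins_sq, add_sq, sq_abs]
  have : 0 ≤ 2 * |t| * ‖x‖ := by positivity
  linarith

theorem norm_pr_le (i : Fin (m+1)) (x : EuclideanSpace ℝ (Fin (m+1))) : ‖pr i x‖ ≤ ‖x‖ := by
  refine le_of_sq_le_sq ?_ (by positivity)
  conv_rhs => rw [← ins_pr i x, norm_ins_sq]
  nlinarith [sq_nonneg (x i)]

theorem abs_coord_le (i : Fin (m+1)) (x : EuclideanSpace ℝ (Fin (m+1))) : |x i| ≤ ‖x‖ := by
  refine le_of_sq_le_sq ?_ (by positivity)
  conv_rhs => rw [← ins_pr i x, norm_ins_sq]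
  rw [sq_abs]
  nlinarith [sq_nonneg ‖pr i x‖]

theorem ins_contDiff (i : Fin (m+1)) {v : EuclideanSpace ℝ (Fin m) → ℝ} (hv : ContDiff ℝ 2 v) :
    ContDiff ℝ 2 (fun x => ins i (v x) x) := by
  rw [contDiff_euclidean]
  intro j
  refine Fin.succAboveCases i ?_ (fun k => ?_) j
  · simpa using hv
  · simp only [ins_succ]
    fun_prop

theorem ins_lip (i : Fin (m+1)) {v : EuclideanSpace ℝ (Fin m) → ℝ} {C : ℝ≥0} (hv : LipschitzWith C v) :
    LipschitzWith (C + 1) (fun x => ins i (v x) x) := by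
  refine LipschitzWith.of_dist_le_mul fun x y => ?_
  rw [dist_eq_norm, ins_sub]
  refine (norm_ins_le _ _ _).trans ?_
  have := hv.dist_le_mul x y
  rw [Real.dist_eq] at this
  rw [← dist_eq_norm]
  push_cast
  linarith

/-- points associated with an index -/
def Assoc (K : Set (EuclideanSpace ℝ (Fin (m+1)))) (i : Fin (m+1)) (s1 s2 : ℝ) (R : ℝ) :
    Set (EuclideanSpace ℝ (Fin (m+1))) :=
  {x | s1 < s2 ∧ ∃ y1 ∈ K, ∃ y2 ∈ K, ‖y1‖ ≤ R ∧ ‖y2‖ ≤ R ∧ y1 i ≤ s1 ∧ s2 ≤ y2 i ∧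
    infDist x K = dist x y1 ∧ infDist x K = dist x y2}

theorem near_val {K : Set (EuclideanSpace ℝ (Fin (m+1)))} {x y z : EuclideanSpace ℝ (Fin (m+1))}
    (hy : infDist x K = dist x y) (hz : z ∈ K) :
    inner ℝ x z - ‖z‖^2/2 ≤ inner ℝ x y - ‖y‖^2/2 := by
  have h1 : dist x y ≤ dist x z := hy ▸ infDist_le_dist_of_mem hz
  have h2 : dist x y ^ 2 ≤ dist x z ^ 2 := pow_le_pow_left₀ dist_nonneg h1 2
  rw [dist_eq_norm, dist_eq_norm, norm_sub_sq_real, norm_sub_sq_real] at h2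
  linarith

theorem assoc_graph (K : Set (EuclideanSpace ℝ (Fin (m+1)))) (i : Fin (m+1)) (s1 s2 : ℝ) (R : ℝ) :
    ∃ (u : EuclideanSpace ℝ (Fin m) → ℝ) (C : ℝ≥0), LipschitzWith C u ∧ (∀ᵐ x, TaylorAt u x) ∧
      ∀ x ∈ Assoc K i s1 s2 R, x i = u (pr i x) := by
  rcases (Assoc K i s1 s2 R).eq_empty_or_nonempty with h0 | ⟨x0, hs, y1, hy1, y2, hy2, n1, n2, l1, l2, -, -⟩
  · refine ⟨fun _ => 0, 0, LipschitzWith.const 0, Eventually.of_forall fun x => ?_, by simp [h0]⟩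
    refine ⟨fun _ => 0, ⟨0, 0, 0, by simp⟩, fun ε hε => ⟨1, one_pos, fun y _ => ?_⟩⟩
    simp; positivity
  · have hR : 0 ≤ R := (norm_nonneg _).trans n1
    let ι : Type := {y : EuclideanSpace ℝ (Fin (m+1)) // y ∈ K ∧ ‖y‖ ≤ R}
    let a : ι → ℝ := fun y => y.1 i
    let b : ι → EuclideanSpace ℝ (Fin m) := fun y => pr i y.1
    let c : ι → ℝ := fun y => ‖y.1‖^2/2
    have hB : Bd a b c R (R^2/2) := by
      refine ⟨fun y => (abs_coord_le i _).trans y.2.2, fun y => (norm_pr_le i _).trans y.2.2,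
        fun y => ?_⟩
      simp only [c]
      rw [abs_of_nonneg (by positivity)]
      have := y.2.2
      gcongr
    let z1 : ι := ⟨y1, hy1, n1⟩
    let z2 : ι := ⟨y2, hy2, n2⟩
    have a1 : a z1 ≤ s1 := l1
    have a2 : s1 ≤ a z2 := hs.le.trans l2
    have a3 : a z1 ≤ s2 := l1.trans hs.le
    have a4 : s2 ≤ a z2 := l2
    have L1 := MM_lip hB hR a1 a2
    have L2 := MM_lip hB hR a3 a4
    have T1 := alexandrov (MM_convex hB a1 a2) L1
    have T2 := alexandrov (MM_convex hB a3 a4) L2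
    have hd : 0 < s2 - s1 := by linarith
    set k : ℝ := (s2 - s1)⁻¹ with hk
    have hkpos : 0 < k := by positivity
    have hLu : LipschitzWith (k.toNNReal * (R.toNNReal + R.toNNReal))
        (fun x => k * MM a b c s1 x + (-k) * MM a b c s2 x) := by
      refine LipschitzWith.of_dist_le_mul fun x y => ?_
      have d1 := abs_le.1 (L1.dist_le_mul x y)
      have d2 := abs_le.1 (L2.dist_le_mul x y)
      simp only [Real.coe_toNNReal R hR, Real.coe_toNNReal k hkpos.le, NNReal.coe_mul, NNReal.coe_add] at d1 d2 ⊢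
      have e : k * MM a b c s1 x + (-k) * MM a b c s2 x - (k * MM a b c s1 y + (-k) * MM a b c s2 y)
        = k * ((MM a b c s1 x - MM a b c s1 y) - (MM a b c s2 x - MM a b c s2 y)) := by ring
      rw [Real.dist_eq, e, abs_mul, abs_of_pos hkpos, mul_assoc]
      gcongr
      rw [abs_le]
      constructor <;> linarith [d1.1, d1.2, d2.1, d2.2]
    refine ⟨_, _, hLu, ?_, ?_⟩
    · filter_upwards [T1, T2] with x t1 t2
      obtain ⟨P, hP, t1⟩ := t1
      obtain ⟨Q, hQ, t2⟩ := t2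
      refine ⟨_, hP.lin hQ k (-k), fun ε hε => ?_⟩
      obtain ⟨δ1, hδ1, t1⟩ := t1 (ε / (2 * k)) (by positivity)
      obtain ⟨δ2, hδ2, t2⟩ := t2 (ε / (2 * k)) (by positivity)
      refine ⟨min δ1 δ2, by positivity, fun y hy => ?_⟩
      have b1 := t1 y (hy.trans (min_le_left _ _))
      have b2 := t2 y (hy.trans (min_le_right _ _))
      have e : k * MM a b c s1 y + -k * MM a b c s2 y - (k * P y + -k * Q y)
        = k * ((MM a b c s1 y - P y) - (MM a b c s2 y - Q y)) := by ring
      rw [e, abs_mul, abs_of_pos hkpos]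
      have e2 : ε * ‖y - x‖^2 = k * (ε / (2 * k) * ‖y - x‖^2 + ε / (2 * k) * ‖y - x‖^2) := by
        field_simp; ring
      rw [e2]
      gcongr
      exact (abs_sub _ _).trans (add_le_add b1 b2)
    · rintro x ⟨-, w1, hw1, w2, hw2, m1, m2, j1, j2, q1, q2⟩
      have key : ∀ s, s1 ≤ s → s ≤ s2 →
          MM a b c s (pr i x) = (inner ℝ x w1 - ‖w1‖^2/2) - s * x i := by
        intro s hs1 hs2
        refine MM_eq hB (y1 := ⟨w1, hw1, m1⟩) (y2 := ⟨w2, hw2, m2⟩) (j1.trans hs1) (hs2.trans j2)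
          (fun y => ?_) ?_ ?_
        · simp only [a, b, c]
          rw [← inner_pr]
          exact near_val q1 y.2.1
        · simp only [a, b, c]
          rw [← inner_pr]
        · simp only [a, b, c]
          rw [← inner_pr]
          exact le_antisymm (near_val q1 hw2) (near_val q2 hw1)
      simp only
      rw [key s1 le_rfl hs.le, key s2 hs.le le_rfl, hk]
      field_simp
      ring

theorem sing_assoc {K : Set (EuclideanSpace ℝ (Fin (m+1)))} (hne : K.Nonempty) (hc : IsClosed K)
    {x : EuclideanSpace ℝ (Fin (m+1))}
    (hx : ¬ DifferentiableAt ℝ (fun y => infDist y K ^ 2) x) :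
    ∃ α : Fin (m+1) × ℚ × ℚ × ℕ, x ∈ Assoc K α.1 α.2.1 α.2.2.1 α.2.2.2 := by
  obtain ⟨y, hy, z, hz, hyz, d1, d2⟩ := sing_two hne hc hx
  obtain ⟨R, hR⟩ := exists_nat_ge (max ‖y‖ ‖z‖)
  have r1 := (le_max_left _ _).trans hR
  have r2 := (le_max_right _ _).trans hR
  have : ∃ i, y i ≠ z i := by
    by_contra hcon
    push Not at hcon
    exact hyz (by ext i; exact hcon i)
  obtain ⟨i, hi⟩ := this
  rcases lt_or_gt_of_ne hi with h | h
  · obtain ⟨p, p1, p2⟩ := exists_rat_btwn h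
    obtain ⟨q, q1, q2⟩ := exists_rat_btwn p2
    exact ⟨(i, p, q, R), q1, y, hy, z, hz, r1, r2, p1.le, q2.le, d1, d2⟩
  · obtain ⟨p, p1, p2⟩ := exists_rat_btwn h
    obtain ⟨q, q1, q2⟩ := exists_rat_btwn p2
    exact ⟨(i, p, q, R), q1, z, hz, y, hy, r2, r1, p1.le, q2.le, d2, d1⟩

theorem main_succ {K : Set (EuclideanSpace ℝ (Fin (m+1)))} (hne : K.Nonempty) (hc : IsClosed K) :
    ∃ (f : ℕ → EuclideanSpace ℝ (Fin m) → EuclideanSpace ℝ (Fin (m+1)))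
      (N : Set (EuclideanSpace ℝ (Fin (m+1)))),
      (∀ i, ContDiff ℝ 2 (f i)) ∧ μH[(m : ℝ)] N = 0 ∧
      {x | ¬ DifferentiableAt ℝ (fun y => infDist y K ^ 2) x} ⊆ N ∪ ⋃ i, range (f i) := by
  choose u C hL hT hA using fun α : Fin (m+1) × ℚ × ℚ × ℕ =>
    assoc_graph K α.1 α.2.1 α.2.2.1 α.2.2.2
  choose v hv hcov using fun α => cover (u α) (hL α).continuous (hT α)
  obtain ⟨g, hg⟩ := exists_surjective_nat ((Fin (m+1) × ℚ × ℚ × ℕ) × ℕ)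
  refine ⟨fun k x => ins (g k).1.1 (v (g k).1 (g k).2 x) x,
    ⋃ α : Fin (m+1) × ℚ × ℚ × ℕ, (fun x => ins α.1 (u α x) x) '' {x | ¬ ∃ k, v α k x = u α x},
    fun k => ins_contDiff _ (hv _ _), ?_, ?_⟩
  · rw [measure_iUnion_null_iff]
    intro α
    have h2 : (μH[(m:ℝ)] : Measure (EuclideanSpace ℝ (Fin m))) ≪ volume := by
      have := Measure.absolutelyContinuous_isAddHaarMeasure
        (μH[Module.finrank ℝ (EuclideanSpace ℝ (Fin m))] : Measure (EuclideanSpace ℝ (Fin m))) volume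
      simpa using this
    have h3 := (ins_lip α.1 (hL α)).hausdorffMeasure_image_le (d := m) (by positivity)
      {x | ¬ ∃ k, v α k x = u α x}
    have h4 : volume {x | ¬ ∃ k, v α k x = u α x} = 0 := hcov α
    rw [h2 h4, mul_zero] at h3
    exact le_antisymm h3 (zero_le)
  · intro x hx
    obtain ⟨α, hα⟩ := sing_assoc hne hc hx
    have e := hA α x hα
    by_cases h : ∃ k, v α k (pr α.1 x) = u α (pr α.1 x)
    · obtain ⟨k, hk⟩ := h
      obtain ⟨l, hl⟩ := hg (α, k)
      refine Or.inr (mem_iUnion.2 ⟨l, pr α.1 x, ?_⟩)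
      simp only [hl, hk, ← e, ins_pr]
    · refine Or.inl (mem_iUnion.2 ⟨α, pr α.1 x, h, ?_⟩)
      simp only [← e, ins_pr]

end Coord


end SingC2


open MeasureTheory

theorem singular_set_C2_rectifiable {n : ℕ} (hn : 1 ≤ n)
    {K : Set (EuclideanSpace ℝ (Fin n))} (hK : K.Nonempty) (hKclosed : IsClosed K) :
    ∃ (f : ℕ → EuclideanSpace ℝ (Fin (n - 1)) → EuclideanSpace ℝ (Fin n))
      (N : Set (EuclideanSpace ℝ (Fin n))),
      (∀ i, ContDiff ℝ 2 (f i)) ∧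
      μH[(n : ℝ) - 1] N = 0 ∧
      {x | ¬ DifferentiableAt ℝ (fun y => Metric.infDist y K ^ 2) x} ⊆
        N ∪ ⋃ i, Set.range (f i) := by
  obtain ⟨m, rfl⟩ : ∃ m, n = m + 1 := ⟨n - 1, by omega⟩
  have h := SingC2.main_succ hK hKclosed
  have e : (((m + 1 : ℕ) : ℝ) - 1) = (m : ℝ) := by push_cast; ring
  rw [e]
  exact h
end
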